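/- The depth function restricted to polynomials over ℚ is computable: there is a computable function which, given any (k,n)-ary polynomial p over ℚ (k ≥ 2, n ≥ 1), outputs dep(H) ∈ ω ∪ {∞}, where H is the zero k-hypergraph of p. -/

import Mathlib

open Cardinal

universe u v

/-- `f` is one-to-one in each coordinate: if `a` and `b` differ in exactly one
coordinate, then `f a ≠ f b`. -/
def OneToOneEachCoord {d : ℕ} {X C : Type*} (f : (Fin d → X) → C) : Prop :=
  ∀ a b : Fin d → X, (∃ i, a i ≠ b i ∧ ∀ j, j ≠ i → a j = b j) → f a ≠ f b

/-- `Q` is a homomorphic image of the template `P`: there is a surjection of `P`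
onto `Q` preserving coordinate equalities. -/
def IsHomImage {d : ℕ} {α β : Type*} (P : Finset (Fin d → α)) (Q : Finset (Fin d → β)) : Prop :=
  ∃ f : (Fin d → α) → (Fin d → β),
    (∀ x ∈ P, f x ∈ Q) ∧ (∀ y ∈ Q, ∃ x ∈ P, f x = y) ∧
    (∀ x ∈ P, ∀ y ∈ P, ∀ i, x i = y i → f x i = f y i)

/-- The edge set of the template hypergraph `L(X^d, P)`: the edges are the
`k`-element subsets of `X^d` that are homomorphic images of `P`. -/
def LEdges (k : ℕ) {d : ℕ} {α : Type*} (P : Finset (Fin d → α)) (X : Type*) :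
    Set (Finset (Fin d → X)) :=
  {Q | Q.card = k ∧ IsHomImage P Q}

/-- Image of a finset (with classical decidable equality). -/
noncomputable def fimg {V W : Type*} (g : V → W) (e : Finset V) : Finset W :=
  @Finset.image _ _ (Classical.decEq W) g e

/-- `g` is an embedding of the hypergraph with edge set `E₁` into the one with
edge set `E₂`: an injection on vertices mapping every edge to an edge. -/
def IsHGEmbedding {V W : Type*} (E₁ : Set (Finset V)) (E₂ : Set (Finset W)) (g : V → W) : Prop :=
  Function.Injective g ∧ ∀ e ∈ E₁, fimg g e ∈ E₂

def Embeddable {V W : Type*} (E₁ : Set (Finset V)) (E₂ : Set (Finset W)) : Prop :=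
  ∃ g, IsHGEmbedding E₁ E₂ g

/-- The hypergraph with edge set `E` has a coloring with at most `κ` colors
that is not constant on any edge. -/
def ProperlyColorable {V : Type u} (E : Set (Finset V)) (κ : Cardinal.{u}) : Prop :=
  ∃ (C : Type u) (φ : V → C), #C ≤ κ ∧ ∀ e ∈ E, ∃ x ∈ e, ∃ y ∈ e, φ x ≠ φ y

/-- The chromatic number: the least `κ` admitting a proper `κ`-coloring. -/
noncomputable def chromaticNumber {V : Type u} (E : Set (Finset V)) : Cardinal.{u} :=
  sInf {κ | ProperlyColorable E κ}

/-- The edge set of the zero `k`-hypergraph of a `(k,n)`-ary real polynomial: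
the `k`-element subsets of `ℝ^n` admitting an enumeration on which `p` vanishes. -/
def zeroEdges (k n : ℕ) (p : MvPolynomial (Fin k × Fin n) ℝ) : Set (Finset (Fin n → ℝ)) :=
  {s | ∃ a : Fin k → (Fin n → ℝ), Function.Injective a ∧
        fimg a Finset.univ = s ∧ MvPolynomial.eval (fun v => a v.1 v.2) p = 0}

/-- `I` is a distinguisher for the template `P`: any two distinct elements of `P`
differ at some coordinate in `I`. -/
def IsDistinguisher {d : ℕ} {α : Type*} (P : Finset (Fin d → α)) (I : Finset (Fin d)) : Prop :=
  ∀ x ∈ P, ∀ y ∈ P, x ≠ y → ∃ i ∈ I, x i ≠ y i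

/-- `e(P)`: the least cardinality of a distinguisher for `P`. -/
noncomputable def eT {d : ℕ} {α : Type*} (P : Finset (Fin d → α)) : ℕ :=
  sInf {e | ∃ I : Finset (Fin d), IsDistinguisher P I ∧ I.card = e}

/-- The set of `δ < ω` witnessing the depth of a `k`-hypergraph: there is a
`d`-dimensional `k`-template `P` with `e(P) = δ + 1` such that `L(M^d, P)` is
embeddable into the hypergraph for every `M < ω`.  The depth `dep(H)` is the
least element of this set, and is `∞` exactly when this set is empty. -/
def DepthSet (k : ℕ) {V : Type*} (E : Set (Finset V)) : Set ℕ :=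
  {δ | ∃ (d : ℕ) (α : Type) (P : Finset (Fin d → α)), P.card = k ∧ eT P = δ + 1 ∧
       ∀ M : ℕ, Embeddable (LEdges k P (Fin M)) E}

/-- Codes for polynomials over `ℚ`: a list of monomials, each given by a rational
coefficient together with a list of exponents. -/
abbrev PolyCode : Type := List (ℚ × List ℕ)

/-- Decoding a code into a `(k,n)`-ary polynomial over `ℚ`: the variable `x_{i,j}`
(`i < k`, `j < n`) gets the exponent stored at position `i * n + j` of the exponent
list.  Every `(k,n)`-ary polynomial over `ℚ` is `decodePoly k n c` for some code `c`,
so this is a natural computable encoding of such polynomials. -/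
noncomputable def decodePoly (k n : ℕ) (c : PolyCode) : MvPolynomial (Fin k × Fin n) ℚ :=
  (c.map fun e =>
    (MvPolynomial.C e.1 : MvPolynomial (Fin k × Fin n) ℚ) *
      ∏ v : Fin k × Fin n, MvPolynomial.X v ^ (e.2.getD (v.1.1 * n + v.2.1) 0)).sum

/-- The edge set of the zero `k`-hypergraph of a `(k,n)`-ary polynomial over `ℚ`. -/
def zeroEdgesQ (k n : ℕ) (p : MvPolynomial (Fin k × Fin n) ℚ) : Set (Finset (Fin n → ℝ)) :=
  {s | ∃ a : Fin k → (Fin n → ℝ), Function.Injective a ∧ fimg a Finset.univ = s ∧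
        MvPolynomial.aeval (fun v : Fin k × Fin n => a v.1 v.2) p = (0 : ℝ)}

attribute [fun_prop] Primrec

namespace PR

variable {α β γ δ : Type*} [Primcodable α] [Primcodable β] [Primcodable γ] [Primcodable δ]

@[fun_prop] theorem pr_id : Primrec (fun a : α => a) := Primrec.id

@[fun_prop] theorem pr_const (b : β) : Primrec (fun _ : α => b) := Primrec.const b

@[fun_prop] theorem pr_comp {f : β → γ} {g : α → β} (hf : Primrec f) (hg : Primrec g) :
    Primrec (fun a => f (g a)) := hf.comp hg

@[fun_prop] theorem pr_fst {f : α → β × γ} (h : Primrec f) : Primrec (fun a : α => (f a).1) :=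
  Primrec.fst.comp h

@[fun_prop] theorem pr_snd {f : α → β × γ} (h : Primrec f) : Primrec (fun a : α => (f a).2) :=
  Primrec.snd.comp h

@[fun_prop] theorem pr_pair {f : α → β} {g : α → γ} (hf : Primrec f) (hg : Primrec g) :
    Primrec (fun a => (f a, g a)) := hf.pair hg

@[fun_prop] theorem pr_map {f : α → List β} {g : α → β → γ} (h : Primrec f)
    (hg : Primrec (fun p : α × β => g p.1 p.2)) : Primrec (fun a : α => (f a).map (g a)) :=
  Primrec.list_map h hg

@[fun_prop] theorem pr_flatMap {f : α → List β} {g : α → β → List γ} (h : Primrec f)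
    (hg : Primrec (fun p : α × β => g p.1 p.2)) : Primrec (fun a : α => (f a).flatMap (g a)) :=
  Primrec.list_flatMap h hg

@[fun_prop] theorem pr_foldl {f : α → List β} {g : α → γ → β → γ} {i : α → γ}
    (hg : Primrec (fun p : α × γ × β => g p.1 p.2.1 p.2.2)) (hi : Primrec i) (h : Primrec f) :
    Primrec (fun a : α => (f a).foldl (g a) (i a)) :=
  Primrec.list_foldl (h := fun a p => g a p.1 p.2) h hi hg

@[fun_prop] theorem pr_foldr {f : α → List β} {g : α → β → γ → γ} {i : α → γ}
    (hg : Primrec (fun p : α × β × γ => g p.1 p.2.1 p.2.2)) (hi : Primrec i) (h : Primrec f) :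
    Primrec (fun a : α => (f a).foldr (g a) (i a)) :=
  Primrec.list_foldr (h := fun a p => g a p.1 p.2) h hi hg

@[fun_prop] theorem pr_append {f g : α → List β} (hf : Primrec f) (hg : Primrec g) :
    Primrec (fun a => f a ++ g a) := Primrec.list_append.comp hf hg

@[fun_prop] theorem pr_cons {f : α → β} {g : α → List β} (hf : Primrec f) (hg : Primrec g) :
    Primrec (fun a => f a :: g a) := Primrec.list_cons.comp hf hg

@[fun_prop] theorem pr_length {f : α → List β} (hf : Primrec f) :
    Primrec (fun a => (f a).length) := Primrec.list_length.comp hf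

@[fun_prop] theorem pr_range {f : α → ℕ} (hf : Primrec f) :
    Primrec (fun a => List.range (f a)) := Primrec.list_range.comp hf

@[fun_prop] theorem pr_oget {f : α → Option β} {d : α → β} (hf : Primrec f) (hd : Primrec d) :
    Primrec (fun a => (f a).getD (d a)) := Primrec.option_getD.comp hf hd

@[fun_prop] theorem pr_getD {f : α → List β} {i : α → ℕ} {d : α → β} (hf : Primrec f)
    (hi : Primrec i) (hd : Primrec d) : Primrec (fun a => (f a).getD (i a) (d a)) := by
  have : Primrec (fun a => ((f a)[i a]?).getD (d a)) :=
    Primrec.option_getD.comp (Primrec.list_getElem?.comp hf hi) hd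
  exact this.of_eq fun a => by simp [List.getD_eq_getElem?_getD]

@[fun_prop] theorem pr_add {f g : α → ℕ} (hf : Primrec f) (hg : Primrec g) :
    Primrec (fun a => f a + g a) := Primrec.nat_add.comp hf hg

@[fun_prop] theorem pr_sub {f g : α → ℕ} (hf : Primrec f) (hg : Primrec g) :
    Primrec (fun a => f a - g a) := Primrec.nat_sub.comp hf hg

@[fun_prop] theorem pr_mul {f g : α → ℕ} (hf : Primrec f) (hg : Primrec g) :
    Primrec (fun a => f a * g a) := Primrec.nat_mul.comp hf hg

@[fun_prop] theorem pr_div {f g : α → ℕ} (hf : Primrec f) (hg : Primrec g) :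
    Primrec (fun a => f a / g a) := Primrec.nat_div.comp hf hg

@[fun_prop] theorem pr_mod {f g : α → ℕ} (hf : Primrec f) (hg : Primrec g) :
    Primrec (fun a => f a % g a) := Primrec.nat_mod.comp hf hg

@[fun_prop] theorem pr_iterate {f : α → ℕ} {g : α → β} {h : α → β → β} (hf : Primrec f)
    (hg : Primrec g) (hh : Primrec (fun p : α × β => h p.1 p.2)) :
    Primrec (fun a => (h a)^[f a] (g a)) := Primrec.nat_iterate hf hg hh

@[fun_prop] theorem pr_pow {f g : α → ℕ} (hf : Primrec f) (hg : Primrec g) :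
    Primrec (fun a => f a ^ g a) := by
  have : Primrec (fun a => (fun x => x * f a)^[g a] 1) := by fun_prop
  refine this.of_eq fun a => ?_
  generalize g a = n
  induction n with
  | zero => simp
  | succ n ih => rw [Function.iterate_succ_apply', ih, pow_succ]

@[fun_prop] theorem pr_cond {c : α → Bool} {f g : α → β} (hc : Primrec c) (hf : Primrec f)
    (hg : Primrec g) : Primrec (fun a => cond (c a) (f a) (g a)) := Primrec.cond hc hf hg

@[fun_prop] theorem pr_beq [BEq β] [LawfulBEq β] {f g : α → β} (hf : Primrec f) (hg : Primrec g) :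
    Primrec (fun a => f a == g a) := by
  classical
  refine ((Primrec.beq (α := β)).comp hf hg).of_eq fun a => ?_
  by_cases h : f a = g a <;> simp [h]

@[fun_prop] theorem pr_and {f g : α → Bool} (hf : Primrec f) (hg : Primrec g) :
    Primrec (fun a => f a && g a) := Primrec.and.comp hf hg

@[fun_prop] theorem pr_or {f g : α → Bool} (hf : Primrec f) (hg : Primrec g) :
    Primrec (fun a => f a || g a) := Primrec.or.comp hf hg

@[fun_prop] theorem pr_not {f : α → Bool} (hf : Primrec f) :
    Primrec (fun a => ! f a) := Primrec.not.comp hf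

@[fun_prop] theorem pr_bne [BEq β] [LawfulBEq β] {f g : α → β} (hf : Primrec f) (hg : Primrec g) :
    Primrec (fun a => f a != g a) := pr_not (pr_beq hf hg)

@[fun_prop] theorem pr_ite [DecidableEq γ] {s t : α → γ} {f g : α → β} (hs : Primrec s)
    (ht : Primrec t) (hf : Primrec f) (hg : Primrec g) :
    Primrec (fun a => if s a = t a then f a else g a) :=
  Primrec.ite (Primrec.eq.comp hs ht) hf hg

@[fun_prop] theorem pr_ite_lt {s t : α → ℕ} {f g : α → β} (hs : Primrec s)
    (ht : Primrec t) (hf : Primrec f) (hg : Primrec g) :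
    Primrec (fun a => if s a < t a then f a else g a) :=
  Primrec.ite (Primrec.nat_lt.comp hs ht) hf hg

@[fun_prop] theorem pr_ite_le {s t : α → ℕ} {f g : α → β} (hs : Primrec s)
    (ht : Primrec t) (hf : Primrec f) (hg : Primrec g) :
    Primrec (fun a => if s a ≤ t a then f a else g a) :=
  Primrec.ite (Primrec.nat_le.comp hs ht) hf hg

@[fun_prop] theorem pr_filter {f : α → List β} {p : α → β → Bool} (hf : Primrec f)
    (hp : Primrec (fun q : α × β => p q.1 q.2)) : Primrec (fun a => (f a).filter (p a)) := by
  have : Primrec (fun a => (f a).flatMap fun b => cond (p a b) [b] []) := by fun_prop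
  refine this.of_eq fun a => ?_
  induction f a with
  | nil => rfl
  | cons b l ih => cases h : p a b <;> simp_all [List.flatMap_cons]

@[fun_prop] theorem pr_any {f : α → List β} {p : α → β → Bool} (hf : Primrec f)
    (hp : Primrec (fun q : α × β => p q.1 q.2)) : Primrec (fun a => (f a).any (p a)) := by
  have : Primrec (fun a => (f a).foldr (fun b r => p a b || r) false) := by fun_prop
  refine this.of_eq fun a => ?_
  induction f a with
  | nil => rfl
  | cons b l ih => simp_all

@[fun_prop] theorem pr_all {f : α → List β} {p : α → β → Bool} (hf : Primrec f)
    (hp : Primrec (fun q : α × β => p q.1 q.2)) : Primrec (fun a => (f a).all (p a)) := by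
  have : Primrec (fun a => (f a).foldr (fun b r => p a b && r) true) := by fun_prop
  refine this.of_eq fun a => ?_
  induction f a with
  | nil => rfl
  | cons b l ih => simp_all

@[fun_prop] theorem pr_lookup [BEq β] [LawfulBEq β] {f : α → β} {l : α → List (β × γ)}
    (hf : Primrec f) (hl : Primrec l) : Primrec (fun a => (l a).lookup (f a)) := by
  classical
  refine (Primrec.listLookup.comp hf hl).of_eq fun a => ?_
  congr 1
  ext x y
  simp

end PR

namespace QE
open PR

/-- A monomial: `(a, b, L)` stands for `(a - b) * ∏ l ∈ L, x_l`. -/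
abbrev Mono := ℕ × ℕ × List ℕ
/-- Integer polynomials in countably many variables. -/
abbrev Po := List Mono
/-- Univariate polynomials with coefficients in `Po`, lowest coefficient first. -/
abbrev UP := List Po

/-- Value of a monomial. -/
def evM (v : ℕ → ℝ) (m : Mono) : ℝ := ((m.1 : ℝ) - (m.2.1 : ℝ)) * (m.2.2.map v).prod

/-- Value of a polynomial. -/
def ev (v : ℕ → ℝ) (p : Po) : ℝ := (p.map (evM v)).sum

/-- Extend an environment by a new value for variable `0`. -/
def cons (y : ℝ) (v : ℕ → ℝ) : ℕ → ℝ := fun i => Nat.casesOn i y v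

namespace Po

/-- Negation. -/
def neg (p : Po) : Po := p.map fun m => (m.2.1, m.1, m.2.2)

/-- Product. -/
def mul (p q : Po) : Po := p.flatMap fun m => q.map fun m' =>
  (m.1 * m'.1 + m.2.1 * m'.2.1, m.1 * m'.2.1 + m.2.1 * m'.1, m.2.2 ++ m'.2.2)

/-- Multiplication by a natural number. -/
def nsmul (n : ℕ) (p : Po) : Po := p.map fun m => (n * m.1, n * m.2.1, m.2.2)

end Po

@[simp] theorem ev_nil (v) : ev v [] = 0 := rfl
@[simp] theorem ev_cons (v m p) : ev v (m :: p) = evM v m + ev v p := by simp [ev]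
@[simp] theorem ev_append (v p q) : ev v (p ++ q) = ev v p + ev v q := by simp [ev]

@[simp] theorem ev_neg (v p) : ev v (Po.neg p) = - ev v p := by
  induction p with
  | nil => simp [Po.neg]
  | cons m p ih =>
    simp only [Po.neg, List.map_cons, ev_cons] at ih ⊢
    rw [ih]; simp [evM]; ring

@[simp] theorem ev_nsmul (v n p) : ev v (Po.nsmul n p) = n * ev v p := by
  induction p with
  | nil => simp [Po.nsmul]
  | cons m p ih =>
    simp only [Po.nsmul, List.map_cons, ev_cons] at ih ⊢
    rw [ih]; simp [evM]; ring

theorem ev_mono_mul (v : ℕ → ℝ) (m : Mono) (q : Po) : ev v (q.map fun m' =>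
    (m.1 * m'.1 + m.2.1 * m'.2.1, m.1 * m'.2.1 + m.2.1 * m'.1, m.2.2 ++ m'.2.2))
      = evM v m * ev v q := by
  induction q with
  | nil => simp
  | cons m' q ih =>
    simp only [List.map_cons, ev_cons] at ih ⊢
    rw [ih]; simp [evM]; ring

@[simp] theorem ev_mul (v p q) : ev v (Po.mul p q) = ev v p * ev v q := by
  induction p with
  | nil => simp [Po.mul]
  | cons m p ih =>
    simp only [Po.mul, List.flatMap_cons, ev_cons, ev_append] at ih ⊢
    rw [ih, ev_mono_mul]; ring

section prim
variable {α : Type*} [Primcodable α]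

@[fun_prop] theorem pr_neg {f : α → Po} (hf : Primrec f) : Primrec fun a => Po.neg (f a) := by
  unfold Po.neg; fun_prop

@[fun_prop] theorem pr_nsmul {n : α → ℕ} {f : α → Po} (hn : Primrec n) (hf : Primrec f) :
    Primrec fun a => Po.nsmul (n a) (f a) := by
  unfold Po.nsmul; fun_prop

@[fun_prop] theorem pr_pmul {f g : α → Po} (hf : Primrec f) (hg : Primrec g) :
    Primrec fun a => Po.mul (f a) (g a) := by
  unfold Po.mul; fun_prop

end prim

/-- Coefficient of `x_0 ^ i`, with the other variables shifted down. -/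
def coefAt (p : Po) (i : ℕ) : Po :=
  (p.filter fun m => (m.2.2.filter fun x => x == 0).length == i).map fun m =>
    (m.1, m.2.1, (m.2.2.filter fun x => x != 0).map fun x => x - 1)

/-- A strict bound for the degree. -/
def degB (p : Po) : ℕ := p.foldr (fun m n => m.2.2.length + 1 + n) 1

/-- View a polynomial as a univariate polynomial in the variable `0`. -/
def toUP (p : Po) : UP := (List.range (degB p)).map fun i => coefAt p i

@[fun_prop] theorem pr_coefAt {α : Type*} [Primcodable α] {f : α → Po} {n : α → ℕ} (hf : Primrec f)
    (hn : Primrec n) : Primrec fun a => coefAt (f a) (n a) := by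
  unfold coefAt; fun_prop

@[fun_prop] theorem pr_degB {α : Type*} [Primcodable α] {f : α → Po} (hf : Primrec f) :
    Primrec fun a => degB (f a) := by
  unfold degB; fun_prop

@[fun_prop] theorem pr_toUP {α : Type*} [Primcodable α] {f : α → Po} (hf : Primrec f) :
    Primrec fun a => toUP (f a) := by
  unfold toUP; fun_prop

open Polynomial in
/-- The real univariate polynomial given by a `UP` in an environment. -/
noncomputable def toP (v : ℕ → ℝ) (p : UP) : ℝ[X] :=
  ∑ i ∈ Finset.range p.length, Polynomial.C (ev v (p.getD i [])) * Polynomial.X ^ i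

theorem coeff_toP (v : ℕ → ℝ) (p : UP) (i : ℕ) : (toP v p).coeff i = ev v (p.getD i []) := by
  unfold toP
  simp only [Polynomial.finsetSum_coeff, Polynomial.coeff_C_mul, Polynomial.coeff_X_pow]
  by_cases h : i < p.length
  · rw [Finset.sum_eq_single i]
    · simp
    · intro b _ hb; simp [Ne.symm hb]
    · intro h'; simp at h'; omega
  · rw [Finset.sum_eq_zero]
    · rw [List.getD_eq_default _ _ (by omega)]; simp
    · intro j hj
      simp at hj
      have : i ≠ j := by omega
      simp [this]

theorem evM_cons (y : ℝ) (v : ℕ → ℝ) (m : Mono) :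
    evM (cons y v) m = y ^ (m.2.2.filter fun x => x == 0).length *
      evM v (m.1, m.2.1, (m.2.2.filter fun x => x != 0).map fun x => x - 1) := by
  obtain ⟨a, b, L⟩ := m
  have : (L.map (cons y v)).prod = y ^ (L.filter fun x => x == 0).length *
      (((L.filter fun x => x != 0).map fun x => x - 1).map v).prod := by
    induction L with
    | nil => simp
    | cons x L ih =>
      rcases x with _ | x
      · simp only [List.map_cons, List.prod_cons, ih]
        simp [cons, pow_succ]; ring
      · simp only [List.map_cons, List.prod_cons, ih]
        simp [cons]; ring
  simp only [evM, this]; ring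

theorem ev_cons_sum (y : ℝ) (v : ℕ → ℝ) (N : ℕ) (p : Po)
    (hN : ∀ m ∈ p, (m.2.2.filter fun x => x == 0).length < N) :
    ∑ i ∈ Finset.range N, ev v (coefAt p i) * y ^ i = ev (cons y v) p := by
  induction p with
  | nil => simp [coefAt]
  | cons m p ih =>
    have ih := ih fun m' hm' => hN m' (List.mem_cons_of_mem _ hm')
    have h0 := hN m List.mem_cons_self
    have key : ∀ i, ev v (coefAt (m :: p) i) =
        (if (m.2.2.filter fun x => x == 0).length = i then
          evM v (m.1, m.2.1, (m.2.2.filter fun x => x != 0).map fun x => x - 1) else 0) +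
        ev v (coefAt p i) := by
      intro i
      unfold coefAt
      by_cases h : (m.2.2.filter fun x => x == 0).length = i
      · rw [List.filter_cons_of_pos (by simpa using h)]
        rw [List.map_cons, ev_cons, if_pos h]
      · rw [List.filter_cons_of_neg (by simpa using h), if_neg h, zero_add]
    simp only [key, add_mul, Finset.sum_add_distrib, ih, ev_cons, evM_cons]
    congr 1
    rw [Finset.sum_eq_single (m.2.2.filter fun x => x == 0).length]
    · simp; ring
    · intro b _ hb; simp [Ne.symm hb]
    · intro h; simp at h; omega

theorem eval_toUP (v : ℕ → ℝ) (y : ℝ) (p : Po) :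
    (toP v (toUP p)).eval y = ev (cons y v) p := by
  have hN : ∀ m ∈ p, (m.2.2.filter fun x => x == 0).length < degB p := by
    intro m hm
    have h1 := List.length_filter_le (fun x => x == 0) m.2.2
    have h2 : m.2.2.length < degB p := by
      clear h1
      induction p with
      | nil => simp at hm
      | cons m' p ih =>
        simp only [degB, List.foldr_cons] at ih ⊢
        rcases List.mem_cons.1 hm with h | h
        · subst h; omega
        · have := ih h; omega
    omega
  rw [← ev_cons_sum y v _ p hN]
  unfold toP
  rw [Polynomial.eval_finsetSum]
  simp only [toUP, List.length_map, List.length_range]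
  refine Finset.sum_congr rfl fun i hi => ?_
  simp at hi
  simp [List.getD_eq_getElem?_getD, hi]

end QE

namespace QE
open PR Polynomial

/-- Leading (formal) coefficient. -/
def lc (p : UP) : Po := p.getD (p.length - 1) []

/-- Derivative. -/
def deriv (p : UP) : UP :=
  (List.range (p.length - 1)).map fun i => Po.nsmul (i + 1) (p.getD (i + 1) [])

/-- Remove the leading coefficient. -/
def trunc (p : UP) : UP := (List.range (p.length - 1)).map fun i => p.getD i []

/-- One step of pseudo-division of `p` by `q`, scaling by the square of `lc q`. -/
def premStep (q p : UP) : UP :=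
  (List.range (p.length - 1)).map fun i =>
    Po.mul (Po.mul (lc q) (lc q)) (p.getD i []) ++
      (if p.length - q.length ≤ i then
        Po.neg (Po.mul (Po.mul (lc q) (lc p)) (q.getD (i - (p.length - q.length)) [])) else [])

/-- Pseudo-remainder. -/
def prem (p q : UP) : UP := (premStep q)^[p.length + 1 - q.length] p

section prim
variable {α : Type*} [Primcodable α] {f g : α → UP}

@[fun_prop] theorem pr_lc (hf : Primrec f) : Primrec fun a => lc (f a) := by
  unfold lc; fun_prop

@[fun_prop] theorem pr_deriv (hf : Primrec f) : Primrec fun a => deriv (f a) := by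
  unfold deriv; fun_prop

@[fun_prop] theorem pr_trunc (hf : Primrec f) : Primrec fun a => trunc (f a) := by
  unfold trunc; fun_prop

@[fun_prop] theorem pr_premStep (hf : Primrec f) (hg : Primrec g) :
    Primrec fun a => premStep (f a) (g a) := by
  unfold premStep; fun_prop

@[fun_prop] theorem pr_prem (hf : Primrec f) (hg : Primrec g) :
    Primrec fun a => prem (f a) (g a) := by
  unfold prem; fun_prop

end prim

theorem getD_rangeMap {β : Type*} (n : ℕ) (f : ℕ → β) (i : ℕ) (d : β) :
    ((List.range n).map f).getD i d = if i < n then f i else d := by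
  by_cases h : i < n
  · simp [List.getD_eq_getElem?_getD, h]
  · rw [if_neg h, List.getD_eq_default _ _ (by simpa using h)]

theorem length_deriv (p : UP) : (deriv p).length = p.length - 1 := by simp [deriv]
theorem length_trunc (p : UP) : (trunc p).length = p.length - 1 := by simp [trunc]
theorem length_premStep (q p : UP) : (premStep q p).length = p.length - 1 := by simp [premStep]

theorem length_iter_premStep (q : UP) (n : ℕ) (p : UP) :
    ((premStep q)^[n] p).length = p.length - n := by
  induction n generalizing p with
  | zero => simp
  | succ n ih => rw [Function.iterate_succ_apply, ih, length_premStep]; omega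

theorem length_prem (p q : UP) (hq : q ≠ []) : (prem p q).length < q.length := by
  have := List.length_pos_iff.2 hq
  rw [prem, length_iter_premStep]; omega

theorem prem_of_lt (p q : UP) (h : p.length < q.length) : prem p q = p := by
  rw [prem, show p.length + 1 - q.length = 0 by omega]; rfl

theorem toP_deriv (v : ℕ → ℝ) (p : UP) : toP v (deriv p) = (toP v p).derivative := by
  ext i
  rw [coeff_toP, Polynomial.coeff_derivative, coeff_toP, deriv, getD_rangeMap]
  split_ifs with h
  · simp; ring
  · rw [List.getD_eq_default _ _ (by omega)]; simp

theorem toP_trunc (v : ℕ → ℝ) (p : UP) (h : ev v (lc p) = 0) : toP v (trunc p) = toP v p := by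
  ext i
  rw [coeff_toP, coeff_toP, trunc, getD_rangeMap]
  split_ifs with hi
  · rfl
  · by_cases h' : i = p.length - 1
    · subst h'; simpa [lc] using h.symm
    · rw [List.getD_eq_default p _ (by omega)]

theorem toP_premStep (v : ℕ → ℝ) (q p : UP) (hq : q ≠ []) (hl : q.length ≤ p.length) :
    toP v (premStep q p) = C (ev v (lc q) ^ 2) * toP v p -
      C (ev v (lc q) * ev v (lc p)) * (X ^ (p.length - q.length) * toP v q) := by
  have hq0 := List.length_pos_iff.2 hq
  ext i
  rw [Polynomial.coeff_sub, Polynomial.coeff_C_mul, Polynomial.coeff_C_mul,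
    Polynomial.coeff_X_pow_mul']
  rw [coeff_toP, coeff_toP, coeff_toP, premStep, getD_rangeMap]
  split_ifs with h1 h2
  · simp; ring
  · simp only [ev_append, ev_mul, ev_nil, mul_zero, sub_zero]; ring
  · by_cases h' : i = p.length - 1
    · subst h'
      have : p.length - 1 - (p.length - q.length) = q.length - 1 := by omega
      rw [this]; simp [lc]; ring
    · rw [List.getD_eq_default p _ (by omega), List.getD_eq_default q _ (by omega)]; simp
  · rw [List.getD_eq_default p _ (by omega)]; simp

/-- The sign of a real number, coded as `0`, `1` (positive), `2` (negative). -/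
noncomputable def sgn (x : ℝ) : ℕ := if x = 0 then 0 else if 0 < x then 1 else 2

@[simp] theorem sgn_eq_zero {x : ℝ} : sgn x = 0 ↔ x = 0 := by
  unfold sgn; split_ifs <;> simp_all

@[simp] theorem sgn_eq_one {x : ℝ} : sgn x = 1 ↔ 0 < x := by
  unfold sgn; split_ifs with h <;> simp_all

@[simp] theorem sgn_eq_two {x : ℝ} : sgn x = 2 ↔ x < 0 := by
  unfold sgn; split_ifs with h h' <;> simp_all
  · exact le_of_lt h'
  · exact lt_of_le_of_ne h' h

theorem sgn_cases (x : ℝ) : sgn x = 0 ∨ sgn x = 1 ∨ sgn x = 2 := by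
  unfold sgn; split_ifs <;> simp

theorem sgn_pos_mul {c x : ℝ} (hc : 0 < c) : sgn (c * x) = sgn x := by
  unfold sgn
  simp [hc.ne', hc]

/-- Coded sign of the negation. -/
def flip (s : ℕ) : ℕ := if s = 1 then 2 else if s = 2 then 1 else 0

@[fun_prop] theorem pr_flip {α : Type*} [Primcodable α] {f : α → ℕ} (hf : Primrec f) :
    Primrec fun a => flip (f a) := by
  unfold flip; fun_prop

theorem sgn_neg (x : ℝ) : sgn (-x) = flip (sgn x) := by
  rcases lt_trichotomy x 0 with h | h | h
  · rw [sgn_eq_two.2 h, sgn_eq_one.2 (by linarith)]; rfl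
  · subst h; simp [flip]
  · rw [sgn_eq_one.2 h, sgn_eq_two.2 (by linarith)]; rfl

theorem sgn_prem (v : ℕ → ℝ) (p q : UP) (y : ℝ) (hq : q ≠ []) (hl : ev v (lc q) ≠ 0)
    (hy : (toP v q).eval y = 0) :
    sgn ((toP v (prem p q)).eval y) = sgn ((toP v p).eval y) := by
  have hq0 := List.length_pos_iff.2 hq
  unfold prem
  have : ∀ n ≤ p.length + 1 - q.length,
      sgn ((toP v ((premStep q)^[n] p)).eval y) = sgn ((toP v p).eval y) := by
    intro n
    induction n with
    | zero => intro _; rfl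
    | succ n ih =>
      intro hn
      rw [← ih (by omega), Function.iterate_succ_apply', toP_premStep v q _ hq
        (by rw [length_iter_premStep]; omega)]
      simp only [eval_sub, eval_mul, eval_C, hy, mul_zero, sub_zero]
      exact sgn_pos_mul (by positivity)
  exact this _ le_rfl

theorem natDegree_toP (v : ℕ → ℝ) (p : UP) (h : ev v (lc p) ≠ 0) :
    (toP v p).natDegree = p.length - 1 := by
  apply Polynomial.natDegree_eq_of_le_of_coeff_ne_zero
  · rw [Polynomial.natDegree_le_iff_coeff_eq_zero]
    intro N hN
    rw [coeff_toP, List.getD_eq_default _ _ (by omega)]; rfl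
  · rw [coeff_toP]; exact h

theorem leadingCoeff_toP (v : ℕ → ℝ) (p : UP) (h : ev v (lc p) ≠ 0) :
    (toP v p).leadingCoeff = ev v (lc p) := by
  rw [Polynomial.leadingCoeff, natDegree_toP v p h, coeff_toP]; rfl

open Filter in
theorem sgn_eventually_atTop (P : ℝ[X]) (h : 0 < P.natDegree) :
    ∀ᶠ y in atTop, sgn (P.eval y) = sgn P.leadingCoeff := by
  have hd : 0 < P.degree := Polynomial.natDegree_pos_iff_degree_pos.1 h
  have h0 : P ≠ 0 := by rintro rfl; simp at h
  rcases lt_or_gt_of_ne (Polynomial.leadingCoeff_ne_zero.2 h0) with hl | hl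
  · have := P.tendsto_atBot_of_leadingCoeff_nonpos hd hl.le
    filter_upwards [this.eventually (eventually_lt_atBot 0)] with y hy
    rw [sgn_eq_two.2 hy, sgn_eq_two.2 hl]
  · have := P.tendsto_atTop_of_leadingCoeff_nonneg hd hl.le
    filter_upwards [this.eventually (eventually_gt_atTop 0)] with y hy
    rw [sgn_eq_one.2 hy, sgn_eq_one.2 hl]

open Filter in
theorem sgn_eventually_atBot (P : ℝ[X]) (h : 0 < P.natDegree) :
    ∀ᶠ y in atBot, sgn (P.eval y) =
      if P.natDegree % 2 = 0 then sgn P.leadingCoeff else flip (sgn P.leadingCoeff) := by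
  have hX : (-X : ℝ[X]).natDegree = 1 := by simp
  have hd : (P.comp (-X)).natDegree = P.natDegree := by
    rw [Polynomial.natDegree_comp, hX, mul_one]
  have hlc : (P.comp (-X)).leadingCoeff = P.leadingCoeff * (-1) ^ P.natDegree := by
    rw [Polynomial.leadingCoeff_comp (by rw [hX]; simp)]; simp
  have h1 := sgn_eventually_atTop (P.comp (-X)) (by omega)
  have := tendsto_neg_atBot_atTop.eventually h1
  filter_upwards [this] with y hy
  simp only [eval_comp, eval_neg, eval_X, neg_neg] at hy
  rw [hy, hlc]
  split_ifs with he
  · rw [Even.neg_one_pow (Nat.even_iff.2 he), mul_one]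
  · rw [Odd.neg_one_pow (Nat.odd_iff.2 (by omega)), mul_neg_one, sgn_neg]

end QE

namespace QE
open PR Polynomial

/-- Sign information on a cell. -/
abbrev Col := List (UP × ℕ)
/-- A root: a polynomial vanishing there, its column, and the column of the next interval. -/
abbrev Ent := UP × Col × Col

/-- Insert `p` in an interval column, given the signs of `p` at both ends. -/
def seg (p : UP) (sL : ℕ) (c : Col) (sR : ℕ) : Col × List Ent :=
  if sL = 0 then ((p, sR) :: c, []) else
  if sR = 0 then ((p, sL) :: c, []) else
  if sL = sR then ((p, sL) :: c, []) else
  ((p, sL) :: c, [(p, (p, 0) :: c, (p, sR) :: c)])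

/-- Look up a sign. -/
def look (c : Col) (p : UP) : ℕ := (c.lookup p).getD 0

/-- Insert `p` at a root and the interval following it. -/
def mainStep (p : UP) (e : Ent) (r : ℕ × List Ent) : ℕ × List Ent :=
  let s := look e.2.1 (prem p e.1)
  let g := seg p s e.2.2 r.1
  (s, (e.1, (p, s) :: e.2.1, g.1) :: (g.2 ++ r.2))

/-- Insert a polynomial of positive degree with leading sign `s`. -/
def procMain (p : UP) (s : ℕ) (st : Col × List Ent) : Col × List Ent :=
  let r := st.2.foldr (mainStep p) (s, [])
  let g := seg p (if p.length % 2 = 1 then s else flip s) st.1 r.1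
  (g.1, g.2 ++ r.2)

/-- Sign of a coefficient according to an assignment. -/
def sg (A : List (Po × ℕ)) (c : Po) : ℕ := (A.lookup c).getD 0

/-- Sign of a polynomial in a column in the cases where no new root appears. -/
def uni (A : List (Po × ℕ)) (p : UP) (c : Col) : ℕ :=
  if p.length = 0 then 0 else if sg A (lc p) = 0 then look c (trunc p) else sg A (lc p)

/-- Insert a polynomial without introducing new roots. -/
def procU (A : List (Po × ℕ)) (p : UP) (st : Col × List Ent) : Col × List Ent :=
  ((p, uni A p st.1) :: st.1,
    st.2.map fun e => (e.1, (p, uni A p e.2.1) :: e.2.1, (p, uni A p e.2.2) :: e.2.2))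

/-- Insert a polynomial in the sign table. -/
def proc (A : List (Po × ℕ)) (p : UP) (st : Col × List Ent) : Col × List Ent :=
  if p.length ≤ 1 then procU A p st else
  if sg A (lc p) = 0 then procU A p st else procMain p (sg A (lc p)) st

section prim
variable {α : Type*} [Primcodable α] {p : α → UP} {s s' : α → ℕ} {c : α → Col} {e : α → Ent}
  {r : α → ℕ × List Ent} {st : α → Col × List Ent} {A : α → List (Po × ℕ)} {b : α → Po}

@[fun_prop] theorem pr_seg (hp : Primrec p) (hs : Primrec s) (hc : Primrec c) (hs' : Primrec s') :
    Primrec fun a => seg (p a) (s a) (c a) (s' a) := by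
  unfold seg; fun_prop

@[fun_prop] theorem pr_look (hc : Primrec c) (hp : Primrec p) :
    Primrec fun a => look (c a) (p a) := by
  unfold look; fun_prop

@[fun_prop] theorem pr_mainStep (hp : Primrec p) (he : Primrec e) (hr : Primrec r) :
    Primrec fun a => mainStep (p a) (e a) (r a) := by
  unfold mainStep; fun_prop

@[fun_prop] theorem pr_procMain (hp : Primrec p) (hs : Primrec s) (hst : Primrec st) :
    Primrec fun a => procMain (p a) (s a) (st a) := by
  unfold procMain; fun_prop

@[fun_prop] theorem pr_sg (hA : Primrec A) (hb : Primrec b) :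
    Primrec fun a => sg (A a) (b a) := by
  unfold sg; fun_prop

@[fun_prop] theorem pr_uni (hA : Primrec A) (hp : Primrec p) (hc : Primrec c) :
    Primrec fun a => uni (A a) (p a) (c a) := by
  unfold uni; fun_prop

@[fun_prop] theorem pr_procU (hA : Primrec A) (hp : Primrec p) (hst : Primrec st) :
    Primrec fun a => procU (A a) (p a) (st a) := by
  unfold procU; fun_prop

@[fun_prop] theorem pr_proc (hA : Primrec A) (hp : Primrec p) (hst : Primrec st) :
    Primrec fun a => proc (A a) (p a) (st a) := by
  unfold proc; fun_prop

end prim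

/-- A column describes the signs of the polynomials of `D` on `S`. -/
def Val (v : ℕ → ℝ) (D : List UP) (S : Set ℝ) (c : Col) : Prop :=
  ∀ p ∈ D, ∀ y ∈ S, c.lookup p = some (sgn ((toP v p).eval y))

/-- A table describes the signs of the polynomials of `D` to the right of `lo`. -/
def Good (v : ℕ → ℝ) (D : List UP) : EReal → Col → List Ent → Prop
  | lo, c, [] => Val v D {y | lo < y ∧ (y : EReal) < ⊤} c
  | lo, c, e :: t => ∃ x : ℝ, lo < x ∧ Val v D {y | lo < y ∧ (y : EReal) < x} c ∧
      Val v D {x} e.2.1 ∧ e.1 ∈ D ∧ e.1 ≠ [] ∧ ev v (lc e.1) ≠ 0 ∧ (toP v e.1).eval x = 0 ∧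
      Good v D x e.2.2 t

theorem Val.cons {v : ℕ → ℝ} {D : List UP} {S : Set ℝ} {c : Col} (h : Val v D S c) {p : UP} {s : ℕ}
    (hs : ∀ y ∈ S, sgn ((toP v p).eval y) = s) : Val v (p :: D) S ((p, s) :: c) := by
  intro q hq y hy
  rw [List.lookup_cons]
  by_cases hqp : q = p
  · subst hqp; simp [hs y hy]
  · rcases List.mem_cons.1 hq with h' | h'
    · exact absurd h' hqp
    · rw [beq_false_of_ne hqp]; exact h q h' y hy

theorem Val.mono {v : ℕ → ℝ} {D : List UP} {S T : Set ℝ} {c : Col} (h : Val v D S c) (hT : T ⊆ S) :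
    Val v D T c := fun p hp y hy => h p hp y (hT hy)

theorem Val.look {v : ℕ → ℝ} {D : List UP} {S : Set ℝ} {c : Col} (h : Val v D S c) {p : UP}
    (hp : p ∈ D) {y : ℝ} (hy : y ∈ S) : look c p = sgn ((toP v p).eval y) := by
  rw [QE.look, h p hp y hy]; rfl

theorem seg_mono {f : ℝ → ℝ} (hf : Continuous f) {J J' : Set ℝ} (hJ : J ⊆ J')
    (hJJ : ∀ a ∈ J', ∀ b ∈ J', ∀ y, a < y → y < b → y ∈ J) (hne : J.Nonempty)
    (hl : ∀ y ∈ J, ∃ z ∈ J, z < y) (hr : ∀ y ∈ J, ∃ z ∈ J, y < z)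
    (hm : StrictMonoOn f J') {sL sR : ℕ} (hL : ∀ y ∈ J', ∃ z ∈ J', z ≤ y ∧ sgn (f z) = sL)
    (hR : ∀ y ∈ J', ∃ z ∈ J', y ≤ z ∧ sgn (f z) = sR) :
    (sL = 0 → ∀ y ∈ J, sgn (f y) = sR) ∧ (sR = 0 → ∀ y ∈ J, sgn (f y) = sL) ∧
    (sL ≠ 0 → sL = sR → ∀ y ∈ J, sgn (f y) = sL) ∧
    (sL ≠ 0 → sR ≠ 0 → sL ≠ sR → ∃ ξ ∈ J, f ξ = 0 ∧ ∀ y ∈ J,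
      (y < ξ → sgn (f y) = sL) ∧ (ξ < y → sgn (f y) = sR)) := by
  refine ⟨?_, ?_, ?_, ?_⟩
  · rintro rfl y hy
    obtain ⟨y0, hy0, hlt⟩ := hl y hy
    obtain ⟨z, hz, hzy, hs⟩ := hL y0 (hJ hy0)
    obtain ⟨w, hw, hyw, hs'⟩ := hR y (hJ hy)
    rw [sgn_eq_zero] at hs
    have h1 : f z < f y := hm hz (hJ hy) (by linarith)
    have h2 : f y ≤ f w := hm.monotoneOn (hJ hy) hw hyw
    rw [← hs', sgn_eq_one.2 (by linarith), sgn_eq_one.2 (by linarith)]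
  · rintro rfl y hy
    obtain ⟨y0, hy0, hlt⟩ := hr y hy
    obtain ⟨z, hz, hzy, hs⟩ := hL y (hJ hy)
    obtain ⟨w, hw, hyw, hs'⟩ := hR y0 (hJ hy0)
    rw [sgn_eq_zero] at hs'
    have h1 : f y < f w := hm (hJ hy) hw (by linarith)
    have h2 : f z ≤ f y := hm.monotoneOn hz (hJ hy) hzy
    rw [← hs, sgn_eq_two.2 (by linarith), sgn_eq_two.2 (by linarith)]
  · rintro h0 rfl y hy
    obtain ⟨z, hz, hzy, hs⟩ := hL y (hJ hy)
    obtain ⟨w, hw, hyw, hs'⟩ := hR y (hJ hy)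
    have h1 : f y ≤ f w := hm.monotoneOn (hJ hy) hw hyw
    have h2 : f z ≤ f y := hm.monotoneOn hz (hJ hy) hzy
    rcases sgn_cases (f z) with h | h | h
    · exact absurd (hs.symm.trans h) h0
    · rw [← hs, h]; rw [sgn_eq_one] at h ⊢; linarith
    · rw [← hs', hs'.trans (hs.symm.trans h)]
      rw [hs, ← hs', sgn_eq_two] at h; rw [sgn_eq_two]; linarith
  · intro h0 h0' hne'
    obtain ⟨y0, hy0⟩ := hne
    obtain ⟨z, hz, hzy, hs⟩ := hL y0 (hJ hy0)
    obtain ⟨w, hw, hyw, hs'⟩ := hR y0 (hJ hy0)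
    have h12 : f z ≤ f w := hm.monotoneOn hz hw (by linarith)
    have hsL : sL = 2 ∧ sR = 1 := by
      rcases sgn_cases (f z) with h | h | h <;> rcases sgn_cases (f w) with h' | h' | h'
      all_goals first | omega | skip
      rw [sgn_eq_one] at h; rw [sgn_eq_two] at h'; linarith
    obtain ⟨rfl, rfl⟩ := hsL
    rw [sgn_eq_two] at hs; rw [sgn_eq_one] at hs'
    obtain ⟨ξ, hξ, hξ0⟩ := intermediate_value_Icc (hzy.trans hyw) hf.continuousOn
      (show (0 : ℝ) ∈ Set.Icc (f z) (f w) from ⟨hs.le, hs'.le⟩)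
    have hzξ : z < ξ := lt_of_le_of_ne hξ.1 (by rintro rfl; linarith)
    have hξw : ξ < w := lt_of_le_of_ne hξ.2 (by rintro rfl; linarith)
    have hξJ := hJJ z hz w hw ξ hzξ hξw
    refine ⟨ξ, hξJ, hξ0, fun y hy => ⟨fun h => ?_, fun h => ?_⟩⟩
    · rw [sgn_eq_two, ← hξ0]; exact hm (hJ hy) (hJ hξJ) h
    · rw [sgn_eq_one, ← hξ0]; exact hm (hJ hξJ) (hJ hy) h

theorem flip_flip_sgn (x : ℝ) : flip (flip (sgn x)) = sgn x := by
  rw [← sgn_neg, ← sgn_neg, neg_neg]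

theorem seg_anti {f : ℝ → ℝ} (hf : Continuous f) {J J' : Set ℝ} (hJ : J ⊆ J')
    (hJJ : ∀ a ∈ J', ∀ b ∈ J', ∀ y, a < y → y < b → y ∈ J) (hne : J.Nonempty)
    (hl : ∀ y ∈ J, ∃ z ∈ J, z < y) (hr : ∀ y ∈ J, ∃ z ∈ J, y < z)
    (hm : StrictAntiOn f J') {sL sR : ℕ} (hL : ∀ y ∈ J', ∃ z ∈ J', z ≤ y ∧ sgn (f z) = sL)
    (hR : ∀ y ∈ J', ∃ z ∈ J', y ≤ z ∧ sgn (f z) = sR) :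
    (sL = 0 → ∀ y ∈ J, sgn (f y) = sR) ∧ (sR = 0 → ∀ y ∈ J, sgn (f y) = sL) ∧
    (sL ≠ 0 → sL = sR → ∀ y ∈ J, sgn (f y) = sL) ∧
    (sL ≠ 0 → sR ≠ 0 → sL ≠ sR → ∃ ξ ∈ J, f ξ = 0 ∧ ∀ y ∈ J,
      (y < ξ → sgn (f y) = sL) ∧ (ξ < y → sgn (f y) = sR)) := by
  have key := seg_mono (f := fun y => - f y) hf.neg hJ hJJ hne hl hr hm.neg
    (sL := flip sL) (sR := flip sR)
    (fun y hy => by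
      obtain ⟨z, hz, h, h'⟩ := hL y hy
      exact ⟨z, hz, h, by rw [sgn_neg, h']⟩)
    (fun y hy => by
      obtain ⟨z, hz, h, h'⟩ := hR y hy
      exact ⟨z, hz, h, by rw [sgn_neg, h']⟩)
  obtain ⟨y0, hy0⟩ := hne
  obtain ⟨z, -, -, hsz⟩ := hL y0 (hJ hy0)
  obtain ⟨w, -, -, hsw⟩ := hR y0 (hJ hy0)
  have hfl : ∀ (y w : ℝ), sgn (-y) = flip (sgn w) → sgn y = sgn w := by
    intro y w h
    rw [← flip_flip_sgn y, ← sgn_neg, h, flip_flip_sgn]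
  have hz0 : ∀ w : ℝ, flip (sgn w) = 0 ↔ sgn w = 0 := by
    intro w; rw [← sgn_neg]; simp
  subst hsz hsw
  obtain ⟨k1, k2, k3, k4⟩ := key
  refine ⟨fun h y hy => hfl _ _ (k1 ((hz0 _).2 h) y hy), fun h y hy => hfl _ _ (k2 ((hz0 _).2 h) y hy),
    fun h h' y hy => hfl _ _ (k3 (mt (hz0 _).1 h) (by rw [h']) y hy), fun h h' h'' => ?_⟩
  obtain ⟨ξ, hξ, h1, h2⟩ := k4 (mt (hz0 _).1 h) (mt (hz0 _).1 h') (fun h3 => h'' (by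
    rw [← flip_flip_sgn, h3, flip_flip_sgn]))
  exact ⟨ξ, hξ, by linarith, fun y hy => ⟨fun h => hfl _ _ ((h2 y hy).1 h),
    fun h => hfl _ _ ((h2 y hy).2 h)⟩⟩

theorem seg_poly (P : ℝ[X]) {lo hi : EReal} (hlh : lo < hi) {s : ℕ} (hs0 : P.derivative ≠ 0)
    (hs : ∀ y : ℝ, lo < y → (y : EReal) < hi → sgn (P.derivative.eval y) = s) {sL sR : ℕ}
    (hL : ∀ y : ℝ, lo ≤ y → (y : EReal) ≤ hi → ∃ z : ℝ, lo ≤ z ∧ z ≤ y ∧ sgn (P.eval z) = sL)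
    (hR : ∀ y : ℝ, lo ≤ y → (y : EReal) ≤ hi →
      ∃ z : ℝ, (z : EReal) ≤ hi ∧ y ≤ z ∧ sgn (P.eval z) = sR) :
    let J : Set ℝ := {y | lo < y ∧ (y : EReal) < hi}
    (sL = 0 → ∀ y ∈ J, sgn (P.eval y) = sR) ∧ (sR = 0 → ∀ y ∈ J, sgn (P.eval y) = sL) ∧
    (sL ≠ 0 → sL = sR → ∀ y ∈ J, sgn (P.eval y) = sL) ∧
    (sL ≠ 0 → sR ≠ 0 → sL ≠ sR → ∃ ξ ∈ J, P.eval ξ = 0 ∧ ∀ y ∈ J,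
      (y < ξ → sgn (P.eval y) = sL) ∧ (ξ < y → sgn (P.eval y) = sR)) := by
  intro J
  set J' : Set ℝ := {y | lo ≤ y ∧ (y : EReal) ≤ hi} with hJ'
  have hJ : J ⊆ J' := fun y hy => ⟨hy.1.le, hy.2.le⟩
  have hJJ : ∀ a ∈ J', ∀ b ∈ J', ∀ y, a < y → y < b → y ∈ J := fun a ha b hb y h1 h2 =>
    ⟨lt_of_le_of_lt ha.1 (EReal.coe_lt_coe_iff.2 h1), lt_of_lt_of_le (EReal.coe_lt_coe_iff.2 h2) hb.2⟩
  have hne : J.Nonempty := by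
    obtain ⟨x, h1, h2⟩ := EReal.exists_between_coe_real hlh
    exact ⟨x, h1, h2⟩
  have hl : ∀ y ∈ J, ∃ z ∈ J, z < y := fun y hy => by
    obtain ⟨x, h1, h2⟩ := EReal.exists_between_coe_real hy.1
    exact ⟨x, ⟨h1, h2.trans hy.2⟩, EReal.coe_lt_coe_iff.1 h2⟩
  have hr : ∀ y ∈ J, ∃ z ∈ J, y < z := fun y hy => by
    obtain ⟨x, h1, h2⟩ := EReal.exists_between_coe_real hy.2
    exact ⟨x, ⟨hy.1.trans h1, h2⟩, EReal.coe_lt_coe_iff.1 h1⟩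
  have hconv : Convex ℝ J' := by
    apply Set.OrdConnected.convex
    refine ⟨fun a ha b hb y hy => ?_⟩
    exact ⟨ha.1.trans (EReal.coe_le_coe_iff.2 hy.1), (EReal.coe_le_coe_iff.2 hy.2).trans hb.2⟩
  have hint : interior J' ⊆ J := by
    intro y hy
    obtain ⟨ε, hε, hb⟩ := Metric.mem_nhds_iff.1 (mem_interior_iff_mem_nhds.1 hy)
    refine hJJ (y - ε / 2) (hb ?_) (y + ε / 2) (hb ?_) y (by linarith) (by linarith)
    · rw [Metric.mem_ball, Real.dist_eq, abs_lt]; constructor <;> linarith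
    · rw [Metric.mem_ball, Real.dist_eq, abs_lt]; constructor <;> linarith
  have hL' : ∀ y ∈ J', ∃ z ∈ J', z ≤ y ∧ sgn (P.eval z) = sL := fun y hy => by
    obtain ⟨z, h1, h2, h3⟩ := hL y hy.1 hy.2
    exact ⟨z, ⟨h1, (EReal.coe_le_coe_iff.2 h2).trans hy.2⟩, h2, h3⟩
  have hR' : ∀ y ∈ J', ∃ z ∈ J', y ≤ z ∧ sgn (P.eval z) = sR := fun y hy => by
    obtain ⟨z, h1, h2, h3⟩ := hR y hy.1 hy.2
    exact ⟨z, ⟨hy.1.trans (EReal.coe_le_coe_iff.2 h2), h1⟩, h2, h3⟩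
  have hs' : ∀ y ∈ J, sgn (P.derivative.eval y) = s := fun y hy => hs y hy.1 hy.2
  have hcase : s = 1 ∨ s = 2 := by
    obtain ⟨y0, hy0⟩ := hne
    rcases sgn_cases (P.derivative.eval y0) with h | h | h
    · exfalso
      apply hs0
      apply Polynomial.eq_zero_of_infinite_isRoot
      have hinf : J.Infinite := by
        obtain ⟨z, hz, hzy⟩ := hl y0 hy0
        refine (Set.Ioo_infinite hzy).mono fun w hw => hJJ z (hJ hz) y0 (hJ hy0) w hw.1 hw.2
      refine hinf.mono fun w hw => ?_
      rw [Set.mem_ofPred_eq, Polynomial.IsRoot, ← sgn_eq_zero, hs' w hw, ← hs' y0 hy0, h]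
    · left; rw [← hs' y0 hy0, h]
    · right; rw [← hs' y0 hy0, h]
  rcases hcase with rfl | rfl
  · refine seg_mono P.continuous hJ hJJ hne hl hr ?_ hL' hR'
    refine strictMonoOn_of_deriv_pos hconv P.continuous.continuousOn fun x hx => ?_
    rw [Polynomial.deriv, ← sgn_eq_one]; exact hs' x (hint hx)
  · refine seg_anti P.continuous hJ hJJ hne hl hr ?_ hL' hR'
    refine strictAntiOn_of_deriv_neg hconv P.continuous.continuousOn fun x hx => ?_
    rw [Polynomial.deriv, ← sgn_eq_two]; exact hs' x (hint hx)

end QE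

namespace QE
open PR Polynomial

theorem Good.procU_aux {v : ℕ → ℝ} {D : List UP} {p : UP} {g : Col → ℕ}
    (hg : ∀ S c, Val v D S c → ∀ y ∈ S, sgn ((toP v p).eval y) = g c) (l : List Ent) :
    ∀ (lo : EReal) (c : Col), Good v D lo c l → Good v (p :: D) lo ((p, g c) :: c)
      (l.map fun e => (e.1, (p, g e.2.1) :: e.2.1, (p, g e.2.2) :: e.2.2)) := by
  induction l with
  | nil => intro lo c h; exact Val.cons h (hg _ _ h)
  | cons e t ih =>
    rintro lo c ⟨x, h1, h2, h3, h4, h5, h6, h7, h8⟩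
    exact ⟨x, h1, h2.cons (hg _ _ h2), h3.cons (hg _ _ h3), List.mem_cons_of_mem _ h4, h5, h6, h7,
      ih _ _ h8⟩

theorem seg_spec {v : ℕ → ℝ} {D : List UP} {p : UP} (hd : deriv p ∈ D) (hd0 : (toP v p).derivative ≠ 0)
    {lo hi : EReal} (hlh : lo < hi) {c : Col}
    (hc : Val v D {y | lo < y ∧ (y : EReal) < hi} c) {sL sR : ℕ}
    (hL : ∀ y : ℝ, lo ≤ y → (y : EReal) ≤ hi →
      ∃ z : ℝ, lo ≤ z ∧ z ≤ y ∧ sgn ((toP v p).eval z) = sL)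
    (hR : ∀ y : ℝ, lo ≤ y → (y : EReal) ≤ hi →
      ∃ z : ℝ, (z : EReal) ≤ hi ∧ y ≤ z ∧ sgn ((toP v p).eval z) = sR) :
    (∃ c', seg p sL c sR = (c', []) ∧ Val v (p :: D) {y | lo < y ∧ (y : EReal) < hi} c') ∨
    (∃ c' pc ic, seg p sL c sR = (c', [(p, pc, ic)]) ∧ ∃ ξ : ℝ, lo < ξ ∧ (ξ : EReal) < hi ∧
      (toP v p).eval ξ = 0 ∧ Val v (p :: D) {y | lo < y ∧ (y : EReal) < ξ} c' ∧
      Val v (p :: D) {ξ} pc ∧ Val v (p :: D) {y | (ξ : EReal) < y ∧ (y : EReal) < hi} ic) := by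
  obtain ⟨y0, hy0, hy0'⟩ := EReal.exists_between_coe_real hlh
  have key := seg_poly (toP v p) hlh (s := sgn ((toP v p).derivative.eval y0)) hd0
    (fun y h1 h2 => by
      rw [← toP_deriv]
      have e1 := hc.look hd (y := y) ⟨h1, h2⟩
      have e2 := hc.look hd (y := y0) ⟨hy0, hy0'⟩
      rw [← e1, ← e2]) hL hR
  obtain ⟨k1, k2, k3, k4⟩ := key
  unfold seg
  split_ifs with h1 h2 h3
  · exact Or.inl ⟨_, rfl, hc.cons (k1 h1)⟩
  · exact Or.inl ⟨_, rfl, hc.cons (k2 h2)⟩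
  · exact Or.inl ⟨_, rfl, hc.cons (k3 h1 h3)⟩
  · obtain ⟨ξ, hξ, hξ0, hs⟩ := k4 h1 h2 h3
    refine Or.inr ⟨_, _, _, rfl, ξ, hξ.1, hξ.2, hξ0, ?_, ?_, ?_⟩
    · refine (hc.mono ?_).cons ?_
      · exact fun y hy => ⟨hy.1, hy.2.trans hξ.2⟩
      · exact fun y hy => (hs y ⟨hy.1, hy.2.trans hξ.2⟩).1 (EReal.coe_lt_coe_iff.1 hy.2)
    · refine (hc.mono ?_).cons ?_
      · rintro y rfl; exact hξ
      · rintro y rfl; rw [hξ0]; simp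
    · refine (hc.mono ?_).cons ?_
      · exact fun y hy => ⟨hξ.1.trans hy.1, hy.2⟩
      · exact fun y hy => (hs y ⟨hξ.1.trans hy.1, hy.2⟩).2 (EReal.coe_lt_coe_iff.1 hy.1)

theorem Good.main_aux {v : ℕ → ℝ} {D : List UP} {p : UP} (hp : p ≠ []) (hlc : ev v (lc p) ≠ 0)
    (hd : deriv p ∈ D)
    (hd0 : (toP v p).derivative ≠ 0) (hrem : ∀ q ∈ D, q ≠ [] → prem p q ∈ D) {sI : ℕ}
    (hI : ∀ y : ℝ, ∃ z : ℝ, y ≤ z ∧ sgn ((toP v p).eval z) = sI) (l : List Ent) :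
    ∀ (lo : EReal) (c : Col), lo < ⊤ → Good v D lo c l → ∀ sL, (∀ y : ℝ, lo ≤ y →
      ∃ z : ℝ, lo ≤ z ∧ z ≤ y ∧ sgn ((toP v p).eval z) = sL) →
      Good v (p :: D) lo (seg p sL c (l.foldr (mainStep p) (sI, [])).1).1
        ((seg p sL c (l.foldr (mainStep p) (sI, [])).1).2 ++
          (l.foldr (mainStep p) (sI, [])).2) := by
  induction l with
  | nil =>
    intro lo c hlo h sL hL
    simp only [List.foldr_nil, List.append_nil]
    rcases seg_spec (sL := sL) (sR := sI) hd hd0 hlo h (fun y h1 _ => hL y h1)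
      (fun y _ _ => (hI y).imp fun z hz => ⟨le_top, hz⟩) with
      ⟨c', h1, h2⟩ | ⟨c', pc, ic, h1, ξ, h2, h3, h4, h5, h6, h7⟩
    · rw [h1]; exact h2
    · rw [h1]; exact ⟨ξ, h2, h5, h6, List.mem_cons_self, hp, hlc, h4, h7⟩
  | cons e t ih =>
    rintro lo c hlo ⟨x, g1, g2, g3, g4, g5, g6, g7, g8⟩ sL hL
    rw [List.foldr_cons]
    set r := t.foldr (mainStep p) (sI, []) with hr
    have hs : look e.2.1 (prem p e.1) = sgn ((toP v p).eval x) := by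
      rw [g3.look (hrem _ g4 g5) (y := x) rfl]
      exact sgn_prem v p e.1 x g5 g6 g7
    have ih' := ih x e.2.2 (EReal.coe_lt_top x) g8 (look e.2.1 (prem p e.1)) (fun y hy =>
      ⟨x, le_rfl, EReal.coe_le_coe_iff.1 hy, hs.symm⟩)
    have hx : Val v (p :: D) {x} ((p, look e.2.1 (prem p e.1)) :: e.2.1) :=
      g3.cons (by rintro y rfl; exact hs.symm)
    have hrest := ih'
    have e1 : mainStep p e r = (look e.2.1 (prem p e.1), (e.1, (p, look e.2.1 (prem p e.1)) :: e.2.1,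
      (seg p (look e.2.1 (prem p e.1)) e.2.2 r.1).1) ::
      ((seg p (look e.2.1 (prem p e.1)) e.2.2 r.1).2 ++ r.2)) := rfl
    rw [e1]
    dsimp only
    rcases seg_spec (sL := sL) (sR := look e.2.1 (prem p e.1)) hd hd0 g1 g2 (fun y h1 _ => hL y h1)
      (fun y _ h => ⟨x, le_rfl, EReal.coe_le_coe_iff.1 h, hs.symm⟩) with
      ⟨c', h1, h2⟩ | ⟨c', pc, ic, h1, ξ, h2, h3, h4, h5, h6, h7⟩
    · rw [h1]
      exact ⟨x, g1, h2, hx, List.mem_cons_of_mem _ g4, g5, g6, g7, hrest⟩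
    · rw [h1]
      exact ⟨ξ, h2, h5, h6, List.mem_cons_self, hp, hlc, h4,
        x, h3, h7, hx, List.mem_cons_of_mem _ g4, g5, g6, g7, hrest⟩

theorem Good.proc {v : ℕ → ℝ} {D : List UP} {p : UP} {A : List (Po × ℕ)}
    (hA : p ≠ [] → sg A (lc p) = sgn (ev v (lc p))) (ht : p ≠ [] → trunc p ∈ D)
    (hd : p ≠ [] → deriv p ∈ D) (hrem : ∀ q ∈ D, q ≠ [] → prem p q ∈ D) {c : Col} {l : List Ent}
    (h : Good v D ⊥ c l) : Good v (p :: D) ⊥ (proc A p (c, l)).1 (proc A p (c, l)).2 := by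
  have huni : (p.length ≤ 1 ∨ sg A (lc p) = 0) →
      ∀ S c, Val v D S c → ∀ y ∈ S, sgn ((toP v p).eval y) = uni A p c := by
    intro hp S c hc y hy
    unfold uni
    by_cases h0 : p.length = 0
    · rw [if_pos h0, List.length_eq_zero_iff.1 h0]; simp [toP]
    · have hp0 : p ≠ [] := by rintro rfl; simp at h0
      rw [if_neg h0]
      split_ifs with h1
      · rw [hc.look (ht hp0) hy, toP_trunc]
        rwa [hA hp0, sgn_eq_zero] at h1
      · have hlen : p.length = 1 := by
          rcases hp with hp | hp
          · omega
          · exact absurd hp h1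
        rw [hA hp0]
        simp [toP, hlen, lc]
  unfold QE.proc
  split_ifs with h1 h2
  · exact Good.procU_aux (huni (Or.inl h1)) l ⊥ c h
  · exact Good.procU_aux (huni (Or.inr h2)) l ⊥ c h
  · have hp0 : p ≠ [] := by rintro rfl; simp at h1
    have hs := hA hp0
    have hl0 : ev v (lc p) ≠ 0 := fun h => h2 (by rw [hs, h]; simp)
    have hnd := natDegree_toP v p hl0
    have hlead := leadingCoeff_toP v p hl0
    have hnd0 : 0 < (toP v p).natDegree := by omega
    have hd0 : (toP v p).derivative ≠ 0 := by
      intro h0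
      have := Polynomial.derivative_eq_zero.1 h0
      omega
    refine Good.main_aux (sI := sg A (lc p)) hp0 hl0 (hd hp0) hd0 hrem (fun y => ?_) l ⊥ c (by simp) h _
      (fun y _ => ?_)
    · obtain ⟨z, hz1, hz2⟩ := ((sgn_eventually_atTop _ hnd0).and
        (Filter.eventually_ge_atTop y)).exists
      exact ⟨z, hz2, by rw [hz1, hlead, hs]⟩
    · obtain ⟨z, hz1, hz2⟩ := ((sgn_eventually_atBot _ hnd0).and
        (Filter.eventually_le_atBot y)).exists
      refine ⟨z, bot_le, hz2, ?_⟩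
      rw [hz1, hlead, hs, hnd]
      have : (p.length - 1) % 2 = 0 ↔ p.length % 2 = 1 := by omega
      simp only [this]

/-- All columns of a table. -/
def cols (st : Col × List Ent) : List Col := st.1 :: st.2.flatMap fun e => [e.2.1, e.2.2]

@[fun_prop] theorem pr_cols {α : Type*} [Primcodable α] {st : α → Col × List Ent} (h : Primrec st) :
    Primrec fun a => cols (st a) := by
  unfold cols; fun_prop

theorem Good.cols {v : ℕ → ℝ} {D : List UP} (l : List Ent) :
    ∀ (lo : EReal) (c : Col), lo < ⊤ → Good v D lo c l →
      (∀ y : ℝ, lo < y → ∃ c' ∈ QE.cols (c, l), Val v D {y} c') ∧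
      (∀ c' ∈ QE.cols (c, l), ∃ y : ℝ, Val v D {y} c') := by
  induction l with
  | nil =>
    intro lo c hlo h
    refine ⟨fun y hy => ⟨c, by simp [QE.cols], h.mono ?_⟩, fun c' hc' => ?_⟩
    · rintro z rfl; exact ⟨hy, EReal.coe_lt_top _⟩
    · obtain ⟨y, h1, h2⟩ := EReal.exists_between_coe_real hlo
      have : c' = c := by simpa [QE.cols] using hc'
      subst this
      refine ⟨y, Val.mono h ?_⟩
      rintro z rfl; exact ⟨h1, h2⟩
  | cons e t ih =>
    rintro lo c hlo ⟨x, g1, g2, g3, g4, g5, g6, g7, g8⟩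
    obtain ⟨i1, i2⟩ := ih x e.2.2 (EReal.coe_lt_top x) g8
    have hsub : ∀ c' ∈ QE.cols (e.2.2, t), c' ∈ QE.cols (c, e :: t) := by
      intro c' hc'
      simp only [QE.cols, List.flatMap_cons, List.mem_cons, List.mem_append, List.not_mem_nil,
        or_false] at hc' ⊢
      tauto
    constructor
    · intro y hy
      rcases lt_trichotomy y x with h | h | h
      · refine ⟨c, by simp [QE.cols], g2.mono ?_⟩
        rintro z rfl; exact ⟨hy, EReal.coe_lt_coe_iff.2 h⟩
      · subst h; exact ⟨e.2.1, by simp [QE.cols], g3⟩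
      · obtain ⟨c', h1, h2⟩ := i1 y (EReal.coe_lt_coe_iff.2 h)
        exact ⟨c', hsub c' h1, h2⟩
    · intro c' hc'
      have : c' = c ∨ c' = e.2.1 ∨ c' ∈ QE.cols (e.2.2, t) := by
        simp only [QE.cols, List.flatMap_cons, List.mem_cons, List.mem_append, List.not_mem_nil,
          or_false] at hc' ⊢
        tauto
      rcases this with rfl | rfl | h
      · obtain ⟨y, h1, h2⟩ := EReal.exists_between_coe_real g1
        refine ⟨y, g2.mono ?_⟩
        rintro z rfl; exact ⟨h1, h2⟩
      · exact ⟨x, g3⟩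
      · exact i2 c' h

end QE

namespace QE
open PR Polynomial

/-- One step of the closure, for polynomials of length `j`. -/
def clStep (S : List UP) (j : ℕ) : List UP :=
  let L := S.filter fun q => q.length == j
  S ++ L.flatMap fun q => deriv q :: trunc q :: S.map fun p => prem p q

/-- Closure under derivative, truncation and pseudo-remainder, starting from length `N`. -/
def clos (N : ℕ) (S : List UP) : List UP :=
  (List.range N).foldl (fun S i => clStep S (N - i)) S

/-- A bound for the lengths. -/
def lenB (S : List UP) : ℕ := S.foldr (fun p n => p.length + n) 0

@[fun_prop] theorem pr_clStep {α : Type*} [Primcodable α] {S : α → List UP} {j : α → ℕ}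
    (hS : Primrec S) (hj : Primrec j) : Primrec fun a => clStep (S a) (j a) := by
  unfold clStep; fun_prop

@[fun_prop] theorem pr_clos {α : Type*} [Primcodable α] {S : α → List UP} {j : α → ℕ}
    (hS : Primrec S) (hj : Primrec j) : Primrec fun a => clos (j a) (S a) := by
  unfold clos; fun_prop

@[fun_prop] theorem pr_lenB {α : Type*} [Primcodable α] {S : α → List UP}
    (hS : Primrec S) : Primrec fun a => lenB (S a) := by
  unfold lenB; fun_prop

theorem le_lenB {S : List UP} {p : UP} (hp : p ∈ S) : p.length ≤ lenB S := by
  induction S with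
  | nil => simp at hp
  | cons q S ih =>
    simp only [lenB, List.foldr_cons] at ih ⊢
    rcases List.mem_cons.1 hp with rfl | h
    · omega
    · have := ih h; omega

theorem clStep_sub (S : List UP) (j : ℕ) : S ⊆ clStep S j := by
  intro p hp; simp [clStep, hp]

theorem clStep_new {S : List UP} {j : ℕ} (hj : 0 < j) {p : UP} (hp : p ∈ clStep S j) :
    p ∈ S ∨ p.length < j := by
  simp only [clStep, List.mem_append, List.mem_flatMap, List.mem_filter, List.mem_cons,
    List.mem_map, beq_iff_eq] at hp
  rcases hp with h | ⟨q, ⟨-, hq⟩, rfl | rfl | ⟨r, -, rfl⟩⟩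
  · exact Or.inl h
  · right; rw [length_deriv]; omega
  · right; rw [length_trunc]; omega
  · right; rw [← hq]; apply length_prem; rintro rfl; simp at hq; omega

/-- Closure conditions at `q`. -/
def ClAt (S : List UP) (q : UP) : Prop := deriv q ∈ S ∧ trunc q ∈ S ∧ ∀ p ∈ S, prem p q ∈ S

theorem clStep_closed {S : List UP} {j : ℕ} (hj : 0 < j)
    (h : ∀ q ∈ S, j < q.length → ClAt S q) : ∀ q ∈ clStep S j, j ≤ q.length → ClAt (clStep S j) q := by
  intro q hq hjq
  have hqS : q ∈ S := (clStep_new hj hq).resolve_right (by omega)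
  rcases hjq.lt_or_eq with hlt | heq
  · obtain ⟨h1, h2, h3⟩ := h q hqS hlt
    refine ⟨clStep_sub _ _ h1, clStep_sub _ _ h2, fun p hp => ?_⟩
    rcases clStep_new hj hp with h' | h'
    · exact clStep_sub _ _ (h3 p h')
    · rwa [prem_of_lt _ _ (by omega)]
  · have hmem : ∀ r, (r = deriv q ∨ r = trunc q ∨ ∃ p ∈ S, prem p q = r) → r ∈ clStep S j := by
      intro r hr
      simp only [clStep, List.mem_append, List.mem_flatMap, List.mem_filter, List.mem_cons,
        List.mem_map, beq_iff_eq]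
      exact Or.inr ⟨q, ⟨hqS, heq.symm⟩, hr⟩
    refine ⟨hmem _ (by simp), hmem _ (by simp), fun p hp => ?_⟩
    rcases clStep_new hj hp with h' | h'
    · exact hmem _ (Or.inr (Or.inr ⟨p, h', rfl⟩))
    · rwa [prem_of_lt _ _ (by omega)]

theorem clos_aux (N : ℕ) (S : List UP) (hN : ∀ p ∈ S, p.length ≤ N) (n : ℕ) (hn : n ≤ N) :
    let T := (List.range n).foldl (fun S i => clStep S (N - i)) S
    S ⊆ T ∧ (∀ p ∈ T, p.length ≤ N) ∧ ∀ q ∈ T, N - n < q.length → ClAt T q := by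
  induction n with
  | zero =>
    refine ⟨fun p hp => hp, hN, fun q hq h => ?_⟩
    have := hN q hq; omega
  | succ n ih =>
    obtain ⟨h1, h2, h3⟩ := ih (by omega)
    rw [List.range_succ, List.foldl_append, List.foldl_cons, List.foldl_nil]
    set T := (List.range n).foldl (fun S i => clStep S (N - i)) S
    refine ⟨fun p hp => clStep_sub _ _ (h1 hp), fun p hp => ?_, fun q hq h => ?_⟩
    · rcases clStep_new (by omega) hp with h | h
      · exact h2 p h
      · omega
    · exact clStep_closed (by omega) h3 q hq (by omega)

theorem sub_clos (S : List UP) : S ⊆ clos (lenB S) S :=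
  (clos_aux (lenB S) S (fun _ => le_lenB) _ le_rfl).1

theorem length_clos (S : List UP) : ∀ p ∈ clos (lenB S) S, p.length ≤ lenB S :=
  (clos_aux (lenB S) S (fun _ => le_lenB) _ le_rfl).2.1

theorem clos_closed (S : List UP) : ∀ q ∈ clos (lenB S) S, q ≠ [] → ClAt (clos (lenB S) S) q :=
  fun q hq h => (clos_aux (lenB S) S (fun _ => le_lenB) _ le_rfl).2.2 q hq (by
    have := List.length_pos_iff.2 h; omega)

/-- Sort by length, longest first. -/
def sortL (N : ℕ) (S : List UP) : List UP :=
  (List.range (N + 1)).foldl (fun r j => (S.filter fun q => q.length == j) ++ r) []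

@[fun_prop] theorem pr_sortL {α : Type*} [Primcodable α] {S : α → List UP} {j : α → ℕ}
    (hS : Primrec S) (hj : Primrec j) : Primrec fun a => sortL (j a) (S a) := by
  unfold sortL; fun_prop

/-- The sign table. -/
def table (A : List (Po × ℕ)) (S : List UP) : Col × List Ent :=
  S.foldr (fun p st => proc A p st) ([], [])

@[fun_prop] theorem pr_table {α : Type*} [Primcodable α] {S : α → List UP} {A : α → List (Po × ℕ)}
    (hS : Primrec S) (hA : Primrec A) : Primrec fun a => table (A a) (S a) := by
  unfold table; fun_prop

theorem sortL_aux (S : List UP) (n : ℕ) :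
    let R := (List.range n).foldl (fun r j => (S.filter fun q => q.length == j) ++ r) []
    (∀ p, p ∈ R ↔ p ∈ S ∧ p.length < n) ∧ R.Pairwise fun p q => q.length ≤ p.length := by
  induction n with
  | zero => simp
  | succ n ih =>
    obtain ⟨h1, h2⟩ := ih
    rw [List.range_succ, List.foldl_append, List.foldl_cons, List.foldl_nil]
    set R := (List.range n).foldl (fun r j => (S.filter fun q => q.length == j) ++ r) []
    constructor
    · intro p
      simp only [List.mem_append, List.mem_filter, beq_iff_eq, h1]
      constructor
      · rintro (⟨h, h'⟩ | ⟨h, h'⟩)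
        · exact ⟨h, by omega⟩
        · exact ⟨h, by omega⟩
      · rintro ⟨h, h'⟩
        rcases Nat.lt_succ_iff_lt_or_eq.1 h' with h'' | h''
        · exact Or.inr ⟨h, h''⟩
        · exact Or.inl ⟨h, h''⟩
    · rw [List.pairwise_append]
      refine ⟨?_, h2, fun a ha b hb => ?_⟩
      · refine List.pairwise_iff_forall_sublist.2 fun {a b} hab => ?_
        have ha := hab.subset (show a ∈ [a, b] by simp)
        have hb := hab.subset (show b ∈ [a, b] by simp)
        simp only [List.mem_filter, beq_iff_eq] at ha hb
        omega
      · simp only [List.mem_filter, beq_iff_eq] at ha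
        have := (h1 b).1 hb
        omega

theorem table_good (v : ℕ → ℝ) (S : List UP) (A : List (Po × ℕ))
    (hcl : ∀ q ∈ S, q ≠ [] → ClAt S q)
    (hA : ∀ p ∈ S, ∀ c ∈ p, sg A c = sgn (ev v c)) :
    ∀ R T : List UP, T ++ R ⊆ S → S ⊆ T ++ R →
      (T ++ R).Pairwise (fun p q => q.length ≤ p.length) →
      Good v R ⊥ (table A R).1 (table A R).2 := by
  intro R
  induction R with
  | nil => intro T _ _ _; simp [table, Good, Val]
  | cons p R ih =>
    intro T h1 h2 h3
    have ih' := ih (T ++ [p]) (by simpa using h1) (by simpa using h2) (by simpa using h3)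
    have hpS : p ∈ S := h1 (by simp)
    have hmem : ∀ q ∈ S, q.length < p.length → q ∈ R := by
      intro q hq hlt
      have := h2 hq
      rw [List.pairwise_append] at h3
      simp only [List.mem_append, List.mem_cons] at this
      rcases this with h | rfl | h
      · have := h3.2.2 q h p (by simp); omega
      · omega
      · exact h
    have hle : ∀ q ∈ R, q.length ≤ p.length := by
      intro q hq
      rw [List.pairwise_append, List.pairwise_cons] at h3
      exact h3.2.1.1 q hq
    have hRS : ∀ q ∈ R, q ∈ S := fun q hq => h1 (by simp [hq])
    have hl : p ≠ [] → 0 < p.length := fun h => List.length_pos_iff.2 h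
    have : table A (p :: R) = proc A p (table A R) := rfl
    rw [this]
    refine Good.proc (fun hp => ?_) (fun hp => ?_) (fun hp => ?_) (fun q hq hq0 => ?_) ih'
    · apply hA p hpS
      have := hl hp
      rw [lc, List.getD_eq_getElem _ _ (by omega)]
      exact List.getElem_mem _
    · exact hmem _ (hcl p hpS hp).2.1 (by rw [length_trunc]; have := hl hp; omega)
    · exact hmem _ (hcl p hpS hp).1 (by rw [length_deriv]; have := hl hp; omega)
    · exact hmem _ ((hcl q (hRS q hq) hq0).2.2 p hpS)
        ((length_prem p q hq0).trans_le (hle q hq))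

/-- Quantifier-free formulas in disjunctive normal form; `(p, s)` says that `p` has sign `s`. -/
abbrev QF := List (List (Po × ℕ))

/-- Truth of a conjunction. -/
def holdsC (v : ℕ → ℝ) (C : List (Po × ℕ)) : Prop := ∀ l ∈ C, sgn (ev v l.1) = l.2

/-- Truth of a quantifier-free formula. -/
def holds (v : ℕ → ℝ) (φ : QF) : Prop := ∃ C ∈ φ, holdsC v C

/-- All sign assignments. -/
def assigns (cs : List Po) : List (List (Po × ℕ)) :=
  cs.foldr (fun c acc => acc.flatMap fun A => [(c, 0) :: A, (c, 1) :: A, (c, 2) :: A]) [[]]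

@[fun_prop] theorem pr_assigns {α : Type*} [Primcodable α] {S : α → List Po}
    (hS : Primrec S) : Primrec fun a => assigns (S a) := by
  unfold assigns; fun_prop

theorem mem_assigns_map (f : Po → ℕ) (hf : ∀ c, f c = 0 ∨ f c = 1 ∨ f c = 2) (cs : List Po) :
    cs.map (fun c => (c, f c)) ∈ assigns cs := by
  induction cs with
  | nil => simp [assigns]
  | cons c cs ih =>
    simp only [assigns, List.foldr_cons, List.map_cons, List.mem_flatMap] at ih ⊢
    refine ⟨_, ih, ?_⟩
    rcases hf c with h | h | h <;> simp [h]

theorem fst_of_mem_assigns {cs : List Po} {A : List (Po × ℕ)} (hA : A ∈ assigns cs) :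
    A.map Prod.fst = cs := by
  induction cs generalizing A with
  | nil => simp [assigns] at hA; simp [hA]
  | cons c cs ih =>
    simp only [assigns, List.foldr_cons, List.mem_flatMap] at ih hA
    obtain ⟨B, hB, h⟩ := hA
    have := ih hB
    simp only [List.mem_cons, List.not_mem_nil, or_false] at h
    rcases h with rfl | rfl | rfl <;> simp [this]

theorem sg_of_holds {v : ℕ → ℝ} {A : List (Po × ℕ)} (h : holdsC v A) {c : Po}
    (hc : c ∈ A.map Prod.fst) : sg A c = sgn (ev v c) := by
  induction A with
  | nil => simp at hc
  | cons l A ih =>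
    obtain ⟨c', s⟩ := l
    have h1 : holdsC v A := fun l hl => h l (List.mem_cons_of_mem _ hl)
    have h2 := h (c', s) List.mem_cons_self
    unfold sg at ih ⊢
    rw [List.lookup_cons]
    by_cases hcc : c = c'
    · subst hcc; simp [h2]
    · rw [beq_false_of_ne hcc]
      rw [List.map_cons, List.mem_cons] at hc
      exact ih h1 (hc.resolve_left hcc)

/-- The univariate polynomials needed to eliminate variable `0` from `φ`. -/
def polys (φ : QF) : List UP :=
  let S := φ.flatMap fun C => C.map fun l => toUP l.1
  let N := lenB S
  sortL N (clos N S)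

/-- Does some cell of the table satisfy `φ`? -/
def checkT (φ : QF) (st : Col × List Ent) : Bool :=
  (cols st).any fun c => φ.any fun C => C.all fun l => look c (toUP l.1) == l.2

/-- Elimination of the existential quantifier over variable `0`. -/
def elim (φ : QF) : QF :=
  let S := polys φ
  (assigns (S.flatMap fun p => p)).filter fun A => checkT φ (table A S)

section prim
variable {α : Type*} [Primcodable α] {φ : α → QF}

@[fun_prop] theorem pr_polys (hφ : Primrec φ) : Primrec fun a => polys (φ a) := by
  unfold polys; fun_prop

@[fun_prop] theorem pr_checkT {st : α → Col × List Ent} (hφ : Primrec φ) (hst : Primrec st) :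
    Primrec fun a => checkT (φ a) (st a) := by
  unfold checkT; fun_prop

@[fun_prop] theorem pr_elim (hφ : Primrec φ) : Primrec fun a => elim (φ a) := by
  unfold elim; fun_prop

end prim

theorem polys_closed (φ : QF) : ∀ q ∈ polys φ, q ≠ [] → ClAt (polys φ) q := by
  set S := φ.flatMap fun C => C.map fun l => toUP l.1 with hS
  have hmem : ∀ p, p ∈ polys φ ↔ p ∈ clos (lenB S) S := by
    intro p
    have := (sortL_aux (clos (lenB S) S) (lenB S + 1)).1 p
    refine this.trans ⟨fun h => h.1, fun h => ⟨h, ?_⟩⟩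
    have := length_clos S p h; omega
  intro q hq hq0
  obtain ⟨h1, h2, h3⟩ := clos_closed S q ((hmem q).1 hq) hq0
  exact ⟨(hmem _).2 h1, (hmem _).2 h2, fun p hp => (hmem _).2 (h3 p ((hmem p).1 hp))⟩

theorem mem_polys {φ : QF} {C : List (Po × ℕ)} (hC : C ∈ φ) {l : Po × ℕ} (hl : l ∈ C) :
    toUP l.1 ∈ polys φ := by
  set S := φ.flatMap fun C => C.map fun l => toUP l.1 with hS
  have h0 : toUP l.1 ∈ S := List.mem_flatMap.2 ⟨C, hC, List.mem_map.2 ⟨l, hl, rfl⟩⟩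
  have := (sortL_aux (clos (lenB S) S) (lenB S + 1)).1 (toUP l.1)
  exact this.2 ⟨sub_clos S h0, by have := le_lenB h0; omega⟩

theorem polys_sorted (φ : QF) : (polys φ).Pairwise fun p q => q.length ≤ p.length :=
  (sortL_aux _ _).2

theorem check_iff {v : ℕ → ℝ} {φ : QF} {A : List (Po × ℕ)}
    (hA : ∀ p ∈ polys φ, ∀ c ∈ p, sg A c = sgn (ev v c)) :
    checkT φ (table A (polys φ)) = true ↔ ∃ y, holds (cons y v) φ := by
  have hg := table_good v (polys φ) A (polys_closed φ) hA (polys φ) [] (by simp) (by simp)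
    (by simpa using polys_sorted φ)
  obtain ⟨h1, h2⟩ := Good.cols _ ⊥ _ (by simp) hg
  have hval : ∀ (y : ℝ) (c : Col), Val v (polys φ) {y} c → ∀ C ∈ φ,
      ((∀ l ∈ C, look c (toUP l.1) = l.2) ↔ holdsC (cons y v) C) := by
    intro y c hc C hC
    refine forall₂_congr fun l hl => ?_
    rw [hc.look (mem_polys hC hl) (y := y) rfl, eval_toUP]
  simp only [checkT, List.any_eq_true, List.all_eq_true, beq_iff_eq]
  constructor
  · rintro ⟨c, hc, C, hC, h⟩
    obtain ⟨y, hy⟩ := h2 c hc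
    exact ⟨y, C, hC, (hval y c hy C hC).1 h⟩
  · rintro ⟨y, C, hC, h⟩
    obtain ⟨c, hc, hy⟩ := h1 y (by simp)
    exact ⟨c, hc, C, hC, (hval y c hy C hC).2 h⟩

theorem holds_elim (v : ℕ → ℝ) (φ : QF) : holds v (elim φ) ↔ ∃ y, holds (cons y v) φ := by
  constructor
  · rintro ⟨A, hA, hv⟩
    simp only [elim, List.mem_filter] at hA
    refine (check_iff (fun p hp c hc => sg_of_holds hv ?_)).1 hA.2
    rw [fst_of_mem_assigns hA.1]
    exact List.mem_flatMap.2 ⟨p, hp, hc⟩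
  · intro h
    set cs := (polys φ).flatMap fun p => p with hcs
    have hm := mem_assigns_map (fun c => sgn (ev v c)) (fun c => sgn_cases _) cs
    have hv : holdsC v (cs.map fun c => (c, sgn (ev v c))) := by
      intro l hl
      obtain ⟨c, -, rfl⟩ := List.mem_map.1 hl
      rfl
    refine ⟨_, List.mem_filter.2 ⟨hm, (check_iff fun p hp c hc => sg_of_holds hv ?_).2 h⟩, hv⟩
    rw [fst_of_mem_assigns hm]
    exact List.mem_flatMap.2 ⟨p, hp, hc⟩

end QE

namespace QE
open PR

/-- Conjunction. -/
def andQ (φ ψ : QF) : QF := φ.flatMap fun C => ψ.map fun D => C ++ D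

/-- Negation. -/
def notQ (φ : QF) : QF := φ.foldr (fun C r => andQ (C.flatMap fun l =>
  (([0, 1, 2] : List ℕ).filter fun s => s != l.2).map fun s => [(l.1, s)]) r) [[]]

/-- Renaming of variables. -/
def renQ (ρ : ℕ → ℕ) (φ : QF) : QF :=
  φ.map fun C => C.map fun l => (l.1.map fun m => (m.1, m.2.1, m.2.2.map ρ), l.2)

/-- Sign of a polynomial at the zero environment. -/
def sgn0 (p : Po) : ℕ :=
  let q := p.filter fun m => m.2.2.length == 0
  let a : ℕ := q.foldr (fun m r => m.1 + r) 0
  let b : ℕ := q.foldr (fun m r => m.2.1 + r) 0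
  if a = b then 0 else if b < a then 1 else 2

/-- Truth at the zero environment. -/
def chk (φ : QF) : Bool := φ.any fun C => C.all fun l => sgn0 l.1 == l.2

section prim
variable {α : Type*} [Primcodable α] {φ ψ : α → QF}

@[fun_prop] theorem pr_andQ (hφ : Primrec φ) (hψ : Primrec ψ) :
    Primrec fun a => andQ (φ a) (ψ a) := by
  unfold andQ; fun_prop

@[fun_prop] theorem pr_notQ (hφ : Primrec φ) : Primrec fun a => notQ (φ a) := by
  unfold notQ; fun_prop

@[fun_prop] theorem pr_renQ {ρ : α → ℕ → ℕ} (hρ : Primrec fun p : α × ℕ => ρ p.1 p.2)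
    (hφ : Primrec φ) : Primrec fun a => renQ (ρ a) (φ a) := by
  unfold renQ; fun_prop

@[fun_prop] theorem pr_sgn0 {p : α → Po} (hp : Primrec p) : Primrec fun a => sgn0 (p a) := by
  unfold sgn0; fun_prop

@[fun_prop] theorem pr_chk (hφ : Primrec φ) : Primrec fun a => chk (φ a) := by
  unfold chk; fun_prop

end prim

theorem holdsC_append (v : ℕ → ℝ) (C D : List (Po × ℕ)) :
    holdsC v (C ++ D) ↔ holdsC v C ∧ holdsC v D := by
  simp only [holdsC, List.mem_append]
  exact ⟨fun h => ⟨fun l hl => h l (Or.inl hl), fun l hl => h l (Or.inr hl)⟩,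
    fun h l hl => hl.elim (h.1 l) (h.2 l)⟩

theorem holds_andQ (v : ℕ → ℝ) (φ ψ : QF) : holds v (andQ φ ψ) ↔ holds v φ ∧ holds v ψ := by
  simp only [holds, andQ, List.mem_flatMap, List.mem_map]
  constructor
  · rintro ⟨_, ⟨C, hC, D, hD, rfl⟩, h⟩
    rw [holdsC_append] at h
    exact ⟨⟨C, hC, h.1⟩, ⟨D, hD, h.2⟩⟩
  · rintro ⟨⟨C, hC, h⟩, ⟨D, hD, h'⟩⟩
    exact ⟨_, ⟨C, hC, D, hD, rfl⟩, (holdsC_append _ _ _).2 ⟨h, h'⟩⟩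

theorem holds_notQ (v : ℕ → ℝ) (φ : QF) : holds v (notQ φ) ↔ ¬ holds v φ := by
  induction φ with
  | nil => simp [notQ, holds, holdsC]
  | cons C φ ih =>
    have : notQ (C :: φ) = andQ (C.flatMap fun l =>
      (([0, 1, 2] : List ℕ).filter fun s => s != l.2).map fun s => [(l.1, s)]) (notQ φ) := rfl
    rw [this, holds_andQ, ih]
    have h1 : holds v (C :: φ) ↔ holdsC v C ∨ holds v φ := by simp [holds]
    rw [h1, not_or]
    refine and_congr_left fun _ => ?_
    simp only [holds, List.mem_flatMap, List.mem_map, List.mem_filter]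
    constructor
    · rintro ⟨_, ⟨l, hl, s, ⟨-, hs⟩, rfl⟩, h⟩ hC
      have h2 := hC l hl
      have h3 := h (l.1, s) (by simp)
      simp only [bne_iff_ne, ne_eq] at hs
      exact hs (h3.symm.trans h2)
    · intro hC
      simp only [holdsC, not_forall] at hC
      obtain ⟨l, hl, hne⟩ := hC
      refine ⟨_, ⟨l, hl, sgn (ev v l.1), ⟨?_, by simpa using hne⟩, rfl⟩, ?_⟩
      · rcases sgn_cases (ev v l.1) with h | h | h <;> simp [h]
      · intro l' hl'
        simp only [List.mem_singleton] at hl'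
        subst hl'; rfl

theorem ev_ren (v : ℕ → ℝ) (ρ : ℕ → ℕ) (p : Po) :
    ev v (p.map fun m => (m.1, m.2.1, m.2.2.map ρ)) = ev (fun i => v (ρ i)) p := by
  induction p with
  | nil => rfl
  | cons m p ih =>
    rw [List.map_cons, ev_cons, ih, ev_cons]
    simp [evM, Function.comp_def]

theorem holds_renQ (v : ℕ → ℝ) (ρ : ℕ → ℕ) (φ : QF) :
    holds v (renQ ρ φ) ↔ holds (fun i => v (ρ i)) φ := by
  simp only [holds, renQ, List.mem_map, exists_exists_and_eq_and]
  refine exists_congr fun C => and_congr_right fun _ => ?_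
  simp only [holdsC, List.mem_map, forall_exists_index, and_imp, forall_apply_eq_imp_iff₂, ev_ren]

theorem sgn0_eq (p : Po) : sgn0 p = sgn (ev (fun _ => 0) p) := by
  have h : ev (fun _ => 0) p =
      (((p.filter fun m => m.2.2.length == 0).foldr (fun m r => m.1 + r) 0 : ℕ) : ℝ) -
      (((p.filter fun m => m.2.2.length == 0).foldr (fun m r => m.2.1 + r) 0 : ℕ) : ℝ) := by
    induction p with
    | nil => simp
    | cons m p ih =>
      rw [ev_cons, ih]
      obtain ⟨a, b, L⟩ := m
      rcases L with _ | ⟨x, L⟩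
      · simp [evM]; ring
      · simp [evM]
  rw [h]
  unfold sgn0 sgn
  simp only [sub_eq_zero, Nat.cast_inj, sub_pos, Nat.cast_lt]

theorem chk_iff (φ : QF) : chk φ = true ↔ holds (fun _ => 0) φ := by
  simp only [chk, holds, holdsC, List.any_eq_true, List.all_eq_true, beq_iff_eq, sgn0_eq]

/-- Concatenation of a block of `N` values with an environment. -/
def app (N : ℕ) (y v : ℕ → ℝ) : ℕ → ℝ := fun i => if i < N then y i else v (i - N)

theorem holds_elim_iter (N : ℕ) (v : ℕ → ℝ) (φ : QF) :
    holds v (elim^[N] φ) ↔ ∃ y, holds (app N y v) φ := by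
  induction N generalizing φ with
  | zero =>
    have : ∀ y, app 0 y v = v := fun y => by funext i; simp [app]
    simp [this]
  | succ N ih =>
    rw [Function.iterate_succ_apply, ih]
    simp only [holds_elim]
    have key : ∀ z y, cons z (app N y v) = app (N + 1) (cons z y) v := by
      intro z y
      funext i
      rcases i with _ | i
      · simp [cons, app]
      · simp only [cons, app, Nat.add_lt_add_iff_right, Nat.add_sub_add_right]
    constructor
    · rintro ⟨y, z, h⟩
      exact ⟨cons z y, by rwa [← key]⟩
    · rintro ⟨y, h⟩
      refine ⟨fun i => y (i + 1), y 0, ?_⟩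
      rw [key]
      convert h using 2
      funext i
      rcases i with _ | i <;> rfl

/-- Families of definable predicates on environments, uniformly computable. -/
def Def {α : Type*} [Primcodable α] (A : α → (ℕ → ℝ) → Prop) : Prop :=
  ∃ φ : α → QF, Primrec φ ∧ ∀ a v, holds v (φ a) ↔ A a v

namespace Def

variable {α β : Type*} [Primcodable α] [Primcodable β] {A B : α → (ℕ → ℝ) → Prop}

theorem congr (hA : Def A) (h : ∀ a v, A a v ↔ B a v) : Def B := by
  obtain ⟨φ, h1, h2⟩ := hA
  exact ⟨φ, h1, fun a v => (h2 a v).trans (h a v)⟩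

theorem dec {b : α → Bool} (hb : Primrec b) : Def fun a _ => b a = true := by
  refine ⟨fun a => cond (b a) [[]] [], by fun_prop, fun a v => ?_⟩
  rcases h : b a <;> simp [h, holds, holdsC]

theorem eq0 {p : α → Po} (hp : Primrec p) : Def fun a v => ev v (p a) = 0 :=
  ⟨fun a => [[(p a, 0)]], by fun_prop, fun a v => by simp [holds, holdsC]⟩

theorem pos {p : α → Po} (hp : Primrec p) : Def fun a v => 0 < ev v (p a) :=
  ⟨fun a => [[(p a, 1)]], by fun_prop, fun a v => by simp [holds, holdsC]⟩

theorem and (hA : Def A) (hB : Def B) : Def fun a v => A a v ∧ B a v := by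
  obtain ⟨φ, h1, h2⟩ := hA
  obtain ⟨ψ, h3, h4⟩ := hB
  exact ⟨fun a => andQ (φ a) (ψ a), by fun_prop, fun a v => by rw [holds_andQ, h2, h4]⟩

theorem not (hA : Def A) : Def fun a v => ¬ A a v := by
  obtain ⟨φ, h1, h2⟩ := hA
  exact ⟨fun a => notQ (φ a), by fun_prop, fun a v => by rw [holds_notQ, h2]⟩

theorem or (hA : Def A) (hB : Def B) : Def fun a v => A a v ∨ B a v :=
  (hA.not.and hB.not).not.congr fun a v => by tauto

theorem imp (hA : Def A) (hB : Def B) : Def fun a v => A a v → B a v :=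
  (hA.not.or hB).congr fun a v => by tauto

theorem ex {A : α → (ℕ → ℝ) → Prop} {N : α → ℕ} (hA : Def A) (hN : Primrec N) :
    Def fun a v => ∃ y, A a (app (N a) y v) := by
  obtain ⟨φ, h1, h2⟩ := hA
  exact ⟨fun a => elim^[N a] (φ a), by fun_prop, fun a v => by
    rw [holds_elim_iter]; simp only [h2]⟩

theorem all {A : α → (ℕ → ℝ) → Prop} {N : α → ℕ} (hA : Def A) (hN : Primrec N) :
    Def fun a v => ∀ y, A a (app (N a) y v) :=
  (hA.not.ex hN).not.congr fun a v => by simp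

theorem bex {A : α → ℕ → (ℕ → ℝ) → Prop} {N : α → ℕ} (hN : Primrec N)
    (hA : Def fun (p : α × ℕ) v => A p.1 p.2 v) : Def fun a v => ∃ i < N a, A a i v := by
  obtain ⟨φ, h1, h2⟩ := hA
  refine ⟨fun a => (List.range (N a)).flatMap fun i => φ (a, i), by fun_prop, fun a v => ?_⟩
  simp only [holds, List.mem_flatMap, List.mem_range]
  constructor
  · rintro ⟨C, ⟨i, hi, hC⟩, h⟩
    exact ⟨i, hi, (h2 (a, i) v).1 ⟨C, hC, h⟩⟩
  · rintro ⟨i, hi, h⟩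
    obtain ⟨C, hC, h⟩ := (h2 (a, i) v).2 h
    exact ⟨C, ⟨i, hi, hC⟩, h⟩

theorem ball {A : α → ℕ → (ℕ → ℝ) → Prop} {N : α → ℕ} (hN : Primrec N)
    (hA : Def fun (p : α × ℕ) v => A p.1 p.2 v) : Def fun a v => ∀ i < N a, A a i v :=
  (bex (A := fun a i v => ¬ A a i v) hN hA.not).not.congr fun a v => by simp

theorem ren {A : α → (ℕ → ℝ) → Prop} {ρ : α → ℕ → ℕ} (hA : Def A)
    (hρ : Primrec fun p : α × ℕ => ρ p.1 p.2) : Def fun a v => A a (fun i => v (ρ a i)) := by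
  obtain ⟨φ, h1, h2⟩ := hA
  exact ⟨fun a => renQ (ρ a) (φ a), by fun_prop, fun a v => by rw [holds_renQ, h2]⟩

theorem decide (hA : Def A) : ∃ b : α → Bool, Primrec b ∧ ∀ a, b a = true ↔ A a fun _ => 0 := by
  obtain ⟨φ, h1, h2⟩ := hA
  exact ⟨fun a => chk (φ a), by fun_prop, fun a => by rw [chk_iff, h2]⟩

end Def

end QE

namespace QE

/-- `q` lists the elements of an image of the template listed by `τ`. -/
def Comp {k d : ℕ} {α X : Type*} (τ : Fin k → Fin d → α) (q : Fin k → Fin d → X) : Prop :=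
  Function.Injective q ∧ ∀ i j c, τ i c = τ j c → q i c = q j c

/-- The listed template is a template for which every coordinate is needed. -/
def Tm {k d : ℕ} {α : Type*} (τ : Fin k → Fin d → α) : Prop :=
  Function.Injective τ ∧ ∀ c, ∃ i j, τ i c ≠ τ j c ∧ ∀ c', c' ≠ c → τ i c' = τ j c'

/-- Embeddability of `L(X^d, P)`, with `P` listed by `τ`, into a zero hypergraph. -/
def ZEmb {k d n : ℕ} {α : Type*} (Z : (Fin k → Fin n → ℝ) → Prop) (τ : Fin k → Fin d → α)
    (X : Type*) : Prop :=
  ∃ g : (Fin d → X) → Fin n → ℝ, Function.Injective g ∧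
    ∀ q : Fin k → Fin d → X, Comp τ q → ∃ π : Equiv.Perm (Fin k), Z fun i => g (q (π i))

/-- The zero relation of a polynomial. -/
def ZQ {k n : ℕ} (p : MvPolynomial (Fin k × Fin n) ℚ) (a : Fin k → Fin n → ℝ) : Prop :=
  MvPolynomial.aeval (fun v : Fin k × Fin n => a v.1 v.2) p = (0 : ℝ)

theorem exists_list {γ : Type*} {k : ℕ} (P : Finset γ) (hP : P.card = k) :
    ∃ x : Fin k → γ, Function.Injective x ∧ ∀ y, y ∈ P ↔ ∃ i, x i = y := by
  let e := (P.equivFinOfCardEq hP).symm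
  refine ⟨fun i => (e i : γ), fun i j h => e.injective (Subtype.ext h), fun y => ⟨fun hy => ?_, ?_⟩⟩
  · exact ⟨e.symm ⟨y, hy⟩, by simp⟩
  · rintro ⟨i, rfl⟩; exact (e i).2

theorem mem_fimg {V W : Type*} (g : V → W) (e : Finset V) (w : W) :
    w ∈ fimg g e ↔ ∃ x ∈ e, g x = w := by
  classical
  unfold fimg
  rw [Finset.mem_image]

theorem mem_zeroEdgesQ_of_list {k n : ℕ} {p : MvPolynomial (Fin k × Fin n) ℚ}
    {Q : Finset (Fin n → ℝ)} {x : Fin k → Fin n → ℝ} (hx : Function.Injective x)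
    (hQ : ∀ y, y ∈ Q ↔ ∃ i, x i = y) :
    Q ∈ zeroEdgesQ k n p ↔ ∃ π : Equiv.Perm (Fin k), ZQ p fun i => x (π i) := by
  constructor
  · rintro ⟨a, ha, hai, h0⟩
    have h1 : ∀ i, ∃ j, x j = a i := fun i => (hQ _).1 (by rw [← hai, mem_fimg]; exact ⟨i, by simp⟩)
    choose f hf using h1
    have hfi : Function.Injective f := fun i j h => ha (by rw [← hf, ← hf, h])
    refine ⟨Equiv.ofBijective f (Finite.injective_iff_bijective.1 hfi), ?_⟩
    have : (fun i => x (Equiv.ofBijective f (Finite.injective_iff_bijective.1 hfi) i)) = a :=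
      funext fun i => hf i
    rw [this]; exact h0
  · rintro ⟨π, h⟩
    refine ⟨fun i => x (π i), hx.comp π.injective, ?_, h⟩
    ext y
    rw [mem_fimg, hQ]
    constructor
    · rintro ⟨i, -, rfl⟩; exact ⟨_, rfl⟩
    · rintro ⟨i, rfl⟩; exact ⟨π.symm i, by simp⟩

theorem mem_LEdges_iff {k d : ℕ} (hk : 0 < k) {α X : Type*} {P : Finset (Fin d → α)} {x : Fin k → Fin d → α}
    (hx : Function.Injective x) (hP : ∀ y, y ∈ P ↔ ∃ i, x i = y) (Q : Finset (Fin d → X)) :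
    Q ∈ LEdges k P X ↔ ∃ q : Fin k → Fin d → X, Comp x q ∧ ∀ y, y ∈ Q ↔ ∃ i, q i = y := by
  classical
  constructor
  · rintro ⟨hQ, f, h1, h2, h3⟩
    have hmem : ∀ y, y ∈ Q ↔ ∃ i, f (x i) = y := by
      intro y
      constructor
      · intro hy
        obtain ⟨z, hz, rfl⟩ := h2 y hy
        obtain ⟨i, rfl⟩ := (hP z).1 hz
        exact ⟨i, rfl⟩
      · rintro ⟨i, rfl⟩; exact h1 _ ((hP _).2 ⟨i, rfl⟩)
    refine ⟨fun i => f (x i), ⟨?_, fun i j c h => h3 _ ((hP _).2 ⟨i, rfl⟩) _ ((hP _).2 ⟨j, rfl⟩) c h⟩,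
      hmem⟩
    have hQ' : Q = Finset.univ.image fun i => f (x i) := by
      ext y; rw [hmem]; simp
    have : (Finset.univ.image fun i => f (x i)).card = (Finset.univ : Finset (Fin k)).card := by
      rw [← hQ', hQ]; simp
    have := Finset.card_image_iff.1 this
    exact fun i j h => this (by simp) (by simp) h
  · rintro ⟨q, ⟨hq, hc⟩, hmem⟩
    have hQ' : Q = Finset.univ.image q := by
      ext y; rw [hmem]; simp
    refine ⟨by rw [hQ', Finset.card_image_of_injective _ hq]; simp, ?_⟩
    have : Nonempty (Fin k) := ⟨⟨0, hk⟩⟩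
    refine ⟨fun y => q (Function.invFun x y), fun y hy => (hmem _).2 ⟨_, rfl⟩, fun y hy => ?_, ?_⟩
    · obtain ⟨i, rfl⟩ := (hmem y).1 hy
      exact ⟨x i, (hP _).2 ⟨i, rfl⟩, congrArg q (Function.leftInverse_invFun hx i)⟩
    · intro y hy y' hy' c h
      obtain ⟨i, rfl⟩ := (hP y).1 hy
      obtain ⟨j, rfl⟩ := (hP y').1 hy'
      simp only [Function.leftInverse_invFun hx _]
      exact hc i j c h

theorem le_eT {d : ℕ} {α : Type*} {P : Finset (Fin d → α)} {e : ℕ}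
    (h : ∀ I, IsDistinguisher P I → e ≤ I.card) : e ≤ eT P := by
  refine le_csInf ⟨_, Finset.univ, fun x _ y _ hxy => ?_, rfl⟩ ?_
  · obtain ⟨i, hi⟩ := Function.ne_iff.1 hxy
    exact ⟨i, Finset.mem_univ _, hi⟩
  · rintro e ⟨I, hI, rfl⟩; exact h I hI

theorem eT_le {d : ℕ} {α : Type*} {P : Finset (Fin d → α)} {I : Finset (Fin d)}
    (h : IsDistinguisher P I) : eT P ≤ I.card := Nat.sInf_le ⟨I, h, rfl⟩

theorem exists_min_distinguisher {d : ℕ} {α : Type*} (P : Finset (Fin d → α)) :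
    ∃ I, IsDistinguisher P I ∧ I.card = eT P := by
  refine Nat.sInf_mem (s := {e | ∃ I : Finset (Fin d), IsDistinguisher P I ∧ I.card = e})
    ⟨_, Finset.univ, fun x _ y _ hxy => ?_, rfl⟩
  obtain ⟨i, hi⟩ := Function.ne_iff.1 hxy
  exact ⟨i, Finset.mem_univ _, hi⟩

theorem exists_distinguisher {d : ℕ} {α : Type*} (P : Finset (Fin d → α)) :
    ∃ I, IsDistinguisher P I ∧ I.card ≤ P.card - 1 := by
  classical
  induction P using Finset.induction_on with
  | empty => exact ⟨∅, by simp [IsDistinguisher], by simp⟩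
  | insert x P hx ih =>
    obtain ⟨I, hI, hc⟩ := ih
    rcases P.eq_empty_or_nonempty with rfl | hne
    · exact ⟨∅, by simp [IsDistinguisher], by simp⟩
    have hpos := hne.card_pos
    rw [Finset.card_insert_of_notMem hx]
    by_cases h : ∃ y ∈ P, ∀ i ∈ I, x i = y i
    · obtain ⟨y, hy, hxy⟩ := h
      have : x ≠ y := fun h => hx (h ▸ hy)
      obtain ⟨c, hcxy⟩ := Function.ne_iff.1 this
      have key : ∀ z ∈ P, ∃ i ∈ insert c I, x i ≠ z i := by
        intro z hz
        by_cases hzy : z = y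
        · subst hzy; exact ⟨c, by simp, hcxy⟩
        · obtain ⟨i, hi, hi'⟩ := hI z hz y hy hzy
          exact ⟨i, by simp [hi], fun h => hi' (by rw [← h, hxy i hi])⟩
      refine ⟨insert c I, fun z hz w hw hzw => ?_, (Finset.card_insert_le _ _).trans (by omega)⟩
      rcases Finset.mem_insert.1 hz with rfl | hz' <;> rcases Finset.mem_insert.1 hw with rfl | hw'
      · exact (hzw rfl).elim
      · exact key w hw'
      · obtain ⟨i, hi, h⟩ := key z hz'
        exact ⟨i, hi, h.symm⟩
      · obtain ⟨i, hi, h⟩ := hI z hz' w hw' hzw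
        exact ⟨i, by simp [hi], h⟩
    · push Not at h
      refine ⟨I, fun z hz w hw hzw => ?_, by omega⟩
      rcases Finset.mem_insert.1 hz with rfl | hz' <;> rcases Finset.mem_insert.1 hw with rfl | hw'
      · exact (hzw rfl).elim
      · exact h w hw'
      · obtain ⟨i, hi, h⟩ := h z hz'
        exact ⟨i, hi, h.symm⟩
      · exact hI z hz' w hw' hzw

theorem lt_of_mem_depthSet {k : ℕ} (hk : 2 ≤ k) {V : Type*} {E : Set (Finset V)} {δ : ℕ}
    (h : δ ∈ DepthSet k E) : δ < k := by
  obtain ⟨d, α, P, hP, he, -⟩ := h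
  obtain ⟨I, hI, hc⟩ := exists_distinguisher P
  have := eT_le hI
  omega

theorem embeddable_iff {k n d : ℕ} (hk : 0 < k) {α X : Type*} {p : MvPolynomial (Fin k × Fin n) ℚ}
    {P : Finset (Fin d → α)} {x : Fin k → Fin d → α}
    (hx : Function.Injective x) (hP : ∀ y, y ∈ P ↔ ∃ i, x i = y) :
    Embeddable (LEdges k P X) (zeroEdgesQ k n p) ↔ ZEmb (ZQ p) x X := by
  classical
  refine exists_congr fun g => and_congr_right fun hg => ?_
  constructor
  · intro h q hq
    have hm : ∀ y, y ∈ Finset.univ.image q ↔ ∃ i, q i = y := by simp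
    have := h _ ((mem_LEdges_iff hk hx hP _).2 ⟨q, hq, hm⟩)
    refine (mem_zeroEdgesQ_of_list (hg.comp hq.1) fun y => ?_).1 this
    rw [mem_fimg]
    simp
  · intro h Q hQ
    obtain ⟨q, hq, hm⟩ := (mem_LEdges_iff hk hx hP _).1 hQ
    refine (mem_zeroEdgesQ_of_list (hg.comp hq.1) fun y => ?_).2 (h q hq)
    rw [mem_fimg]
    simp only [hm, Function.comp]
    constructor
    · rintro ⟨_, ⟨i, rfl⟩, rfl⟩; exact ⟨i, rfl⟩
    · rintro ⟨i, rfl⟩; exact ⟨_, ⟨i, rfl⟩, rfl⟩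

theorem mem_depthSet_iff {k n : ℕ} (hk : 0 < k) {p : MvPolynomial (Fin k × Fin n) ℚ} {δ : ℕ} :
    δ ∈ DepthSet k (zeroEdgesQ k n p) ↔
      ∃ τ : Fin k → Fin (δ + 1) → Fin k, Tm τ ∧ ∀ M : ℕ, ZEmb (ZQ p) τ (Fin M) := by
  classical
  have : Nonempty (Fin k) := ⟨⟨0, hk⟩⟩
  constructor
  · rintro ⟨d, α, P, hP, he, hM⟩
    obtain ⟨x, hx, hxP⟩ := exists_list P hP
    obtain ⟨I, hI, hIc⟩ := exists_min_distinguisher P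
    rw [he] at hIc
    let e : Fin (δ + 1) ≃ I := (I.equivFinOfCardEq hIc).symm
    let τ : Fin k → Fin (δ + 1) → Fin k := fun i c =>
      Function.invFun (fun j => x j (e c)) (x i (e c))
    have hτ : ∀ i j c, τ i c = τ j c ↔ x i (e c) = x j (e c) := by
      intro i j c
      refine ⟨fun h => ?_, fun h => by simp only [τ]; rw [h]⟩
      have h1 := Function.invFun_eq (f := fun j => x j (e c)) (b := x i (e c)) ⟨i, rfl⟩
      have h2 := Function.invFun_eq (f := fun j => x j (e c)) (b := x j (e c)) ⟨j, rfl⟩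
      rw [← h1, ← h2]
      exact congrArg (fun j => x j (e c)) h
    refine ⟨τ, ⟨fun i j h => ?_, fun c => ?_⟩, fun M => ?_⟩
    · by_contra hij
      obtain ⟨c, hc, hne⟩ := hI (x i) ((hxP _).2 ⟨i, rfl⟩) (x j) ((hxP _).2 ⟨j, rfl⟩)
        (fun h => hij (hx h))
      have := (hτ i j (e.symm ⟨c, hc⟩)).1 (congrFun h _)
      simp only [Equiv.apply_symm_apply] at this
      exact hne this
    · have h1 : ¬ IsDistinguisher P (I.erase (e c)) := by
        intro h
        have := eT_le h
        rw [Finset.card_erase_of_mem (e c).2] at this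
        omega
      simp only [IsDistinguisher, not_forall] at h1
      obtain ⟨y, hy, z, hz, hyz, h1⟩ := h1
      push Not at h1
      obtain ⟨i, rfl⟩ := (hxP _).1 hy
      obtain ⟨j, rfl⟩ := (hxP _).1 hz
      have h2 : ∀ c', c' ≠ c → τ i c' = τ j c' := by
        intro c' hc'
        refine (hτ _ _ _).2 (h1 _ (Finset.mem_erase.2 ⟨fun h => hc' ?_, (e c').2⟩))
        exact e.injective (Subtype.ext h)
      refine ⟨i, j, fun h => ?_, h2⟩
      obtain ⟨c', hc', hne⟩ := hI _ hy _ hz hyz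
      refine hne ?_
      by_cases hcc : c' = e c
      · subst hcc; exact (hτ _ _ _).1 h
      · exact h1 c' (Finset.mem_erase.2 ⟨hcc, hc'⟩)
    · obtain ⟨g, hg, hq⟩ := (embeddable_iff hk hx hxP).1 (hM (M + 1))
      let E : (Fin (δ + 1) → Fin M) → Fin d → Fin (M + 1) := fun a c =>
        if h : c ∈ I then (a (e.symm ⟨c, h⟩)).castSucc else 0
      have hE : ∀ a c, E a (e c) = (a c).castSucc := by
        intro a c
        simp only [E, (e c).2, dif_pos, Subtype.coe_eta, Equiv.symm_apply_apply]
      have hEi : Function.Injective E := by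
        intro a b h
        funext c
        have := congrFun h (e c)
        rw [hE, hE] at this
        exact Fin.castSucc_injective _ this
      refine ⟨fun a => g (E a), hg.comp hEi, fun q hc => hq (fun i => E (q i)) ⟨hEi.comp hc.1, ?_⟩⟩
      intro i j c h
      by_cases hcI : c ∈ I
      · have := hc.2 i j (e.symm ⟨c, hcI⟩) ((hτ _ _ _).2 (by simpa using h))
        simp only [E, hcI, dif_pos, this]
      · simp only [E, hcI, dif_neg, not_false_eq_true]
  · rintro ⟨τ, ⟨hτ, hmin⟩, hM⟩
    have hP : ∀ y, y ∈ Finset.univ.image τ ↔ ∃ i, τ i = y := by simp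
    refine ⟨δ + 1, Fin k, Finset.univ.image τ, ?_, ?_, fun M => (embeddable_iff hk hτ hP).2 (hM M)⟩
    · rw [Finset.card_image_of_injective _ hτ]; simp
    · apply le_antisymm
      · refine (eT_le (I := Finset.univ) fun x _ y _ hxy => ?_).trans (by simp)
        obtain ⟨i, hi⟩ := Function.ne_iff.1 hxy
        exact ⟨i, Finset.mem_univ _, hi⟩
      · refine le_eT fun I hI => ?_
        have : I = Finset.univ := by
          ext c
          simp only [Finset.mem_univ, iff_true]
          obtain ⟨i, j, hne, heq⟩ := hmin c
          obtain ⟨c', hc', h⟩ := hI (τ i) ((hP _).2 ⟨i, rfl⟩) (τ j) ((hP _).2 ⟨j, rfl⟩)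
            (fun h => hne (congrFun h c))
          by_cases hcc : c' = c
          · rwa [← hcc]
          · exact (h (heq c' hcc)).elim
        rw [this]; simp

end QE

namespace QE
open Filter

/-- The `k`-th tensor power of an ultrafilter. -/
def pw {α : Type*} (U : Ultrafilter α) : ∀ k : ℕ, Ultrafilter (Fin k → α)
  | 0 => pure Fin.elim0
  | k + 1 => U.bind fun x => (pw U k).map (Fin.cons (α := fun _ => α) x)

theorem pw_zero {α : Type*} {U : Ultrafilter α} {P : (Fin 0 → α) → Prop} :
    (∀ᶠ z : Fin 0 → α in pw U 0, P z) ↔ P Fin.elim0 := by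
  change {z | P z} ∈ (pure Fin.elim0 : Ultrafilter (Fin 0 → α)) ↔ _
  simp

theorem pw_succ {α : Type*} {U : Ultrafilter α} {k : ℕ} {P : (Fin (k + 1) → α) → Prop} :
    (∀ᶠ z : Fin (k + 1) → α in pw U (k + 1), P z) ↔
      ∀ᶠ x in U, ∀ᶠ z : Fin k → α in pw U k, P (Fin.cons (α := fun _ => α) x z) := Iff.rfl

theorem pw_marginal {α : Type*} {U : Ultrafilter α} {k : ℕ} (a : Fin k) {P : α → Prop} :
    (∀ᶠ z : Fin k → α in pw U k, P (z a)) ↔ ∀ᶠ x in U, P x := by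
  induction k with
  | zero => exact a.elim0
  | succ k ih =>
    rw [pw_succ]
    induction a using Fin.cases with
    | zero => simp
    | succ a => simp [ih a]

theorem eventually_eq_const {α β : Type*} {U : Ultrafilter α} {f g : α → β}
    (h : ∀ᶠ x in U, ∀ᶠ y in U, f x = g y) :
    ∃ c, (∀ᶠ x in U, f x = c) ∧ ∀ᶠ y in U, g y = c := by
  obtain ⟨x₀, h₀⟩ := h.exists
  refine ⟨f x₀, ?_, h₀.mono fun y hy => hy.symm⟩
  filter_upwards [h] with x hx
  obtain ⟨y, h1, h2⟩ := (hx.and h₀).exists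
  rw [h1, h2]

theorem pw_pair {α β : Type*} {U : Ultrafilter α} {k : ℕ} {a b : Fin k} (hab : a ≠ b)
    {f g : α → β} (h : ∀ᶠ z : Fin k → α in pw U k, f (z a) = g (z b)) :
    ∃ c, (∀ᶠ x in U, f x = c) ∧ ∀ᶠ y in U, g y = c := by
  induction k with
  | zero => exact a.elim0
  | succ k ih =>
    rw [pw_succ] at h
    induction a using Fin.cases with
    | zero =>
      induction b using Fin.cases with
      | zero => exact (hab rfl).elim
      | succ b =>
        simp only [Fin.cons_zero, Fin.cons_succ] at h
        refine eventually_eq_const (h.mono fun x hx => ?_)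
        exact (pw_marginal b (P := fun y => f x = g y)).1 hx
    | succ a =>
      induction b using Fin.cases with
      | zero =>
        simp only [Fin.cons_zero, Fin.cons_succ] at h
        obtain ⟨c, h1, h2⟩ := eventually_eq_const (f := g) (g := f) (h.mono fun x hx =>
          (pw_marginal a (P := fun y => g x = f y)).1 (hx.mono fun _ => Eq.symm))
        exact ⟨c, h2, h1⟩
      | succ b =>
        simp only [Fin.cons_succ, eventually_const] at h
        exact ih (fun h => hab (by rw [h])) h

theorem pw_diag {α β : Type*} {U : Ultrafilter α} {k : ℕ} (a b : Fin k)
    {f g : α → β} (h : ∀ᶠ z : Fin k → α in pw U k, f (z a) = g (z b)) : ∀ᶠ x in U, f x = g x := by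
  by_cases hab : a = b
  · subst hab
    exact (pw_marginal a (P := fun y => f y = g y)).1 h
  · obtain ⟨c, h1, h2⟩ := pw_pair hab h
    filter_upwards [h1, h2] with x hx hy
    rw [hx, hy]

/-- The grid point selected by `a`. -/
def pick {α : Type*} {d k : ℕ} (z : Fin d → Fin k → α) (a : Fin d → Fin k) : Fin d → α :=
  fun i => z i (a i)

theorem pick_cons {α : Type*} {d k : ℕ} (z₀ : Fin k → α) (z : Fin d → Fin k → α)
    (a : Fin (d + 1) → Fin k) :
    pick (Fin.cons (α := fun _ => Fin k → α) z₀ z) a =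
      Fin.cons (α := fun _ => α) (z₀ (a 0)) (pick z (Fin.tail a)) := by
  funext i
  induction i using Fin.cases <;> simp [pick, Fin.tail]

section grid
variable {α β : Type*} {U : Ultrafilter α} {d k : ℕ}

/-- Generic grids. -/
abbrev gr (U : Ultrafilter α) (d k : ℕ) : Ultrafilter (Fin d → Fin k → α) := pw (pw U k) d

theorem gr_marginal (a : Fin d → Fin k) {P : (Fin d → α) → Prop} :
    (∀ᶠ z : Fin d → Fin k → α in gr U d k, P (pick z a)) ↔ ∀ᶠ x : Fin d → α in pw U d, P x := by
  induction d with
  | zero =>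
    rw [pw_zero, pw_zero]
    exact Iff.of_eq (congrArg _ (Subsingleton.elim _ _))
  | succ d ih =>
    rw [pw_succ, pw_succ]
    simp only [pick_cons]
    rw [← pw_marginal (k := k) (a 0) (P := fun x => ∀ᶠ z : Fin d → α in pw U d, P (Fin.cons (α := fun _ => α) x z))]
    refine eventually_congr (Eventually.of_forall fun z₀ => ?_)
    exact ih (Fin.tail a) (P := fun x => P (Fin.cons (α := fun _ => α) (z₀ (a 0)) x))

theorem gr_diag (a b : Fin d → Fin k) {f g : (Fin d → α) → β}
    (h : ∀ᶠ z : Fin d → Fin k → α in gr U d k, f (pick z a) = g (pick z b)) : ∀ᶠ x : Fin d → α in pw U d, f x = g x := by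
  induction d with
  | zero =>
    rw [pw_zero] at h ⊢
    convert h
  | succ d ih =>
    rw [pw_succ] at h ⊢
    simp only [pick_cons] at h
    let F : ((Fin (d + 1) → α) → β) → α → Germ (pw U d : Filter (Fin d → α)) β := fun f t =>
      ((fun x => f (Fin.cons (α := fun _ => α) t x) : (Fin d → α) → β) : Germ _ β)
    have h1 : ∀ᶠ z : Fin k → α in pw U k, F f (z (a 0)) = F g (z (b 0)) :=
      h.mono fun z hz => Germ.coe_eq.2 (ih (Fin.tail a) (Fin.tail b)
        (f := fun x => f (Fin.cons (α := fun _ => α) (z (a 0)) x))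
        (g := fun x => g (Fin.cons (α := fun _ => α) (z (b 0)) x)) hz)
    exact (pw_diag _ _ h1).mono fun x hx => Germ.coe_eq.1 hx

theorem gr_indep {u v : Fin k} (a b : Fin d → Fin k) {i : Fin d} (hi : a i ≠ b i)
    {f g : (Fin d → α) → β} (h : ∀ᶠ z : Fin d → Fin k → α in gr U d k, f (pick z a) = g (pick z b)) :
    ∀ᶠ z : Fin d → Fin k → α in gr U d k, f (pick z fun _ => u) = f (pick z (Function.update (fun _ => u) i v)) := by
  induction d with
  | zero => exact i.elim0
  | succ d ih =>
    rw [pw_succ] at h ⊢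
    simp only [pick_cons] at h ⊢
    induction i using Fin.cases with
    | zero =>
      let F : ((Fin (d + 1) → α) → β) → α → Germ (pw U d : Filter (Fin d → α)) β := fun f t =>
        ((fun x => f (Fin.cons (α := fun _ => α) t x) : (Fin d → α) → β) : Germ _ β)
      have h1 : ∀ᶠ z : Fin k → α in pw U k, F f (z (a 0)) = F g (z (b 0)) :=
        h.mono fun z hz => Germ.coe_eq.2 (gr_diag (Fin.tail a) (Fin.tail b)
          (f := fun x => f (Fin.cons (α := fun _ => α) (z (a 0)) x))
          (g := fun x => g (Fin.cons (α := fun _ => α) (z (b 0)) x)) hz)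
      obtain ⟨c, hc, -⟩ := pw_pair hi h1
      have h2 := (pw_marginal u).2 hc
      have h3 := (pw_marginal v).2 hc
      filter_upwards [h2, h3] with z hz hz'
      have h4 := Germ.coe_eq.1 (hz.trans hz'.symm)
      have h5 := (gr_marginal (U := U) (fun _ : Fin d => u) (k := k)).2 h4
      filter_upwards [h5] with w hw
      have e : Fin.tail (Function.update (fun _ : Fin (d + 1) => u) 0 v) = fun _ => u := by
        funext j; simp [Fin.tail]
      have e' : Fin.tail (fun _ : Fin (d + 1) => u) = fun _ => u := rfl
      rw [e, e']
      simpa using hw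
    | succ i =>
      have h1 : ∀ᶠ z : Fin k → α in pw U k, ∀ᶠ w : Fin d → Fin k → α in gr U d k,
          f (Fin.cons (α := fun _ => α) (z (a 0)) (pick w fun _ => u)) =
          f (Fin.cons (α := fun _ => α) (z (a 0)) (pick w (Function.update (fun _ => u) i v))) :=
        h.mono fun z hz => ih (Fin.tail a) (Fin.tail b) hi
          (f := fun x => f (Fin.cons (α := fun _ => α) (z (a 0)) x))
          (g := fun x => g (Fin.cons (α := fun _ => α) (z (b 0)) x)) hz
      have h2 := (pw_marginal (a 0) (P := fun t => ∀ᶠ w : Fin d → Fin k → α in gr U d k,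
          f (Fin.cons (α := fun _ => α) t (pick w fun _ => u)) =
          f (Fin.cons (α := fun _ => α) t (pick w (Function.update (fun _ => u) i v))))).1 h1
      have h3 := (pw_marginal (k := k) u).2 h2
      have e : Fin.tail (Function.update (fun _ : Fin (d + 1) => u) i.succ v) =
          Function.update (fun _ => u) i v := by
        funext j; simp [Fin.tail, Function.update_apply]
      have e' : (Function.update (fun _ : Fin (d + 1) => u) i.succ v) 0 = u := by
        rw [Function.update_of_ne]; exact (Fin.succ_ne_zero i).symm
      rw [e, e']
      exact h3

theorem gr_injective {U : Ultrafilter α} (hU : ∀ x, {x}ᶜ ∈ U) :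
    ∀ᶠ z : Fin d → Fin k → α in gr U d k, ∀ i, Function.Injective (z i) := by
  have h0 : ∀ᶠ z : Fin k → α in pw U k, Function.Injective z := by
    simp only [Function.Injective, eventually_all]
    intro a b
    by_cases hab : a = b
    · exact Eventually.of_forall fun _ _ => hab
    have : ¬ ∀ᶠ z : Fin k → α in pw U k, z a = z b := by
      intro h
      obtain ⟨c, h1, -⟩ := pw_pair hab (f := id) (g := id) h
      have h2 : {c}ᶜ ∩ {x | id x = c} ∈ U := inter_mem (hU c) h1
      obtain ⟨x, hx, hx'⟩ := U.nonempty_of_mem h2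
      exact hx hx'
    exact (Ultrafilter.eventually_not.2 this).mono fun z hz h => (hz h).elim
  rw [eventually_all]
  intro i
  exact (pw_marginal i (P := fun w : Fin k → α => Function.Injective w)).2 h0

end grid

end QE

namespace QE
open Filter MvPolynomial

/-- The ideal of polynomials vanishing along an ultrafilter. -/
def genIdeal {ι S : Type*} {K : Type*} [CommRing S] [CommRing K] [Algebra S K] (U : Filter ι)
    {σ : Type*} (Y : ι → σ → K) : Ideal (MvPolynomial σ S) where
  carrier := {q | ∀ᶠ x in U, aeval (Y x) q = 0}
  add_mem' := by
    intro a b ha hb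
    filter_upwards [ha, hb] with x h1 h2
    rw [map_add, h1, h2, add_zero]
  zero_mem' := by simp
  smul_mem' := by
    intro c a ha
    filter_upwards [ha] with x h
    rw [smul_eq_mul, map_mul, h, mul_zero]

theorem mem_genIdeal {ι S : Type*} {K : Type*} [CommRing S] [CommRing K] [Algebra S K]
    {U : Filter ι} {σ : Type*} {Y : ι → σ → K} {q : MvPolynomial σ S} :
    q ∈ genIdeal U Y ↔ ∀ᶠ x in U, aeval (Y x) q = 0 := Iff.rfl

theorem genIdeal_eventually {ι S : Type*} {K : Type*} [CommRing S] [IsNoetherianRing S]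
    [CommRing K] [Algebra S K] (U : Filter ι) {σ : Type*} [Finite σ] (Y : ι → σ → K) :
    ∀ᶠ x in U, ∀ q ∈ genIdeal (S := S) U Y, aeval (Y x) q = 0 := by
  obtain ⟨s, hs⟩ := (isNoetherianRing_iff_ideal_fg _).1
    (inferInstance : IsNoetherianRing (MvPolynomial σ S)) (genIdeal U Y)
  have h1 : ∀ᶠ x in U, ∀ q ∈ s, aeval (Y x) q = 0 := by
    rw [Filter.eventually_all_finset]
    intro q hq
    exact mem_genIdeal.1 (hs ▸ Ideal.subset_span hq)
  filter_upwards [h1] with x hx q hq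
  have : genIdeal U Y ≤ RingHom.ker (aeval (R := S) (Y x)) := by
    rw [← hs, Ideal.span_le]
    exact fun q hq => hx q hq
  exact this hq

theorem pw_collapse {α W K : Type*} [Finite W] [Field K] {U : Ultrafilter α}
    (Y : α → W → K) {k : ℕ} (q : MvPolynomial (Fin k × W) K)
    (h : ∀ᶠ z : Fin k → α in pw U k, aeval (fun v => Y (z v.1) v.2) q = 0) :
    ∀ᶠ x in U, aeval (fun v => Y x v.2) q = 0 := by
  have h0 := genIdeal_eventually (S := K) (U : Filter α) Y
  suffices key : ∀ z : Fin k → α, (∀ i, ∀ q ∈ genIdeal (S := K) (U : Filter α) Y,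
      aeval (Y (z i)) q = 0) → aeval (fun v => Y (z v.1) v.2) q = 0 from
    h0.mono fun x hx => key (fun _ => x) fun _ => hx
  clear h0
  induction k with
  | zero =>
    intro z _
    rw [pw_zero] at h
    rw [Subsingleton.elim z Fin.elim0]
    exact h
  | succ k ih =>
    intro z hz
    rw [pw_succ] at h
    let r : MvPolynomial W K := aeval (fun v : Fin (k + 1) × W =>
      Fin.cases (motive := fun _ => MvPolynomial W K) (X v.2) (fun i => C (Y (z i.succ) v.2)) v.1) q
    have hr : ∀ x, aeval (Y x) r =
        aeval (fun v => Y (Fin.cons (α := fun _ => α) x (Fin.tail z) v.1) v.2) q := by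
      intro x
      simp only [r]
      rw [← AlgHom.comp_apply, comp_aeval]
      congr 2
      funext ⟨i, w⟩
      induction i using Fin.cases <;> simp [Fin.tail]
    have : aeval (Y (z 0)) r = 0 := by
      refine hz 0 r (mem_genIdeal.2 (h.mono fun x hx => ?_))
      let r' : MvPolynomial (Fin k × W) K := aeval (fun v : Fin (k + 1) × W =>
        Fin.cases (motive := fun _ => MvPolynomial (Fin k × W) K) (C (Y x v.2))
          (fun i => X (i, v.2)) v.1) q
      have hr' : ∀ z, aeval (fun v => Y (z v.1) v.2) r' =
          aeval (fun v => Y (Fin.cons (α := fun _ => α) x z v.1) v.2) q := by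
        intro x
        simp only [r']
        rw [← AlgHom.comp_apply, comp_aeval]
        congr 2
        funext ⟨i, w⟩
        induction i using Fin.cases <;> simp
      rw [hr, ← hr']
      refine ih r' (hx.mono fun z hz => ?_) (Fin.tail z) fun i => hz i.succ
      rw [hr', hz]
    rw [hr] at this
    simpa using this

theorem germ_eval₂ {ι K σ : Type*} [Field K] [Algebra ℚ K] (U : Ultrafilter ι) (f : ι → σ → K)
    (c : ℚ →+* Germ (U : Filter ι) K) (q : MvPolynomial σ ℚ) :
    eval₂ c (fun v => ((fun x => f x v : ι → K) : Germ (U : Filter ι) K)) q =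
      ((fun x => aeval (f x) q : ι → K) : Germ (U : Filter ι) K) := by
  induction q using MvPolynomial.induction_on with
  | C r =>
    have : c = (Germ.coeRingHom (R := K) (U : Filter ι)).comp
      (RingHom.pi fun _ => algebraMap ℚ K) := RingHom.ext_rat _ _
    simp only [algHom_C, eval₂_C, this]
    rfl
  | add p q hp hq =>
    rw [eval₂_add, hp, hq]
    simp only [map_add]; rfl
  | mul_X p v hp =>
    rw [eval₂_mul, hp]
    simp only [map_mul, eval₂_X, aeval_X]; rfl

theorem gr_collapse {α W K : Type*} [Finite W] [Field K] [Algebra ℚ K] {U : Ultrafilter α}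
    {d k : ℕ} (Z : (Fin d → α) → W → K) (q : MvPolynomial ((Fin d → Fin k) × W) ℚ)
    (h : ∀ᶠ z : Fin d → Fin k → α in gr U d k, aeval (fun v => Z (pick z v.1) v.2) q = 0) :
    ∀ᶠ x : Fin d → α in pw U d, aeval (fun v => Z x v.2) q = 0 := by
  induction d generalizing W with
  | zero =>
    rw [pw_zero] at h ⊢
    convert h using 3
    funext v
    congr 1
    exact Subsingleton.elim _ _
  | succ d ih =>
    rw [pw_succ] at h ⊢
    simp only [pick_cons] at h
    let G := Germ (pw U d : Filter (Fin d → α)) K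
    have h1 : ∀ᶠ z : Fin k → α in pw U k, ∀ᶠ x : Fin d → α in pw U d,
        aeval (fun v : Fin k × W => Z (Fin.cons (α := fun _ => α) (z v.1) x) v.2)
          (rename (fun v : (Fin (d + 1) → Fin k) × W => (v.1 0, v.2)) q) = 0 := by
      refine h.mono fun z hz => ?_
      have := ih (W := Fin k × W)
        (fun x w => Z (Fin.cons (α := fun _ => α) (z w.1) x) w.2)
        (rename (fun v : (Fin (d + 1) → Fin k) × W => (Fin.tail v.1, (v.1 0, v.2))) q) (by
          refine hz.mono fun z' hz' => ?_
          rw [aeval_rename]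
          exact hz')
      refine this.mono fun x hx => ?_
      rw [aeval_rename] at hx ⊢
      exact hx
    set q' := rename (fun v : (Fin (d + 1) → Fin k) × W => (v.1 0, v.2)) q
    let c : ℚ →+* G := (Germ.coeRingHom (R := K) (pw U d : Filter (Fin d → α))).comp
      (RingHom.pi fun _ => algebraMap ℚ K)
    let Y : α → W → G := fun t w =>
      ((fun x => Z (Fin.cons (α := fun _ => α) t x) w : (Fin d → α) → K) : G)
    have key : ∀ z : Fin k → α, aeval (fun v => Y (z v.1) v.2) (map c q') = 0 ↔
        ∀ᶠ x : Fin d → α in pw U d,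
          aeval (fun v : Fin k × W => Z (Fin.cons (α := fun _ => α) (z v.1) x) v.2) q' = 0 := by
      intro z
      rw [aeval_def, eval₂_map, Algebra.algebraMap_self, RingHom.id_comp]
      have e := germ_eval₂ (pw U d)
        (fun x (v : Fin k × W) => Z (Fin.cons (α := fun _ => α) (z v.1) x) v.2) c q'
      refine (Eq.congr_left e).trans ?_
      exact Germ.coe_eq
    have h2 := pw_collapse Y (map c q') (h1.mono fun z hz => (key z).2 hz)
    refine h2.mono fun x hx => ?_
    have h3 := (key fun _ => x).1 hx
    refine h3.mono fun y hy => ?_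
    simp only [q'] at hy
    rw [aeval_rename] at hy
    exact hy

end QE

namespace QE
open Filter MvPolynomial

theorem exists_polarized (d : ℕ) : ∃ X : Type, ∀ χ : (Fin d → X) → ℕ, ∃ h : Fin d → ℕ → X,
    (∀ c, Function.Injective (h c)) ∧ ∃ col, ∀ a : Fin d → ℕ, χ (fun c => h c (a c)) = col := by
  induction d with
  | zero =>
    refine ⟨Unit, fun χ => ⟨fun c => c.elim0, fun c => c.elim0, χ Fin.elim0, fun a => ?_⟩⟩
    congr 1
  | succ d ih =>
    obtain ⟨X, hX⟩ := ih
    refine ⟨Set (((Fin d → X) → ℕ) × ℕ) ⊕ X, fun χ => ?_⟩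
    let S := Set (((Fin d → X) → ℕ) × ℕ)
    let F : S → (Fin d → X) → ℕ := fun t a =>
      χ (Fin.cons (α := fun _ => S ⊕ X) (Sum.inl t) fun i => Sum.inr (a i))
    have h1 : ∃ C, (F ⁻¹' {C}).Infinite := by
      by_contra hc
      push Not at hc
      have h2 : ∀ C, ∃ e : S → ℕ, Set.InjOn e (F ⁻¹' {C}) := fun C =>
        Set.countable_iff_exists_injOn.1 (hc C).countable
      choose e he using h2
      refine Function.cantor_injective (fun t : S => ((F t, e (F t) t) : _ × ℕ)) ?_
      intro s t hst
      obtain ⟨ha, hb⟩ := Prod.ext_iff.1 hst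
      simp only at ha hb
      rw [ha] at hb
      exact he (F t) ha rfl hb
    obtain ⟨C, hC⟩ := h1
    have := hC.to_subtype
    obtain ⟨h, hh, col, hcol⟩ := hX C
    let h0 := Infinite.natEmbedding (F ⁻¹' {C})
    refine ⟨Fin.cases (motive := fun _ => ℕ → S ⊕ X) (fun n => Sum.inl (h0 n).1)
      fun i n => Sum.inr (h i n), fun c => ?_, col, fun a => ?_⟩
    · induction c using Fin.cases with
      | zero => exact fun a b hab => h0.injective (Subtype.ext (by simpa using hab))
      | succ c => exact fun a b hab => hh c (by simpa using hab)
    · have h4 : F (h0 (a 0)) = C := (h0 (a 0)).2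
      rw [← hcol (Fin.tail a), ← congrFun h4]
      simp only [F]
      congr 1
      funext i
      induction i using Fin.cases <;> simp [Fin.tail]

/-- Finite systems of equations and inequations solvable in `R` are solvable over `ℝ`. -/
def Transfer (R : Type*) [Field R] [Algebra ℚ R] : Prop :=
  ∀ (V : Type) (w : V → R) (S T : Finset (MvPolynomial V ℚ)), (∀ P ∈ S, aeval w P = 0) →
    (∀ Q ∈ T, aeval w Q ≠ 0) →
    ∃ w' : V → ℝ, (∀ P ∈ S, aeval w' P = 0) ∧ ∀ Q ∈ T, aeval w' Q ≠ 0

theorem transfer_germ {ι : Type*} (U : Ultrafilter ι) [Algebra ℚ (Germ (U : Filter ι) ℝ)] :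
    Transfer (Germ (U : Filter ι) ℝ) := by
  classical
  intro V w S T hS hT
  have : ∀ v, ∃ f : ι → ℝ, (f : Germ (U : Filter ι) ℝ) = w v := fun v =>
    ⟨Quot.out (w v), Quot.out_eq (w v)⟩
  choose f hf using this
  have key : ∀ P : MvPolynomial V ℚ,
      aeval w P = ((fun x => aeval (fun v => f v x) P : ι → ℝ) : Germ (U : Filter ι) ℝ) := by
    intro P
    rw [aeval_def, ← germ_eval₂]
    congr 1
    funext v
    exact (hf v).symm
  have h1 : ∀ᶠ x in (U : Filter ι), ∀ P ∈ S, aeval (fun v => f v x) P = 0 := by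
    rw [Filter.eventually_all_finset]
    intro P hP
    have := hS P hP
    rw [key] at this
    exact Germ.coe_eq.1 this
  have h2 : ∀ᶠ x in (U : Filter ι), ∀ P ∈ T, aeval (fun v => f v x) P ≠ 0 := by
    rw [Filter.eventually_all_finset]
    intro P hP
    refine Ultrafilter.eventually_not.2 fun h => hT P hP ?_
    rw [key]
    exact Germ.coe_eq.2 h
  obtain ⟨x, hx⟩ := (h1.and h2).exists
  exact ⟨_, hx⟩

theorem exists_big_embedding {k d n : ℕ} {p : MvPolynomial (Fin k × Fin n) ℚ}
    {τ : Fin k → Fin d → Fin k} (h : ∀ M : ℕ, ZEmb (ZQ p) τ (Fin M)) (X : Type) :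
    ∃ (R : Type) (_ : Field R) (_ : Algebra ℚ R), Transfer R ∧
      ∃ y : (Fin d → X) → Fin n → R, Function.Injective y ∧
        ∀ q : Fin k → Fin d → X, Comp τ q → ∃ π : Equiv.Perm (Fin k),
          aeval (fun v : Fin k × Fin n => y (q (π v.1)) v.2) p = 0 := by
  classical
  let U : Ultrafilter (Finset X) := Ultrafilter.of atTop
  have hU : ∀ x : X, ∀ᶠ F in (U : Filter (Finset X)), x ∈ F := fun x =>
    Ultrafilter.of_le (f := (atTop : Filter (Finset X)))
      ((eventually_ge_atTop {x}).mono fun F hF => by simpa using hF)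
  have h1 : ∀ F : Finset X, ZEmb (ZQ p) τ F := by
    intro F
    obtain ⟨g, hg, hq⟩ := h F.card
    let e := F.equivFin
    refine ⟨fun a => g fun c => e (a c), fun a b hab => ?_, fun q hc => ?_⟩
    · funext c
      exact e.injective (congrFun (hg hab) c)
    · exact hq (fun i c => e (q i c)) ⟨fun i j hij => hc.1 (funext fun c =>
        e.injective (congrFun hij c)), fun i j c hij => congrArg e (hc.2 i j c hij)⟩
  choose g hg hq using h1
  let f : Finset X → (Fin d → X) → Fin n → ℝ := fun F a j =>
    if H : ∀ c, a c ∈ F then g F (fun c => ⟨a c, H c⟩) j else 0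
  have hm : ∀ a : Fin d → X, ∀ᶠ F in (U : Filter (Finset X)), ∀ c, a c ∈ F := fun a => by
    rw [eventually_all]; exact fun c => hU (a c)
  let _ : Algebra ℚ (Germ (U : Filter (Finset X)) ℝ) :=
    ((Germ.coeRingHom (R := ℝ) (U : Filter (Finset X))).comp
      (RingHom.pi fun _ => algebraMap ℚ ℝ)).toAlgebra
  let y : (Fin d → X) → Fin n → Germ (U : Filter (Finset X)) ℝ := fun a j =>
    ((fun F => f F a j : Finset X → ℝ) : Germ (U : Filter (Finset X)) ℝ)
  refine ⟨Germ (U : Filter (Finset X)) ℝ, inferInstance, inferInstance, transfer_germ U, y,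
    fun a b hab => ?_, fun q hc => ?_⟩
  · have h2 : ∀ᶠ F in (U : Filter (Finset X)), ∀ j, f F a j = f F b j := by
      rw [eventually_all]; exact fun j => Germ.coe_eq.1 (congrFun hab j)
    obtain ⟨F, ⟨hF, ha⟩, hb⟩ := ((h2.and (hm a)).and (hm b)).exists
    have h3 : g F (fun c => ⟨a c, ha c⟩) = g F (fun c => ⟨b c, hb c⟩) := by
      funext j
      have := hF j
      simp only [f] at this
      rwa [dif_pos ha, dif_pos hb] at this
    funext c
    simpa using congrFun (hg F h3) c
  · have h2 : ∀ᶠ F in (U : Filter (Finset X)), ∀ i c, q i c ∈ F := by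
      rw [eventually_all]; exact fun i => hm _
    have h3 : ∀ᶠ F in (U : Filter (Finset X)), ∃ π : Equiv.Perm (Fin k),
        aeval (fun v : Fin k × Fin n => f F (q (π v.1)) v.2) p = 0 := by
      refine h2.mono fun F hF => ?_
      obtain ⟨π, hπ⟩ := hq F (fun i c => ⟨q i c, hF i c⟩) ⟨fun i j hij => hc.1 (funext fun c => by
        simpa using congrFun hij c), fun i j c hij => by simp [hc.2 i j c hij]⟩
      refine ⟨π, ?_⟩
      unfold ZQ at hπ
      convert hπ using 3
      funext v
      simp only [f]
      rw [dif_pos]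
    rw [Ultrafilter.eventually_exists_iff] at h3
    obtain ⟨π, hπ⟩ := h3
    refine ⟨π, ?_⟩
    have := germ_eval₂ U (fun F (v : Fin k × Fin n) => f F (q (π v.1)) v.2)
      (algebraMap ℚ (Germ (U : Filter (Finset X)) ℝ)) p
    rw [aeval_def]
    refine this.trans ?_
    exact Germ.coe_eq.2 hπ

end QE

namespace QE
open Filter MvPolynomial

/-- A derivation of `R` with prescribed values on a transcendence basis. -/
theorem exists_derivation {R : Type} [Field R] [Algebra ℚ R] {ι : Type} {x : ι → R}
    (hx : IsTranscendenceBasis ℚ x) (f : ι → R) : ∃ D : Derivation ℚ R R, ∀ i, D (x i) = f i := by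
  let _ : Algebra (MvPolynomial ι ℚ) R := (aeval (R := ℚ) x).toRingHom.toAlgebra
  have hm : ∀ q : MvPolynomial ι ℚ, algebraMap (MvPolynomial ι ℚ) R q = aeval x q := fun _ => rfl
  have : IsScalarTower ℚ (MvPolynomial ι ℚ) R := IsScalarTower.of_algebraMap_eq' (by
    ext r; exact ((aeval (R := ℚ) x).commutes r).symm)
  have hinj : Function.Injective (algebraMap (MvPolynomial ι ℚ) R) := hx.1
  have : FaithfulSMul (MvPolynomial ι ℚ) R := (faithfulSMul_iff_algebraMap_injective _ _).2 hinj
  let _ : Algebra (FractionRing (MvPolynomial ι ℚ)) R := FractionRing.liftAlgebra _ _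
  have : Algebra.IsAlgebraic (MvPolynomial ι ℚ) R := by
    have h := hx.isAlgebraic
    refine Algebra.IsAlgebraic.of_ringHom_of_comp_eq (S := Algebra.adjoin ℚ (Set.range x)) (B := R)
      hx.1.aevalEquiv.toRingEquiv (RingHom.id R) hx.1.aevalEquiv.surjective
      Function.injective_id ?_
    ext q
    · simp
    · simp [hm]
  have : Algebra.IsAlgebraic (FractionRing (MvPolynomial ι ℚ)) R := by
    exact (IsFractionRing.comap_isAlgebraic_iff (A := MvPolynomial ι ℚ)).1 this
  have : CharZero R := algebraRat.charZero R
  have : CharZero (FractionRing (MvPolynomial ι ℚ)) := algebraRat.charZero _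
  have : Algebra.FormallyEtale (FractionRing (MvPolynomial ι ℚ)) R :=
    Algebra.FormallyEtale.of_isSeparable _ _
  have : Algebra.FormallyEtale (MvPolynomial ι ℚ) (FractionRing (MvPolynomial ι ℚ)) :=
    Algebra.FormallyEtale.of_isLocalization (nonZeroDivisors _)
  have : Algebra.FormallyEtale (MvPolynomial ι ℚ) R :=
    Algebra.FormallyEtale.comp _ (FractionRing (MvPolynomial ι ℚ)) _
  let e := KaehlerDifferential.tensorKaehlerEquivOfFormallyEtale ℚ (MvPolynomial ι ℚ) R
  let d0 : Derivation ℚ (MvPolynomial ι ℚ) R := mkDerivation ℚ f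
  let L := (d0.liftKaehlerDifferential.liftBaseChange R).comp e.symm.toLinearMap
  refine ⟨L.compDer (KaehlerDifferential.D ℚ R), fun i => ?_⟩
  have h1 : x i = algebraMap (MvPolynomial ι ℚ) R (X i) := by rw [hm, aeval_X]
  have h2 := KaehlerDifferential.tensorKaehlerEquivOfFormallyEtale_symm_D_algebraMap ℚ
    (MvPolynomial ι ℚ) R (X i)
  rw [h1]
  simp [L, e, h2, d0, mkDerivation_X]

theorem exists_minimal_relation {R : Type} [Field R] [Algebra ℚ R] {σ : Type} {w : σ → R}
    (hw : ¬ AlgebraicIndependent ℚ w) : ∃ G : MvPolynomial σ ℚ, G ≠ 0 ∧ aeval w G = 0 ∧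
      ∀ v ∈ G.vars, aeval w (pderiv v G) ≠ 0 := by
  rw [algebraicIndependent_iff] at hw
  push Not at hw
  obtain ⟨G, ⟨h1, h2⟩, hmin⟩ := WellFounded.has_min (InvImage.wf totalDegree Nat.lt_wfRel.wf)
    {G : MvPolynomial σ ℚ | aeval w G = 0 ∧ G ≠ 0} hw
  refine ⟨G, h2, h1, fun v hv h => ?_⟩
  have h3 : pderiv v G ≠ 0 := by
    obtain ⟨e, he, hve⟩ := (mem_vars_iff_mem_support v).1 hv
    intro h0
    have h4 := coeff_pderiv (i := v) G (e - Finsupp.single v 1)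
    have h5 : e - Finsupp.single v 1 + Finsupp.single v 1 = e :=
      tsub_add_cancel_of_le (Finsupp.single_le_iff.2
        (Nat.one_le_iff_ne_zero.2 (Finsupp.mem_support_iff.1 hve)))
    rw [h0, h5, coeff_zero] at h4
    rcases mul_eq_zero.1 h4.symm with h6 | h6
    · exact mem_support_iff.1 he h6
    · exact Nat.cast_add_one_ne_zero _ h6
  refine hmin _ ⟨h, h3⟩ ?_
  have h4 : ∀ e ∈ (pderiv v G).support, (e.sum fun _ n => n) + 1 ≤ G.totalDegree := by
    intro e he
    have h5 : e + Finsupp.single v 1 ∈ G.support := by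
      rw [mem_support_iff] at he ⊢
      intro h6
      rw [coeff_pderiv, h6, zero_mul] at he
      exact he rfl
    refine le_trans (le_of_eq ?_) (le_totalDegree h5)
    rw [Finsupp.sum_add_index' (fun _ => rfl) fun _ _ _ => rfl, Finsupp.sum_single_index rfl]
  obtain ⟨e, he⟩ := support_nonempty.2 h3
  change (pderiv v G).totalDegree < G.totalDegree
  rw [totalDegree, Finset.sup_lt_iff (lt_of_lt_of_le (Nat.succ_pos _) (h4 e he))]
  exact h4

theorem exists_local_equations {R : Type} [Field R] [Algebra ℚ R] {ι : Type} {x : ι → R}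
    (hx : IsTranscendenceBasis ℚ x) {n : ℕ} (y : Fin n → R) :
    ∃ (m : ℕ) (s : Fin m → ι) (G : Fin n → MvPolynomial (Option (Fin m)) ℚ),
      Function.Injective s ∧
      (∀ j, G j ≠ 0 ∧ aeval (fun o : Option (Fin m) => o.elim (y j) fun l => x (s l)) (G j) = 0 ∧
        aeval (fun o : Option (Fin m) => o.elim (y j) fun l => x (s l)) (pderiv none (G j)) ≠ 0) ∧
      ∀ l, ∃ j, aeval (fun o : Option (Fin m) => o.elim (y j) fun l => x (s l))
        (pderiv (some l) (G j)) ≠ 0 := by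
  classical
  have h0 : ∀ u : R, ¬ AlgebraicIndependent ℚ (fun o : Option ι => o.elim u x) := by
    intro u h
    exact (hx.1.option_iff_transcendental u).1 h (hx.isAlgebraic.isAlgebraic u)
  choose G hG h1 h2 using fun j => exists_minimal_relation (h0 (y j))
  have h3 : ∀ j, none ∈ (G j).vars := by
    intro j
    by_contra hn
    obtain ⟨q, hq⟩ := exists_rename_eq_of_vars_subset_range (G j) some (Option.some_injective ι)
      (fun o ho => by
        cases o with
        | none => exact (hn ho).elim
        | some i => exact ⟨i, rfl⟩)
    have h4 := h1 j
    rw [← hq, aeval_rename] at h4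
    have : q = 0 := algebraicIndependent_iff.1 hx.1 q h4
    exact hG j (by rw [← hq, this, map_zero])
  let S : Finset ι := Finset.univ.biUnion fun j => (G j).vars.eraseNone
  let e := S.equivFin
  let s : Fin S.card → ι := fun l => (e.symm l).1
  have hs : Function.Injective s := fun a b h => e.symm.injective (Subtype.ext h)
  have hos : Function.Injective (Option.map s) := Option.map_injective hs
  have h5 : ∀ j, ∃ q, rename (Option.map s) q = G j := by
    intro j
    refine exists_rename_eq_of_vars_subset_range (G j) _ hos fun o ho => ?_
    cases o with
    | none => exact ⟨none, rfl⟩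
    | some i =>
      have : i ∈ S := Finset.mem_biUnion.2 ⟨j, Finset.mem_univ _, Finset.mem_eraseNone.2 ho⟩
      exact ⟨some (e ⟨i, this⟩), by simp [s]⟩
  choose q hq using h5
  have hw : ∀ j, (fun o : Option (Fin S.card) => o.elim (y j) fun l => x (s l)) =
      (fun o : Option ι => o.elim (y j) x) ∘ Option.map s := by
    intro j; funext o; cases o <;> rfl
  have hd : ∀ j o, aeval (fun o : Option (Fin S.card) => o.elim (y j) fun l => x (s l))
      (pderiv o (q j)) = aeval (fun o : Option ι => o.elim (y j) x)
        (pderiv (Option.map s o) (G j)) := by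
    intro j o
    rw [← hq j, pderiv_rename hos, aeval_rename, hw]
  refine ⟨S.card, s, q, hs, fun j => ⟨fun h => hG j (by rw [← hq, h, map_zero]), ?_, ?_⟩, ?_⟩
  · rw [hw, ← aeval_rename, hq, h1]
  · rw [hd]; exact h2 j _ (h3 j)
  · intro l
    obtain ⟨j, -, hj⟩ := Finset.mem_biUnion.1 (e.symm l).2
    refine ⟨j, ?_⟩
    rw [hd]; exact h2 j _ (Finset.mem_eraseNone.1 hj)

/-- Uniform algebraic coordinates on a large grid. -/
theorem exists_uniform_coordinates (d n : ℕ) : ∃ X : Type, ∀ (R : Type) [Field R] [Algebra ℚ R]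
    (y : (Fin d → X) → Fin n → R), Function.Injective y →
    ∃ (ι : Type) (x : ι → R) (m : ℕ) (G : Fin n → MvPolynomial (Option (Fin m)) ℚ)
      (h : Fin d → ℕ → X) (s : (Fin d → ℕ) → Fin m → ι), IsTranscendenceBasis ℚ x ∧
      (∀ c, Function.Injective (h c)) ∧ Function.Injective s ∧ ∀ a, Function.Injective (s a) ∧
      (∀ j, aeval (fun o : Option (Fin m) => o.elim (y (fun c => h c (a c)) j)
          fun l => x (s a l)) (G j) = 0 ∧
        aeval (fun o : Option (Fin m) => o.elim (y (fun c => h c (a c)) j)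
          fun l => x (s a l)) (pderiv none (G j)) ≠ 0) ∧
      ∀ l, ∃ j, aeval (fun o : Option (Fin m) => o.elim (y (fun c => h c (a c)) j)
        fun l => x (s a l)) (pderiv (some l) (G j)) ≠ 0 := by
  classical
  obtain ⟨X, hX⟩ := exists_polarized d
  refine ⟨X, fun R _ _ y hy => ?_⟩
  have : CharZero R := algebraRat.charZero R
  obtain ⟨ι, x, hx⟩ := exists_isTranscendenceBasis' ℚ R
  choose m s G hs h1 h2 using fun a => exists_local_equations hx (y a)
  have hcount : ∀ (m : ℕ) (t : Fin m → ι), ∃ e : R → ℕ, Set.InjOn e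
      {r | IsAlgebraic (Algebra.adjoin ℚ (Set.range (x ∘ t))) r} := fun m t => by
    have : Countable (Algebra.adjoin ℚ (Set.range (x ∘ t))) := by
      have h3 : Countable (MvPolynomial (Fin m) ℚ) := mk_le_aleph0_iff.1
        (MvPolynomial.cardinalMk_le_max.trans (by simp))
      have hr : Function.Surjective (fun q : MvPolynomial (Fin m) ℚ =>
          (⟨aeval (x ∘ t) q, by
            rw [Algebra.adjoin_range_eq_range_aeval]; exact ⟨q, rfl⟩⟩ :
            Algebra.adjoin ℚ (Set.range (x ∘ t)))) := by
        rintro ⟨r, hr⟩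
        have h4 := hr
        rw [Algebra.adjoin_range_eq_range_aeval] at h4
        obtain ⟨q, hq⟩ := h4
        exact ⟨q, Subtype.ext hq⟩
      exact hr.countable
    exact Set.countable_iff_exists_injOn.1 (Algebraic.countable _ _)
  choose e he using hcount
  have : Countable (Σ m, (Fin n → MvPolynomial (Option (Fin m)) ℚ) × (Fin n → ℕ)) := by
    have : ∀ m, Countable (MvPolynomial (Option (Fin m)) ℚ) := fun m => mk_le_aleph0_iff.1
        (MvPolynomial.cardinalMk_le_max.trans (by simp))
    infer_instance
  obtain ⟨E, hE⟩ := exists_injective_nat (Σ m, (Fin n → MvPolynomial (Option (Fin m)) ℚ) × (Fin n → ℕ))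
  let C : (Fin d → X) → (Σ m, (Fin n → MvPolynomial (Option (Fin m)) ℚ) × (Fin n → ℕ)) :=
    fun a => ⟨m a, G a, fun j => e (m a) (s a) (y a j)⟩
  let Good : (Σ m, (Fin n → MvPolynomial (Option (Fin m)) ℚ) × (Fin n → ℕ)) → (Fin d → X) → Prop :=
    fun c a => ∃ t : Fin c.1 → ι, Function.Injective t ∧
      (∀ j, c.2.1 j ≠ 0 ∧
        aeval (fun o : Option (Fin c.1) => o.elim (y a j) fun l => x (t l)) (c.2.1 j) = 0 ∧
        aeval (fun o : Option (Fin c.1) => o.elim (y a j) fun l => x (t l))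
          (pderiv none (c.2.1 j)) ≠ 0) ∧
      (∀ l, ∃ j, aeval (fun o : Option (Fin c.1) => o.elim (y a j) fun l => x (t l))
        (pderiv (some l) (c.2.1 j)) ≠ 0) ∧ ∀ j, e c.1 t (y a j) = c.2.2 j
  have hGood : ∀ a, Good (C a) a := fun a => ⟨s a, hs a, h1 a, h2 a, fun j => rfl⟩
  obtain ⟨h, hh, col, hcol⟩ := hX fun a => E (C a)
  let p : (Fin d → ℕ) → Fin d → X := fun a c => h c (a c)
  have hp : Function.Injective p := fun a b hab => funext fun c => hh c (congrFun hab c)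
  have hc : ∀ a, Good (C (p 0)) (p a) := fun a => by
    have h3 : C (p 0) = C (p a) := hE ((hcol 0).trans (hcol a).symm)
    rw [h3]; exact hGood _
  choose t ht h3 h4 h5 using hc
  refine ⟨ι, x, (C (p 0)).1, (C (p 0)).2.1, h, t, hx, hh, fun a b hab => ?_, fun a =>
    ⟨ht a, fun j => (h3 a j).2, h4 a⟩⟩
  refine hp (hy (funext fun j => ?_))
  have halg : ∀ a j, IsAlgebraic (Algebra.adjoin ℚ (Set.range (x ∘ t a))) (y (p a) j) := by
    intro a j
    by_contra hn
    refine (h3 a j).1 (algebraicIndependent_iff.1 (((hx.1.comp (t a) (ht a)).option_iff_transcendental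
      (y (p a) j)).2 hn) _ (h3 a j).2.1)
  refine he _ (t a) (halg a j) ?_ ((h5 a j).trans ?_)
  · rw [hab]; exact halg b j
  · rw [hab]; exact (h5 b j).symm

end QE

namespace QE
open Filter MvPolynomial

theorem derivation_aeval {R σ : Type*} [Field R] [Algebra ℚ R] (D : Derivation ℚ R R) (w : σ → R)
    (Δ : Derivation ℚ (MvPolynomial σ ℚ) (MvPolynomial σ ℚ)) (t : R)
    (h : ∀ v, aeval w (Δ (X v)) = t * D (w v)) (q : MvPolynomial σ ℚ) :
    aeval w (Δ q) = t * D (aeval w q) := by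
  induction q using MvPolynomial.induction_on with
  | C r => rw [derivation_C, map_zero, algHom_C, Derivation.map_algebraMap, mul_zero]
  | add p q hp hq => simp only [map_add, hp, hq]; ring
  | mul_X p v hp =>
    simp only [Derivation.leibniz, map_add, smul_eq_mul, map_mul, aeval_X, hp, h]
    ring

theorem derivation_aeval_sum {R σ : Type*} [Fintype σ] [Field R] [Algebra ℚ R]
    (D : Derivation ℚ R R) (w : σ → R) (q : MvPolynomial σ ℚ) :
    D (aeval w q) = ∑ v, aeval w (pderiv v q) * D (w v) := by
  classical
  induction q using MvPolynomial.induction_on with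
  | C r =>
    rw [algHom_C, Derivation.map_algebraMap]
    simp
  | add p q hp hq => simp only [map_add, hp, hq, add_mul, Finset.sum_add_distrib]
  | mul_X p v hp =>
    simp only [Derivation.leibniz, map_add, smul_eq_mul, map_mul, aeval_X, hp, add_mul,
      Finset.sum_add_distrib, pderiv_X, Finset.mul_sum]
    congr 1
    · rw [Finset.sum_eq_single v]
      · simp
      · intro b _ hb; simp [Ne.symm hb]
      · simp
    · exact Finset.sum_congr rfl fun _ _ => by ring

section data
variable {d k m n : ℕ} (G : Fin n → MvPolynomial (Option (Fin m)) ℚ) (l : Fin d → Fin m)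

/-- The partial derivative of an equation, at the grid point `a`. -/
noncomputable def pl (a : Fin d → Fin k) (j : Fin n) (o : Option (Fin m)) :
    MvPolynomial ((Fin d → Fin k) × (Fin m ⊕ Fin n)) ℚ :=
  rename (fun o' : Option (Fin m) => (a, o'.elim (Sum.inr j) Sum.inl)) (pderiv o (G j))

/-- The coordinate derivations on grids, cleared of denominators. -/
noncomputable def dl (i : Fin d) (t : Fin k) :
    Derivation ℚ (MvPolynomial ((Fin d → Fin k) × (Fin m ⊕ Fin n)) ℚ)
      (MvPolynomial ((Fin d → Fin k) × (Fin m ⊕ Fin n)) ℚ) :=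
  mkDerivation ℚ fun v => v.2.elim
    (fun l' => if l' = l i ∧ v.1 i = t then
      ∏ b : (Fin d → Fin k) × Fin n, pl G b.1 b.2 none else 0)
    (fun j => if v.1 i = t then - pl G v.1 j (some (l i)) *
      ∏ b ∈ Finset.univ.erase (v.1, j), pl G b.1 b.2 none else 0)

theorem aeval_pl {K : Type*} [Field K] [Algebra ℚ K]
    (Z : (Fin d → Fin k) × (Fin m ⊕ Fin n) → K) (a : Fin d → Fin k) (j : Fin n)
    (o : Option (Fin m)) : aeval Z (pl G a j o) =
      aeval (fun o' : Option (Fin m) => o'.elim (Z (a, Sum.inr j)) fun l => Z (a, Sum.inl l))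
        (pderiv o (G j)) := by
  rw [pl, aeval_rename]
  congr 2
  funext o'
  cases o' <;> rfl

end data

theorem exists_real_data {k d n : ℕ} (hk : 2 ≤ k) {p : MvPolynomial (Fin k × Fin n) ℚ}
    {τ : Fin k → Fin d → Fin k} (h : ∀ M : ℕ, ZEmb (ZQ p) τ (Fin M)) :
    ∃ (m : ℕ) (G : Fin n → MvPolynomial (Option (Fin m)) ℚ) (l : Fin d → Fin m)
      (jj : Fin d → Fin n) (I : Ideal (MvPolynomial ((Fin d → Fin k) × (Fin m ⊕ Fin n)) ℚ))
      (c : Fin m → ℝ) (y : Fin n → ℝ),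
      (∀ i t, ∀ q ∈ I, dl G l i t q ∈ I) ∧
      (∀ q ∈ I, aeval (fun v => Sum.elim c y v.2) q = 0) ∧
      (∀ j, aeval (fun o : Option (Fin m) => o.elim (y j) c) (G j) = 0 ∧
        aeval (fun o : Option (Fin m) => o.elim (y j) c) (pderiv none (G j)) ≠ 0) ∧
      (∀ i, aeval (fun o : Option (Fin m) => o.elim (y (jj i)) c)
        (pderiv (some (l i)) (G (jj i))) ≠ 0) ∧
      ∀ q : Fin k → Fin d → Fin k, Comp τ q → ∃ π : Equiv.Perm (Fin k),
        rename (fun v : Fin k × Fin n => (q (π v.1), Sum.inr v.2)) p ∈ I := by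
  classical
  obtain ⟨X, hX⟩ := exists_uniform_coordinates d n
  obtain ⟨R, _, _, hT, y', hy', hedge'⟩ := exists_big_embedding h X
  obtain ⟨ι, x, m, G, h, s, hx, hh, hs, hloc⟩ := hX R y' hy'
  let y : (Fin d → ℕ) → Fin n → R := fun a => y' fun c => h c (a c)
  have hedge : ∀ q : Fin k → Fin d → ℕ, Comp τ q → ∃ π : Equiv.Perm (Fin k),
      aeval (fun v : Fin k × Fin n => y (q (π v.1)) v.2) p = 0 := fun q hq =>
    hedge' (fun i c => h c (q i c)) ⟨fun i j hij => hq.1 (funext fun c =>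
      hh c (congrFun hij c)), fun i j c hij => congrArg (h c) (hq.2 i j c hij)⟩
  clear hedge'
  let U : Ultrafilter ℕ := hyperfilter ℕ
  have hU : ∀ x, {x}ᶜ ∈ U := fun x => (Set.finite_singleton x).compl_mem_hyperfilter
  let Z : (Fin d → ℕ) → Fin m ⊕ Fin n → R := fun a => Sum.elim (fun l => x (s a l)) (y a)
  let Yg : (Fin d → Fin k → ℕ) → (Fin d → Fin k) × (Fin m ⊕ Fin n) → R :=
    fun z v => Z (pick z v.1) v.2
  have hinj := gr_injective (d := d) (k := k) hU
  have hl : ∀ i : Fin d, ∃ l, ∀ a b : Fin d → Fin k, a i ≠ b i →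
      ∀ᶠ z : Fin d → Fin k → ℕ in gr U d k, s (pick z a) l ≠ s (pick z b) l := by
    intro i
    by_contra hc
    push Not at hc
    let u : Fin k := ⟨0, by omega⟩
    let v : Fin k := ⟨1, by omega⟩
    have h1 : ∀ l, ∀ᶠ z : Fin d → Fin k → ℕ in gr U d k,
        s (pick z fun _ => u) l = s (pick z (Function.update (fun _ => u) i v)) l := by
      intro l
      obtain ⟨a, b, hab, hn⟩ := hc l
      have h2 : ∀ᶠ z : Fin d → Fin k → ℕ in gr U d k, s (pick z a) l = s (pick z b) l := hn
      exact gr_indep a b hab (f := fun x => s x l) (g := fun x => s x l) h2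
    obtain ⟨z, hz, hzi⟩ := ((eventually_all.2 h1).and hinj).exists
    have h3 := congrFun (hs (funext hz)) i
    simp only [pick, Function.update_self] at h3
    have := hzi i h3
    simp [u, v] at this
  choose l hl using hl
  have hP1 : ∀ᶠ z : Fin d → Fin k → ℕ in gr U d k, ∀ (a b : Fin d → Fin k) (l l' : Fin m),
      s (pick z a) l = s (pick z b) l' → l = l' := by
    simp only [eventually_all]
    intro a b l l'
    by_cases hll : l = l'
    · exact Eventually.of_forall fun _ _ => hll
    refine (Ultrafilter.eventually_not.2 fun hc => ?_).mono fun z hz hz' => (hz hz').elim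
    obtain ⟨w, hw⟩ := (gr_diag a b (f := fun x => s x l) (g := fun x => s x l') hc).exists
    exact hll ((hloc w).1 hw)
  have hP2 : ∀ᶠ z : Fin d → Fin k → ℕ in gr U d k, ∀ (i : Fin d) (a b : Fin d → Fin k),
      s (pick z a) (l i) = s (pick z b) (l i) → a i = b i := by
    simp only [eventually_all]
    intro i a b
    by_cases hab : a i = b i
    · exact Eventually.of_forall fun _ _ => hab
    exact (hl i a b hab).mono fun z hz hz' => (hz hz').elim
  let I := genIdeal (S := ℚ) (gr U d k : Filter (Fin d → Fin k → ℕ)) Yg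
  have hI : ∀ i t, ∀ q ∈ I, dl G l i t q ∈ I := by
    intro i t q hq
    refine mem_genIdeal.2 ?_
    filter_upwards [hP1, hP2, mem_genIdeal.1 hq] with z h1 h2 h3
    obtain ⟨D, hD⟩ := exists_derivation hx fun e =>
      if ∃ b : Fin d → Fin k, b i = t ∧ s (pick z b) (l i) = e then 1 else 0
    have hDs : ∀ a l', D (x (s (pick z a) l')) = if l' = l i ∧ a i = t then 1 else 0 := by
      intro a l'
      rw [hD]
      congr 1
      refine propext ⟨?_, ?_⟩
      · rintro ⟨b, hb, hbe⟩
        have h4 := h1 _ _ _ _ hbe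
        subst h4
        exact ⟨rfl, by rw [← hb]; exact (h2 i b a hbe).symm⟩
      · rintro ⟨rfl, ha⟩
        exact ⟨a, ha, rfl⟩
    have hpl : ∀ a j o, aeval (Yg z) (pl G a j o) = aeval (fun o : Option (Fin m) =>
        o.elim (y (pick z a) j) fun l => x (s (pick z a) l)) (pderiv o (G j)) := fun a j o =>
      aeval_pl G (Yg z) a j o
    have hDy : ∀ a j, aeval (Yg z) (pl G a j none) * D (y (pick z a) j) =
        if a i = t then - aeval (Yg z) (pl G a j (some (l i))) else 0 := by
      intro a j
      have h4 := derivation_aeval_sum D (fun o : Option (Fin m) =>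
        o.elim (y (pick z a) j) fun l => x (s (pick z a) l)) (G j)
      rw [((hloc (pick z a)).2.1 j).1, map_zero, Fintype.sum_option] at h4
      simp only [Option.elim_none, Option.elim_some, hDs, ← hpl] at h4
      have h5 : ∑ i', aeval (Yg z) (pl G a j (some i')) * (if i' = l i ∧ a i = t then 1 else 0) =
          if a i = t then aeval (Yg z) (pl G a j (some (l i))) else 0 := by
        rw [Finset.sum_eq_single (l i)]
        · simp
        · intro b _ hb; simp [hb]
        · simp
      rw [h5] at h4
      split_ifs at h4 ⊢ with h6
      · linear_combination -h4
      · linear_combination -h4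
    have key := derivation_aeval D (Yg z) (dl G l i t)
      (aeval (Yg z) (∏ b : (Fin d → Fin k) × Fin n, pl G b.1 b.2 none)) (fun v => ?_) q
    · rw [key, h3, map_zero, mul_zero]
    · rw [dl, mkDerivation_X]
      obtain ⟨a, l' | j⟩ := v
      · have : Yg z (a, Sum.inl l') = x (s (pick z a) l') := rfl
        rw [this, hDs]
        simp only [Sum.elim_inl]
        split_ifs <;> simp
      · have : Yg z (a, Sum.inr j) = y (pick z a) j := rfl
        rw [this, ← Finset.mul_prod_erase _ _ (Finset.mem_univ (a, j)), map_mul,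
          mul_right_comm, hDy]
        simp only [Sum.elim_inr]
        split_ifs <;> simp
  have hq : ∀ q : Fin k → Fin d → Fin k, Comp τ q → ∃ π : Equiv.Perm (Fin k),
        rename (fun v : Fin k × Fin n => (q (π v.1), Sum.inr v.2)) p ∈ I := by
    intro q hq
    have h1 : ∀ᶠ z : Fin d → Fin k → ℕ in gr U d k, ∃ π : Equiv.Perm (Fin k),
        aeval (Yg z) (rename (fun v : Fin k × Fin n =>
          ((q (π v.1), Sum.inr v.2) : (Fin d → Fin k) × (Fin m ⊕ Fin n))) p) = 0 := by
      filter_upwards [hinj] with z hz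
      obtain ⟨π, hπ⟩ := hedge (fun i => pick z (q i)) ⟨fun i j hij => hq.1 (funext fun c =>
        hz c (congrFun hij c)), fun i j c hij => congrArg (z c) (hq.2 i j c hij)⟩
      refine ⟨π, ?_⟩
      rw [aeval_rename]
      exact hπ
    exact Ultrafilter.eventually_exists_iff.1 h1
  obtain ⟨Sg, hSg⟩ := (isNoetherianRing_iff_ideal_fg _).1
    (inferInstance : IsNoetherianRing (MvPolynomial ((Fin d → Fin k) × (Fin m ⊕ Fin n)) ℚ)) I
  have hx0 : ∀ᶠ x : Fin d → ℕ in pw U d, ∀ q ∈ Sg, aeval (fun v : (Fin d → Fin k) × (Fin m ⊕ Fin n) =>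
      Z x v.2) q = 0 := by
    rw [Filter.eventually_all_finset]
    intro q hq
    have hqI : q ∈ I := hSg ▸ Ideal.subset_span hq
    exact gr_collapse Z q (mem_genIdeal.1 hqI)
  obtain ⟨x0, hx0⟩ := hx0.exists
  choose jj hjj using fun i => (hloc x0).2.2 (l i)
  let ρ : Fin n → Option (Fin m) → Fin m ⊕ Fin n := fun j o => o.elim (Sum.inr j) Sum.inl
  have hρ : ∀ {K : Type} (w : Fin m ⊕ Fin n → K) (j : Fin n), w ∘ ρ j =
      fun o : Option (Fin m) => o.elim (w (Sum.inr j)) fun l => w (Sum.inl l) := by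
    intro K w j; funext o; cases o <;> rfl
  obtain ⟨w, hw1, hw2⟩ := hT (Fin m ⊕ Fin n) (Z x0)
    (Sg.image (rename Prod.snd) ∪ Finset.univ.image fun j => rename (ρ j) (G j))
    ((Finset.univ.image fun j => rename (ρ j) (pderiv none (G j))) ∪
      Finset.univ.image fun i => rename (ρ (jj i)) (pderiv (some (l i)) (G (jj i))))
    (by
      intro P hP
      rcases Finset.mem_union.1 hP with hP | hP
      · obtain ⟨q, hq, rfl⟩ := Finset.mem_image.1 hP
        rw [aeval_rename]; exact hx0 q hq
      · obtain ⟨j, -, rfl⟩ := Finset.mem_image.1 hP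
        rw [aeval_rename, hρ]; exact ((hloc x0).2.1 j).1)
    (by
      intro P hP
      rcases Finset.mem_union.1 hP with hP | hP
      · obtain ⟨j, -, rfl⟩ := Finset.mem_image.1 hP
        rw [aeval_rename, hρ]; exact ((hloc x0).2.1 j).2
      · obtain ⟨i, -, rfl⟩ := Finset.mem_image.1 hP
        rw [aeval_rename, hρ]; exact hjj i)
  refine ⟨m, G, l, jj, I, fun l => w (Sum.inl l), fun j => w (Sum.inr j), hI, fun q hq => ?_,
    fun j => ⟨?_, ?_⟩, fun i => ?_, hq⟩
  · have h1 : I ≤ RingHom.ker (aeval (R := ℚ)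
        (fun v : (Fin d → Fin k) × (Fin m ⊕ Fin n) => w v.2)) := by
      rw [← hSg, Ideal.span_le]
      intro q hq
      have := hw1 _ (Finset.mem_union_left _ (Finset.mem_image_of_mem _ hq))
      rw [aeval_rename] at this
      exact this
    have h2 : Sum.elim (fun l => w (Sum.inl l)) (fun j => w (Sum.inr j)) = w := by
      funext v; cases v <;> rfl
    rw [h2]
    exact h1 hq
  · have := hw1 _ (Finset.mem_union_right _ (Finset.mem_image_of_mem _ (Finset.mem_univ j)))
    rwa [aeval_rename, hρ] at this
  · have := hw2 _ (Finset.mem_union_left _ (Finset.mem_image_of_mem _ (Finset.mem_univ j)))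
    rwa [aeval_rename, hρ] at this
  · have := hw2 _ (Finset.mem_union_right _ (Finset.mem_image_of_mem _ (Finset.mem_univ i)))
    rwa [aeval_rename, hρ] at this

end QE

namespace QE
open Filter MvPolynomial Topology

theorem contDiff_aeval {σ : Type*} [Fintype σ] {N : WithTop ℕ∞} (q : MvPolynomial σ ℚ) :
    ContDiff ℝ N fun w : σ → ℝ => aeval w q := by
  induction q using MvPolynomial.induction_on with
  | C r => simp only [algHom_C]; exact contDiff_const
  | add p q hp hq => simp only [map_add]; exact hp.add hq
  | mul_X p v hp => simp only [map_mul, aeval_X]; exact hp.mul (contDiff_apply ℝ ℝ v)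

theorem continuous_aeval {σ : Type*} [Fintype σ] (q : MvPolynomial σ ℚ) :
    Continuous fun w : σ → ℝ => aeval w q := (contDiff_aeval (N := 0) q).continuous

/-- Chain rule along a curve whose velocity is a combination of derivations. -/
theorem hasDerivAt_aeval {σ E : Type*} [Fintype E] {F : ℝ → σ → ℝ} {F' : σ → ℝ} {s W : ℝ}
    {coef : E → ℝ} {Δ : E → Derivation ℚ (MvPolynomial σ ℚ) (MvPolynomial σ ℚ)}
    (hF : ∀ v, HasDerivAt (fun s => F s v) (F' v) s)
    (h : ∀ v, W * F' v = ∑ e, coef e * aeval (F s) (Δ e (X v))) (q : MvPolynomial σ ℚ) :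
    ∃ D : ℝ, HasDerivAt (fun s => aeval (F s) q) D s ∧
      W * D = ∑ e, coef e * aeval (F s) (Δ e q) := by
  induction q using MvPolynomial.induction_on with
  | C r =>
    refine ⟨0, ?_, ?_⟩
    · simp only [algHom_C]; exact hasDerivAt_const _ _
    · simp [derivation_C]
  | add p q hp hq =>
    obtain ⟨D, h1, h2⟩ := hp
    obtain ⟨D', h1', h2'⟩ := hq
    refine ⟨D + D', ?_, ?_⟩
    · simp only [map_add]; exact h1.add h1'
    · rw [mul_add, h2, h2', ← Finset.sum_add_distrib]
      refine Finset.sum_congr rfl fun e _ => ?_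
      simp only [map_add]; ring
  | mul_X p v hp =>
    obtain ⟨D, h1, h2⟩ := hp
    refine ⟨D * F s v + aeval (F s) p * F' v, ?_, ?_⟩
    · simp only [map_mul, aeval_X]; exact h1.mul (hF v)
    · rw [mul_add, ← mul_assoc, h2, mul_left_comm, h v, Finset.sum_mul, Finset.mul_sum,
        ← Finset.sum_add_distrib]
      refine Finset.sum_congr rfl fun e _ => ?_
      simp only [Derivation.leibniz, map_add, smul_eq_mul, map_mul, aeval_X]; ring

theorem hasDerivAt_aeval_pderiv {σ : Type*} [Fintype σ] {F : ℝ → σ → ℝ} {F' : σ → ℝ} {s : ℝ}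
    (hF : ∀ v, HasDerivAt (fun s => F s v) (F' v) s) (q : MvPolynomial σ ℚ) :
    HasDerivAt (fun s => aeval (F s) q) (∑ e, F' e * aeval (F s) (pderiv e q)) s := by
  classical
  obtain ⟨D, h1, h2⟩ := hasDerivAt_aeval (W := 1) (coef := F') (Δ := fun e => pderiv e) hF
    (fun v => by
      rw [one_mul, Finset.sum_eq_single v]
      · simp
      · intro b _ hb; simp [pderiv_X_of_ne hb.symm]
      · simp) q
  rw [one_mul] at h2
  rwa [h2] at h1

/-- Vanishing of a differential ideal propagates along curves. -/
theorem ideal_vanish {σ E : Type*} [Fintype σ] [Fintype E] (I : Ideal (MvPolynomial σ ℚ))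
    {F F' : ℝ → σ → ℝ} (w : MvPolynomial σ ℚ)
    {coef : E → ℝ} {Δ : E → Derivation ℚ (MvPolynomial σ ℚ) (MvPolynomial σ ℚ)}
    (hI : ∀ e, ∀ q ∈ I, Δ e q ∈ I)
    (hF : ∀ s ∈ Set.Icc (0 : ℝ) 1, ∀ v, HasDerivAt (fun s => F s v) (F' s v) s)
    (hw : ∀ s ∈ Set.Icc (0 : ℝ) 1, aeval (F s) w ≠ (0 : ℝ))
    (h : ∀ s ∈ Set.Icc (0 : ℝ) 1, ∀ v,
      aeval (F s) w * F' s v = ∑ e, coef e * aeval (F s) (Δ e (X v)))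
    (h0 : ∀ q ∈ I, aeval (F 0) q = (0 : ℝ)) : ∀ q ∈ I, aeval (F 1) q = (0 : ℝ) := by
  classical
  have hFG : I.FG := (inferInstance : IsNoetherianRing (MvPolynomial σ ℚ)).noetherian I
  obtain ⟨N, g, hg⟩ := Submodule.fg_iff_exists_fin_generating_family.1 hFG
  have hgI : ∀ r, g r ∈ I := fun r => hg ▸ Submodule.subset_span ⟨r, rfl⟩
  have hspan : ∀ q ∈ I, ∃ a : Fin N → MvPolynomial σ ℚ, ∑ r, a r * g r = q := by
    intro q hq
    rw [← hg] at hq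
    exact (Ideal.mem_span_range_iff_exists_fun).1 hq
  choose a ha using fun e r => hspan _ (hI e _ (hgI r))
  let u : ℝ → Fin N → ℝ := fun s r => aeval (F s) (g r)
  have hcF : ContinuousOn F (Set.Icc 0 1) := by
    rw [continuousOn_pi]
    exact fun v s hs => (hF s hs v).continuousAt.continuousWithinAt
  have hcq : ∀ q : MvPolynomial σ ℚ, ContinuousOn (fun s => aeval (F s) q) (Set.Icc 0 1) :=
    fun q => (continuous_aeval q).comp_continuousOn hcF
  let B : ℝ → ℝ := fun s => ∑ r, ∑ e, ∑ r', |coef e * aeval (F s) (a e r r') / aeval (F s) w|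
  have hB : ContinuousOn B (Set.Icc 0 1) := by
    refine continuousOn_finsetSum _ fun r _ => continuousOn_finsetSum _ fun e _ =>
      continuousOn_finsetSum _ fun r' _ => ContinuousOn.abs ?_
    exact ((hcq _).const_smul (coef e)).div (hcq w) hw
  obtain ⟨K, hK⟩ := isCompact_Icc.bddAbove_image hB
  have hD : ∀ r, ∀ s ∈ Set.Icc (0 : ℝ) 1, ∃ D : ℝ, HasDerivAt (fun s => u s r) D s ∧
      |D| ≤ K * ‖u s‖ := by
    intro r s hs
    obtain ⟨D, h1, h2⟩ := hasDerivAt_aeval (hF s hs) (h s hs) (g r)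
    refine ⟨D, h1, ?_⟩
    have h3 : D = ∑ e, ∑ r', coef e * aeval (F s) (a e r r') / aeval (F s) w * u s r' := by
      rw [← mul_right_inj' (hw s hs), h2, Finset.mul_sum]
      refine Finset.sum_congr rfl fun e _ => ?_
      rw [← ha e r, map_sum, Finset.mul_sum, Finset.mul_sum]
      refine Finset.sum_congr rfl fun r' _ => ?_
      have := hw s hs
      rw [map_mul]
      field_simp
      ring
    calc |D| ≤ ∑ e, ∑ r', |coef e * aeval (F s) (a e r r') / aeval (F s) w| * ‖u s‖ := by
          rw [h3]
          refine (Finset.abs_sum_le_sum_abs _ _).trans (Finset.sum_le_sum fun e _ =>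
            (Finset.abs_sum_le_sum_abs _ _).trans (Finset.sum_le_sum fun r' _ => ?_))
          rw [abs_mul]
          exact mul_le_mul_of_nonneg_left (norm_le_pi_norm (u s) r') (abs_nonneg _)
      _ = (∑ e, ∑ r', |coef e * aeval (F s) (a e r r') / aeval (F s) w|) * ‖u s‖ := by
          simp only [Finset.sum_mul]
      _ ≤ B s * ‖u s‖ := by
          refine mul_le_mul_of_nonneg_right ?_ (norm_nonneg _)
          exact Finset.single_le_sum
            (f := fun r => ∑ e, ∑ r', |coef e * aeval (F s) (a e r r') / aeval (F s) w|)
            (fun r _ => Finset.sum_nonneg fun e _ => Finset.sum_nonneg fun r' _ => abs_nonneg _)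
            (Finset.mem_univ r)
      _ ≤ K * ‖u s‖ := mul_le_mul_of_nonneg_right (hK ⟨s, hs, rfl⟩) (norm_nonneg _)
  choose! D hD1 hD2 using hD
  have hu : ∀ s ∈ Set.Icc (0 : ℝ) 1, HasDerivAt u (fun r => D r s) s := fun s hs =>
    hasDerivAt_pi.2 fun r => hD1 r s hs
  have hfin : ∀ s ∈ Set.Icc (0 : ℝ) 1, u s = 0 := by
    refine eq_zero_of_abs_deriv_le_mul_abs_self_of_eq_zero_right (K := |K|)
      (f' := fun s r => D r s)
      (fun s hs => (hu s hs).continuousAt.continuousWithinAt)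
      (fun s hs => (hu s (Set.Ico_subset_Icc_self hs)).hasDerivWithinAt)
      (funext fun r => h0 _ (hgI r)) fun s hs => ?_
    have hs' := Set.Ico_subset_Icc_self hs
    exact (pi_norm_le_iff_of_nonneg (mul_nonneg (abs_nonneg K) (norm_nonneg _))).2 fun r =>
      (hD2 r s hs').trans (mul_le_mul_of_nonneg_right (le_abs_self K) (norm_nonneg _))
  intro q hq
  obtain ⟨b, rfl⟩ := hspan q hq
  rw [map_sum]
  refine Finset.sum_eq_zero fun r _ => ?_
  rw [map_mul]
  have := congrFun (hfin 1 (by simp)) r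
  simp only [Pi.zero_apply, u] at this
  rw [this, mul_zero]

end QE

namespace QE
open Filter MvPolynomial Topology

theorem exists_implicit {m : ℕ} (G : MvPolynomial (Option (Fin m)) ℚ) (c : Fin m → ℝ) (y : ℝ)
    (h0 : aeval (fun o => o.elim y c) G = (0 : ℝ))
    (h1 : aeval (fun o => o.elim y c) (pderiv none G) ≠ (0 : ℝ)) :
    ∃ φ : (Fin m → ℝ) → ℝ, φ c = y ∧ ContDiffAt ℝ 1 φ c ∧
      ∀ᶠ v : (Fin m → ℝ) × ℝ in 𝓝 (c, y),
        aeval (fun o : Option (Fin m) => o.elim v.2 v.1) G = (0 : ℝ) ↔ φ v.1 = v.2 := by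
  let w : (Fin m → ℝ) × ℝ → Option (Fin m) → ℝ := fun v o => o.elim v.2 v.1
  let f : (Fin m → ℝ) × ℝ → ℝ := fun v => aeval (w v) G
  have hw : ContDiff ℝ 1 w := by
    refine contDiff_pi.2 fun o => ?_
    rcases o with _ | l
    · exact contDiff_snd
    · exact (contDiff_apply ℝ ℝ l).comp contDiff_fst
  have hf : ContDiff ℝ 1 f := (contDiff_aeval G).comp hw
  have cdf : ContDiffAt ℝ 1 f (c, y) := hf.contDiffAt
  have hone : (fderiv ℝ f (c, y)) (0, 1) = aeval (w (c, y)) (pderiv none G) := by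
    have e1 : HasDerivAt (fun s : ℝ => f (c, s)) ((fderiv ℝ f (c, y)) (0, 1)) y := by
      have := (cdf.differentiableAt (by norm_num)).hasFDerivAt.comp_hasDerivAt y
        ((hasDerivAt_const y c).prodMk (hasDerivAt_id y))
      exact this
    have e2 := hasDerivAt_aeval_pderiv (F := fun s => w (c, s)) (F' := fun o => o.elim 1 0)
      (s := y) (fun o => by
        rcases o with _ | l
        · exact hasDerivAt_id y
        · exact hasDerivAt_const y (c l)) G
    rw [e1.unique e2, Fintype.sum_option]
    simp
  have if₂ : (fderiv ℝ f (c, y) ∘L .inr ℝ (Fin m → ℝ) ℝ).IsInvertible := by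
    have hne : (fderiv ℝ f (c, y)) (0, 1) ≠ 0 := by rw [hone]; exact h1
    refine ⟨ContinuousLinearEquiv.unitsEquivAut ℝ (Units.mk0 _ hne), ?_⟩
    ext
    simp
  refine ⟨cdf.implicitFunction one_ne_zero if₂, cdf.implicitFunction_apply_self one_ne_zero if₂,
    cdf.contDiffAt_implicitFunction one_ne_zero if₂, ?_⟩
  have := cdf.eventually_apply_eq_iff_implicitFunction one_ne_zero if₂
  have hz : f (c, y) = 0 := h0
  rw [hz] at this
  exact this

theorem eventually_small {α : Type*} [PseudoMetricSpace α] {a : α} {P : α → Prop}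
    (h : ∀ᶠ v in 𝓝 a, P v) : ∀ᶠ e in 𝓝[>] (0 : ℝ), ∀ v, dist v a < e → P v := by
  obtain ⟨e, he, h⟩ := Metric.eventually_nhds_iff.1 h
  filter_upwards [Ioo_mem_nhdsGT he] with e' he' v hv
  exact h (hv.trans he'.2)

/-- Simultaneous local solutions of the equations `G j = 0`. -/
theorem exists_local_solutions {m n d : ℕ} (G : Fin n → MvPolynomial (Option (Fin m)) ℚ)
    (l : Fin d → Fin m) (jj : Fin d → Fin n) (c : Fin m → ℝ) (y : Fin n → ℝ)
    (h : ∀ j, aeval (fun o : Option (Fin m) => o.elim (y j) c) (G j) = (0 : ℝ) ∧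
        aeval (fun o : Option (Fin m) => o.elim (y j) c) (pderiv none (G j)) ≠ (0 : ℝ))
    (hl : ∀ i, aeval (fun o : Option (Fin m) => o.elim (y (jj i)) c)
        (pderiv (some (l i)) (G (jj i))) ≠ (0 : ℝ)) :
    ∃ (ε r : ℝ) (φ : Fin n → (Fin m → ℝ) → ℝ), 0 < ε ∧ 0 < r ∧ (∀ j, φ j c = y j) ∧
      ∀ X : Fin m → ℝ, dist X c < r →
        (∀ j, |φ j X - y j| < ε ∧ DifferentiableAt ℝ (φ j) X) ∧
        (∀ j (Y : ℝ), |Y - y j| < ε →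
          (aeval (fun o : Option (Fin m) => o.elim Y X) (G j) = (0 : ℝ) ↔ φ j X = Y) ∧
          aeval (fun o : Option (Fin m) => o.elim Y X) (pderiv none (G j)) ≠ (0 : ℝ)) ∧
        ∀ i (Y : ℝ), |Y - y (jj i)| < ε →
          aeval (fun o : Option (Fin m) => o.elim Y X) (pderiv (some (l i)) (G (jj i))) ≠
            (0 : ℝ) := by
  choose φ hφc hφd hφ using fun j => exists_implicit (G j) c (y j) (h j).1 (h j).2
  have hne : ∀ (q : MvPolynomial (Option (Fin m)) ℚ) (y : ℝ),
      aeval (fun o : Option (Fin m) => o.elim y c) q ≠ (0 : ℝ) →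
      ∀ᶠ v : (Fin m → ℝ) × ℝ in 𝓝 (c, y),
        aeval (fun o : Option (Fin m) => o.elim v.2 v.1) q ≠ (0 : ℝ) := by
    intro q y hq
    have hc : Continuous fun v : (Fin m → ℝ) × ℝ =>
        aeval (fun o : Option (Fin m) => o.elim v.2 v.1) q := by
      refine (continuous_aeval q).comp (continuous_pi fun o => ?_)
      rcases o with _ | l
      · exact continuous_snd
      · exact (continuous_apply l).comp continuous_fst
    exact hc.continuousAt.eventually_ne hq
  have E1 := eventually_all.2 fun j => eventually_small ((hφ j).and (hne _ _ (h j).2))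
  have E2 := eventually_all.2 fun i => eventually_small (hne _ _ (hl i))
  obtain ⟨ε, ⟨hε1, hε2⟩, hε⟩ := ((E1.and E2).and self_mem_nhdsWithin).exists
  have hε : 0 < ε := hε
  have E3 : ∀ j, ∀ᶠ X in 𝓝 c, |φ j X - y j| < ε ∧ DifferentiableAt ℝ (φ j) X := by
    intro j
    refine Eventually.and ?_ ?_
    · have := (hφd j).continuousAt
      rw [Metric.continuousAt_iff'] at this
      filter_upwards [this ε hε] with X hX
      rwa [hφc j, Real.dist_eq] at hX
    · filter_upwards [(hφd j).eventually (by simp)] with X hX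
      exact hX.differentiableAt one_ne_zero
  have E4 := eventually_all.2 fun j => eventually_small (E3 j)
  obtain ⟨r, ⟨hr1, hr2⟩, hr⟩ := ((E4.and (Iio_mem_nhds hε |> mem_nhdsWithin_of_mem_nhds)).and
    self_mem_nhdsWithin).exists
  refine ⟨ε, r, φ, hε, hr, hφc, fun X hX => ⟨fun j => hr1 j X hX, fun j Y hY => ?_,
    fun i Y hY => ?_⟩⟩
  · exact hε1 j (X, Y) (by rw [Prod.dist_eq, Real.dist_eq]; exact max_lt (hX.trans hr2) hY)
  · exact hε2 i (X, Y) (by rw [Prod.dist_eq, Real.dist_eq]; exact max_lt (hX.trans hr2) hY)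

end QE

namespace QE
open Filter MvPolynomial Topology

/-- The open unit box. -/
def Box {d : ℕ} (x : Fin d → ℝ) : Prop := ∀ c, 0 < x c ∧ x c < 1

/-- A relation certifying that all finite template hypergraphs embed. -/
structure CertR {k d n : ℕ} (Z : (Fin k → Fin n → ℝ) → Prop) (τ : Fin k → Fin d → Fin k)
    (Γ : (Fin d → ℝ) → (Fin n → ℝ) → Prop) : Prop where
  total : ∀ x, Box x → ∃ Y, Γ x Y
  sep : ∀ x x' i, Box x → Box x' → x i ≠ x' i → (∀ j, j ≠ i → x j = x' j) →
    ∀ Y, Γ x Y → ¬ Γ x' Y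
  edge : ∀ x : Fin k → Fin d → ℝ, Comp τ x → (∀ i, Box (x i)) → ∀ Y : Fin k → Fin n → ℝ,
    (∀ i, Γ (x i) (Y i)) → ∃ π : Equiv.Perm (Fin k), Z fun i => Y (π i)

/-- The affine coordinates of a point of the box. -/
def crd {m d : ℕ} (c : Fin m → ℝ) (η : ℝ) (l : Fin d → Fin m) (x : Fin d → ℝ) (l' : Fin m) : ℝ :=
  c l' + η * ∑ i, if l i = l' then x i else 0

/-- The relation attached to a system of implicit equations. -/
def Gam {m n d : ℕ} (G : Fin n → MvPolynomial (Option (Fin m)) ℚ) (l : Fin d → Fin m)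
    (c : Fin m → ℝ) (y : Fin n → ℝ) (η ε : ℝ) (x : Fin d → ℝ) (Y : Fin n → ℝ) : Prop :=
  ∀ j, aeval (fun o : Option (Fin m) => o.elim (Y j) (crd c η l x)) (G j) = (0 : ℝ) ∧
    |Y j - y j| < ε

theorem hasDerivAt_crd {m d : ℕ} (c : Fin m → ℝ) (η : ℝ) (l : Fin d → Fin m) (l' : Fin m)
    {x : ℝ → Fin d → ℝ} {x' : Fin d → ℝ} {s : ℝ} (h : ∀ i, HasDerivAt (fun s => x s i) (x' i) s) :
    HasDerivAt (fun s => crd c η l (x s) l') (η * ∑ i, if l i = l' then x' i else 0) s := by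
  unfold crd
  refine (HasDerivAt.const_mul η (HasDerivAt.fun_sum fun i _ => ?_)).const_add _
  split_ifs
  · exact h i
  · exact hasDerivAt_const _ _

theorem dist_crd {m d : ℕ} (c : Fin m → ℝ) {r : ℝ} (hr : 0 < r) (l : Fin d → Fin m)
    {x : Fin d → ℝ} (hx : ∀ i, |x i| ≤ 2) : dist (crd c (r / (2 * d + 1)) l x) c < r := by
  rw [dist_pi_lt_iff hr]
  intro l'
  rw [Real.dist_eq, crd, add_sub_cancel_left, abs_mul, abs_of_pos (by positivity), div_mul_eq_mul_div,
    div_lt_iff₀ (by positivity)]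
  refine mul_lt_mul_of_pos_left ?_ hr
  calc |∑ i, if l i = l' then x i else 0| ≤ ∑ i : Fin d, (2 : ℝ) := by
        refine (Finset.abs_sum_le_sum_abs _ _).trans (Finset.sum_le_sum fun i _ => ?_)
        split_ifs
        · exact hx i
        · simp
    _ < 2 * d + 1 := by simp; linarith

theorem sum_crd {m d : ℕ} (l : Fin d → Fin m) (x : Fin d → ℝ) (η : ℝ) (P : Fin m → ℝ) :
    ∑ l', (η * ∑ i, if l i = l' then x i else 0) * P l' = ∑ i, η * x i * P (l i) := by
  simp only [Finset.mul_sum, Finset.sum_mul]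
  rw [Finset.sum_comm]
  refine Finset.sum_congr rfl fun i _ => ?_
  rw [Finset.sum_eq_single (l i)]
  · simp
  · intro b _ hb; simp [hb.symm]
  · simp

theorem exists_certR {k d n : ℕ} (hk : 2 ≤ k) {p : MvPolynomial (Fin k × Fin n) ℚ}
    {τ : Fin k → Fin d → Fin k} (h : ∀ M : ℕ, ZEmb (ZQ p) τ (Fin M)) :
    ∃ (m : ℕ) (G : Fin n → MvPolynomial (Option (Fin m)) ℚ) (l : Fin d → Fin m) (c : Fin m → ℝ)
      (y : Fin n → ℝ) (η ε : ℝ), CertR (ZQ p) τ (Gam G l c y η ε) := by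
  classical
  obtain ⟨m, G, l, jj, I, c, y, hI, hI0, hG, hGl, hedge⟩ := exists_real_data hk h
  obtain ⟨ε, r, φ, hε, hr, hφc, hloc⟩ := exists_local_solutions G l jj c y hG hGl
  let η := r / (2 * d + 1)
  have hη : 0 < η := by positivity
  have hball : ∀ x : Fin d → ℝ, (∀ i, |x i| ≤ 2) → dist (crd c η l x) c < r :=
    fun x hx => dist_crd c hr l hx
  have hbox : ∀ x : Fin d → ℝ, Box x → ∀ i, |x i| ≤ 2 := fun x hx i =>
    abs_le.2 ⟨by linarith [(hx i).1], by linarith [(hx i).2]⟩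
  refine ⟨m, G, l, c, y, η, ε, ?_, ?_, ?_⟩
  · intro x hx
    have H := hloc _ (hball x (hbox x hx))
    exact ⟨fun j => φ j (crd c η l x), fun j => ⟨((H.2.1 j _ (H.1 j).1).1).2 rfl, (H.1 j).1⟩⟩
  · have key : ∀ x x' i, Box x → Box x' → x i < x' i → (∀ j, j ≠ i → x j = x' j) →
        ∀ Y, Gam G l c y η ε x Y → ¬ Gam G l c y η ε x' Y := by
      intro x x' i hx hx' hlt hj Y hY hY'
      let j := jj i
      let F : ℝ → Option (Fin m) → ℝ := fun t o => o.elim (Y j) (crd c η l (Function.update x i t))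
      have hd : ∀ t, HasDerivAt (fun t => aeval (F t) (G j))
          (η * aeval (F t) (pderiv (some (l i)) (G j))) t := by
        intro t
        have := hasDerivAt_aeval_pderiv (F := F) (s := t)
          (F' := fun o => o.elim 0 fun l' => η * ∑ i', if l i' = l' then
            (Pi.single i 1 : Fin d → ℝ) i' else 0) (fun o => by
          rcases o with _ | l'
          · exact hasDerivAt_const _ _
          · exact hasDerivAt_crd c η l l' fun i' => by
              by_cases hi : i' = i
              · subst hi; simpa using hasDerivAt_id' t
              · simpa [hi] using hasDerivAt_const t (x i')) (G j)
        rw [Fintype.sum_option] at this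
        simp only [Option.elim_none, Option.elim_some, zero_mul, zero_add] at this
        rw [sum_crd l (Pi.single i 1) η fun l' => aeval (F t) (pderiv (some l') (G j))] at this
        rw [Finset.sum_eq_single i (by intro b _ hb; simp [hb]) (by simp)] at this
        simpa using this
      obtain ⟨t, ht, h0⟩ := exists_hasDerivAt_eq_zero (f := fun t => aeval (F t) (G j)) hlt
        (fun t _ => (hd t).continuousAt.continuousWithinAt)
        (by
          have e1 : Function.update x i (x i) = x := Function.update_eq_self i x
          have e2 : Function.update x i (x' i) = x' := by
            funext i'
            by_cases hi : i' = i
            · subst hi; simp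
            · simp [hi, hj i' hi]
          simp only [F, e1, e2]
          rw [(hY j).1, (hY' j).1]) (fun t _ => hd t)
      have ht2 : ∀ i', |Function.update x i t i'| ≤ 2 := by
        refine hbox _ fun i' => ?_
        by_cases hi : i' = i
        · subst hi
          simp only [Function.update_self]
          exact ⟨(hx i').1.trans ht.1, ht.2.trans (hx' i').2⟩
        · simpa [hi] using hx i'
      exact mul_ne_zero hη.ne' ((hloc _ (hball _ ht2)).2.2 i (Y j) (hY j).2) h0
    intro x x' i hx hx' hne hj Y hY hY'
    rcases lt_or_gt_of_ne hne with hlt | hlt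
    · exact key x x' i hx hx' hlt hj Y hY hY'
    · exact key x' x i hx' hx hlt (fun j h => (hj j h).symm) Y hY' hY
  · intro x hx hxb Y hY
    have hrep : ∀ c, ∃ rep : ℝ → Fin k, ∀ i, x (rep (x i c)) c = x i c := by
      intro c
      refine ⟨fun v => if h : ∃ i', x i' c = v then h.choose else ⟨0, by omega⟩, fun i => ?_⟩
      have h : ∃ i', x i' c = x i c := ⟨i, rfl⟩
      simp only [h, dif_pos]
      exact h.choose_spec
    choose rep hrep using hrep
    let q : Fin k → Fin d → Fin k := fun i c => rep c (x i c)
    have hq : Comp τ q := ⟨fun i j hij => hx.1 (funext fun c => by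
      rw [← hrep c i, ← hrep c j]
      exact congrArg (fun t => x t c) (congrFun hij c)),
      fun i j c hij => congrArg (rep c) (hx.2 i j c hij)⟩
    obtain ⟨π, hπ⟩ := hedge q hq
    refine ⟨π, ?_⟩
    let z : (Fin d → Fin k) → Fin d → ℝ := fun a c => x (a c) c
    have hz : ∀ i, z (q i) = x i := fun i => funext fun c => hrep c i
    have hz2 : ∀ a, ∀ s ∈ Set.Ioo (-2 : ℝ) 2, ∀ i, |(s • z a) i| ≤ 2 := by
      intro a s hs i
      rw [Pi.smul_apply, smul_eq_mul, abs_mul]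
      have h1 : |s| ≤ 2 := abs_le.2 ⟨hs.1.le, hs.2.le⟩
      have h2 : |z a i| ≤ 1 := abs_le.2 ⟨by linarith [(hxb (a i) i).1], (hxb (a i) i).2.le⟩
      nlinarith [abs_nonneg s, abs_nonneg (z a i)]
    let F : ℝ → (Fin d → Fin k) × (Fin m ⊕ Fin n) → ℝ := fun s v =>
      Sum.elim (crd c η l (s • z v.1)) (fun j => φ j (crd c η l (s • z v.1))) v.2
    have hFl : ∀ a l' s, HasDerivAt (fun s => F s (a, Sum.inl l'))
        (η * ∑ i, if l i = l' then z a i else 0) s := fun a l' s =>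
      hasDerivAt_crd c η l l' fun i => by simpa using (hasDerivAt_id s).mul_const (z a i)
    have hFr : ∀ a j, ∀ s ∈ Set.Ioo (-2 : ℝ) 2, ∃ D, HasDerivAt (fun s => F s (a, Sum.inr j)) D s ∧
        aeval (F s) (pl G a j none) * D =
          - ∑ i, η * z a i * aeval (F s) (pl G a j (some (l i))) := by
      intro a j s hs
      have hD : DifferentiableAt ℝ (fun s => F s (a, Sum.inr j)) s :=
        DifferentiableAt.comp s ((hloc _ (hball _ (hz2 a s hs))).1 j).2
          (differentiableAt_pi.2 fun l' => (hFl a l' s).differentiableAt)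
      refine ⟨_, hD.hasDerivAt, ?_⟩
      have h1 := hasDerivAt_aeval_pderiv (F := fun s (o : Option (Fin m)) =>
        o.elim (F s (a, Sum.inr j)) fun l' => F s (a, Sum.inl l')) (s := s)
        (F' := fun o => o.elim (_root_.deriv (fun s => F s (a, Sum.inr j)) s) fun l' =>
          η * ∑ i, if l i = l' then z a i else 0) (fun o => by
          rcases o with _ | l'
          · exact hD.hasDerivAt
          · exact hFl a l' s) (G j)
      have h2 : (fun s => aeval (fun o : Option (Fin m) =>
          o.elim (F s (a, Sum.inr j)) fun l' => F s (a, Sum.inl l')) (G j)) =ᶠ[𝓝 s]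
          fun _ => (0 : ℝ) := by
        filter_upwards [Ioo_mem_nhds hs.1 hs.2] with s hs
        have H := hloc _ (hball _ (hz2 a s hs))
        exact ((H.2.1 j _ (H.1 j).1).1).2 rfl
      have h3 := h1.unique ((hasDerivAt_const s (0 : ℝ)).congr_of_eventuallyEq h2)
      rw [Fintype.sum_option] at h3
      simp only [Option.elim_none, Option.elim_some] at h3
      rw [sum_crd l (z a) η fun l' => aeval (fun o : Option (Fin m) =>
          o.elim (F s (a, Sum.inr j)) fun l' => F s (a, Sum.inl l')) (pderiv (some l') (G j))] at h3
      simp only [aeval_pl]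
      linarith
    choose! D hD1 hD2 using hFr
    have hsub : ∀ s ∈ Set.Icc (0 : ℝ) 1, s ∈ Set.Ioo (-2 : ℝ) 2 := fun s hs =>
      ⟨by linarith [hs.1], by linarith [hs.2]⟩
    have hfin := ideal_vanish I (F := F)
      (F' := fun s v => Sum.elim (fun l' => η * ∑ i, if l i = l' then z v.1 i else 0)
        (fun j => D v.1 j s) v.2)
      (∏ b : (Fin d → Fin k) × Fin n, pl G b.1 b.2 none)
      (E := Fin d × Fin k) (coef := fun e => η * x e.2 e.1) (Δ := fun e => dl G l e.1 e.2)
      (fun e q hq => hI e.1 e.2 q hq)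
      (fun s hs v => by
        rcases v with ⟨a, l' | j⟩
        · exact hFl a l' s
        · exact hD1 a j s (hsub s hs))
      (fun s hs => by
        rw [map_prod, Finset.prod_ne_zero_iff]
        intro b _
        rw [aeval_pl]
        have H := hloc _ (hball _ (hz2 b.1 s (hsub s hs)))
        exact (H.2.1 b.2 _ (H.1 b.2).1).2)
      (fun s hs v => by
        rw [Fintype.sum_prod_type]
        rcases v with ⟨a, l' | j⟩
        · simp only [dl, mkDerivation_X, Sum.elim_inl]
          rw [mul_left_comm, Finset.mul_sum, Finset.mul_sum]
          refine Finset.sum_congr rfl fun i _ => ?_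
          rw [Finset.sum_eq_single (a i)]
          · by_cases hl : l i = l'
            · simp [hl, z]; ring
            · simp [hl, Ne.symm hl]
          · intro b _ hb; simp [hb.symm]
          · simp
        · simp only [dl, mkDerivation_X, Sum.elim_inr]
          rw [map_prod, ← Finset.mul_prod_erase Finset.univ _ (Finset.mem_univ (a, j)), mul_right_comm,
            hD2 a j s (hsub s hs), neg_mul, Finset.sum_mul, ← Finset.sum_neg_distrib]
          refine Finset.sum_congr rfl fun i _ => ?_
          rw [Finset.sum_eq_single (a i)]
          · simp only [if_true, map_mul, map_neg, map_prod, z]; ring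
          · intro b _ hb; simp [hb.symm]
          · simp)
      (by
        have : F 0 = fun v => Sum.elim c y v.2 := by
          funext v
          have e : crd c η l ((0 : ℝ) • z v.1) = c := by funext l'; simp [crd]
          rcases v with ⟨a, l' | j⟩
          · simp only [F, Sum.elim_inl]; exact congrFun e l'
          · simp only [F, e, Sum.elim_inr, hφc]
        rw [this]; exact hI0) _ hπ
    rw [aeval_rename] at hfin
    have hYF : ∀ i j, F 1 (q i, Sum.inr j) = Y i j := by
      intro i j
      have H := hloc _ (hball _ (hbox _ (hxb i)))
      simp only [F, Sum.elim_inr, one_smul, hz]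
      exact ((H.2.1 j _ (hY i j).2).1).1 (hY i j).1
    unfold ZQ
    rw [← hfin]
    congr 2
    funext v
    simp [hYF]

end QE

namespace QE

theorem exists_avoiding {S R : Type*} [Finite S] [Fintype R] [DecidableEq S] {N : ℕ}
    (hN : Fintype.card R < N) (B : R → Set (S → Fin N)) (s : R → S)
    (h : ∀ r, ∀ t ∈ B r, ∀ t' ∈ B r, (∀ p, p ≠ s r → t p = t' p) → t = t') :
    ∃ t, ∀ r, t ∉ B r := by
  classical
  have := Fintype.ofFinite S
  by_contra! hc
  let T := Fintype.card (S → Fin N)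
  have hT : 0 < T := by
    have : Nonempty (Fin N) := ⟨⟨0, by omega⟩⟩
    exact Fintype.card_pos
  have h1 : ∀ r, Fintype.card (B r) * N ≤ T := by
    intro r
    have : Fintype.card (B r × Fin N) ≤ T := by
      refine Fintype.card_le_of_injective (fun x => Function.update x.1.1 (s r) x.2) ?_
      rintro ⟨⟨t, ht⟩, v⟩ ⟨⟨t', ht'⟩, v'⟩ heq
      have e : ∀ p, Function.update t (s r) v p = Function.update t' (s r) v' p := congrFun heq
      have e1 : t = t' := h r t ht t' ht' fun p hp => by simpa [hp] using e p
      have e2 : v = v' := by simpa using e (s r)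
      subst e1; subst e2; rfl
    simpa using this
  choose g hg using hc
  have h2 : T ≤ ∑ r, Fintype.card (B r) := by
    rw [← Fintype.card_sigma]
    exact Fintype.card_le_of_injective (fun t => (⟨g t, t, hg t⟩ : Σ r, B r)) fun t t' heq => by
      simp only [Sigma.mk.injEq] at heq
      obtain ⟨e, h⟩ := heq
      have : ∀ (r r' : R) (x : B r) (y : B r'), r = r' → x ≍ y → x.1 = y.1 := by
        rintro r r' x y rfl h; rw [eq_of_heq h]
      exact this _ _ _ _ e h
  have h3 : T * N ≤ Fintype.card R * T := by
    calc T * N ≤ (∑ r, Fintype.card (B r)) * N := Nat.mul_le_mul_right _ h2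
      _ = ∑ r, Fintype.card (B r) * N := Finset.sum_mul _ _ _
      _ ≤ ∑ _r : R, T := Finset.sum_le_sum fun r _ => h1 r
      _ = Fintype.card R * T := by simp
  nlinarith

theorem CertR.zEmb {k d n : ℕ} {Z : (Fin k → Fin n → ℝ) → Prop} {τ : Fin k → Fin d → Fin k}
    {Γ : (Fin d → ℝ) → (Fin n → ℝ) → Prop} (h : CertR Z τ Γ) (M : ℕ) : ZEmb Z τ (Fin M) := by
  classical
  choose! f hf using h.total
  let R := {x : (Fin d → Fin M) × (Fin d → Fin M) // x.1 ≠ x.2}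
  have hR : ∀ r : R, ∃ c, r.1.1 c ≠ r.1.2 c := fun r => Function.ne_iff.1 r.2
  choose s hs using hR
  let N := Fintype.card R + 1
  let w : Fin N → ℝ := fun i => ((i : ℕ) + 1 : ℝ) / (N + 1)
  have hw : ∀ i, 0 < w i ∧ w i < 1 := fun i => by
    refine ⟨by positivity, ?_⟩
    rw [div_lt_one (by positivity)]
    have : ((i : ℕ) : ℝ) < N := by exact_mod_cast i.2
    linarith
  have hwi : Function.Injective w := fun i j hij => by
    have h1 : ((i : ℕ) + 1 : ℝ) = (j : ℕ) + 1 := (div_left_inj' (by positivity)).1 hij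
    exact Fin.ext (by exact_mod_cast add_right_cancel h1)
  let pt : (Fin d × Fin M → Fin N) → (Fin d → Fin M) → Fin d → ℝ := fun t a c => w (t (c, a c))
  have hpt : ∀ t a, Box (pt t a) := fun t a c => hw _
  obtain ⟨t, ht⟩ := exists_avoiding (N := N) (Nat.lt_succ_self _)
    (fun r : R => {t | f (pt t r.1.1) = f (pt t r.1.2)}) (fun r => (s r, r.1.1 (s r))) (by
      intro r t ht t' ht' heq
      by_contra hne
      have e1 : t (s r, r.1.1 (s r)) ≠ t' (s r, r.1.1 (s r)) := fun h => hne (funext fun p => by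
        by_cases hp : p = (s r, r.1.1 (s r))
        · rw [hp, h]
        · exact heq p hp)
      have e2 : pt t r.1.2 = pt t' r.1.2 := funext fun c => congrArg w (heq _ fun hc => by
        simp only [Prod.mk.injEq] at hc
        obtain ⟨rfl, hc⟩ := hc
        exact hs r hc.symm)
      refine h.sep (pt t r.1.1) (pt t' r.1.1) (s r) (hpt _ _) (hpt _ _) (fun hc => e1 (hwi hc))
        (fun j hj => congrArg w (heq _ fun hc => hj (congrArg Prod.fst hc))) (f (pt t r.1.1))
        (hf _ (hpt _ _)) ?_
      have : f (pt t r.1.1) = f (pt t' r.1.1) := by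
        rw [show f (pt t r.1.1) = f (pt t r.1.2) from ht, e2]
        exact Eq.symm ht'
      rw [this]
      exact hf _ (hpt _ _))
  have hinj : Function.Injective fun a => f (pt t a) := by
    intro a b hab
    by_contra hne
    exact ht ⟨(a, b), hne⟩ hab
  have htc : ∀ c e e', w (t (c, e)) = w (t (c, e')) → e = e' := by
    intro c e e' heq
    have : pt t (fun _ => e) = pt t (Function.update (fun _ => e) c e') := by
      funext c'
      by_cases hc : c' = c
      · subst hc; simpa [pt] using heq
      · simp [pt, hc]
    have h2 := congrFun (hinj (congrArg f this)) c
    simpa using h2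
  refine ⟨fun a => f (pt t a), hinj, fun q hq => ?_⟩
  exact h.edge (fun i => pt t (q i))
    ⟨fun i j hij => hq.1 (funext fun c => htc c _ _ (congrFun hij c)),
      fun i j c hij => congrArg (fun e => w (t (c, e))) (hq.2 i j c hij)⟩
    (fun i => hpt _ _) _ fun i => hf _ (hpt _ _)

end QE

namespace QE
open MvPolynomial

/-- Extension of a finite tuple by zero. -/
def ext0 {N : ℕ} (f : Fin N → ℝ) (i : ℕ) : ℝ := if h : i < N then f ⟨i, h⟩ else 0

theorem ext0_val {N : ℕ} (f : Fin N → ℝ) (i : Fin N) : ext0 f i = f i := by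
  simp [ext0]

theorem ext0_lt {N : ℕ} (f : Fin N → ℝ) {i : ℕ} (h : i < N) : ext0 f i = f ⟨i, h⟩ := dif_pos h

/-- Functions given by integer polynomials. -/
def PolyFun (F : (ℕ → ℝ) → ℝ) : Prop := ∃ P : Po, ∀ v, ev v P = F v

namespace PolyFun

variable {F G : (ℕ → ℝ) → ℝ}

theorem var (i : ℕ) : PolyFun fun v => v i := ⟨[(1, 0, [i])], fun v => by simp [evM]⟩

theorem int (z : ℤ) : PolyFun fun _ => (z : ℝ) :=
  ⟨[(z.toNat, (-z).toNat, [])], fun v => by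
    simp only [ev_cons, ev_nil, evM, List.map_nil, List.prod_nil, mul_one, add_zero]
    have : (z.toNat : ℤ) - ((-z).toNat : ℤ) = z := by omega
    exact_mod_cast congrArg (fun t : ℤ => (t : ℝ)) this⟩

theorem add (hF : PolyFun F) (hG : PolyFun G) : PolyFun fun v => F v + G v := by
  obtain ⟨P, hP⟩ := hF
  obtain ⟨Q, hQ⟩ := hG
  exact ⟨P ++ Q, fun v => by rw [ev_append, hP, hQ]⟩

theorem mul (hF : PolyFun F) (hG : PolyFun G) : PolyFun fun v => F v * G v := by
  obtain ⟨P, hP⟩ := hF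
  obtain ⟨Q, hQ⟩ := hG
  exact ⟨Po.mul P Q, fun v => by rw [ev_mul, hP, hQ]⟩

theorem sub (hF : PolyFun F) (hG : PolyFun G) : PolyFun fun v => F v - G v := by
  have := hF.add ((int (-1)).mul hG)
  convert this using 2
  push_cast; ring

theorem sum {ι : Type*} (s : Finset ι) {F : ι → (ℕ → ℝ) → ℝ} (h : ∀ i, PolyFun (F i)) :
    PolyFun fun v => ∑ i ∈ s, F i v := by
  classical
  induction s using Finset.induction_on with
  | empty => simpa using int 0
  | insert a s ha ih => simpa only [Finset.sum_insert ha] using (h a).add ih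

theorem aeval {σ : Type*} {S : σ → (ℕ → ℝ) → ℝ} (h : ∀ w, PolyFun (S w)) (q : MvPolynomial σ ℚ) :
    ∃ N : ℤ, N ≠ 0 ∧ PolyFun fun v => N * MvPolynomial.aeval (fun w => S w v) q := by
  induction q using MvPolynomial.induction_on with
  | C r =>
    refine ⟨r.den, by simp, ?_⟩
    convert int r.num using 2
    simp only [algHom_C, eq_ratCast, Int.cast_natCast]
    rw [mul_comm]
    exact_mod_cast Rat.mul_den_eq_num r
  | add p q hp hq =>
    obtain ⟨N, hN, h1⟩ := hp
    obtain ⟨M, hM, h2⟩ := hq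
    refine ⟨N * M, mul_ne_zero hN hM, ?_⟩
    convert ((int M).mul h1).add ((int N).mul h2) using 2
    rw [map_add]; push_cast; ring
  | mul_X p w hp =>
    obtain ⟨N, hN, h1⟩ := hp
    refine ⟨N, hN, ?_⟩
    convert h1.mul (h w) using 2
    rw [map_mul, aeval_X]; ring

end PolyFun

theorem app_lt {N : ℕ} {y v : ℕ → ℝ} {i : ℕ} (h : i < N) : app N y v i = y i := if_pos h

theorem app_add {N : ℕ} {y v : ℕ → ℝ} {i : ℕ} : app N y v (N + i) = v i := by
  simp [app]

theorem exists_formula {m n d : ℕ} (G : Fin n → MvPolynomial (Option (Fin m)) ℚ)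
    (l : Fin d → Fin m) (c : Fin m → ℝ) (y : Fin n → ℝ) (η ε : ℝ) :
    ∃ (N : ℕ) (u : ℕ → ℝ) (γ : QF), ∀ x Y, Gam G l c y η ε x Y ↔
      holds (app n (ext0 Y) (app d (ext0 x) (app N u fun _ => 0))) γ := by
  classical
  let S : Option (Fin m) → Fin n → (ℕ → ℝ) → ℝ := fun o j v =>
    o.elim (v j) fun l' => v (n + (d + l')) +
      v (n + (d + (m + n))) * ∑ i : Fin d, if l i = l' then v (n + i) else 0
  have hS : ∀ o j, PolyFun (S o j) := by
    intro o j
    rcases o with _ | l'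
    · exact PolyFun.var _
    · refine (PolyFun.var _).add ((PolyFun.var _).mul (PolyFun.sum _ fun i => ?_))
      split_ifs
      · exact PolyFun.var _
      · simpa using PolyFun.int 0
  choose N hN P hP using fun j => PolyFun.aeval (fun o => hS o j) (G j)
  choose Q hQ using fun j : Fin n => ((PolyFun.var (n + (d + (m + n + 1)))).sub
    ((PolyFun.var j).sub (PolyFun.var (n + (d + (m + j))))))
  choose R hR using fun j : Fin n => ((PolyFun.var (n + (d + (m + n + 1)))).add
    ((PolyFun.var j).sub (PolyFun.var (n + (d + (m + j))))))
  let u : ℕ → ℝ := app m (ext0 c) (app n (ext0 y) fun i => if i = 0 then η else ε)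
  refine ⟨m + n + 2, u, [(List.finRange n).flatMap fun j => [(P j, 0), (Q j, 1), (R j, 1)]],
    fun x Y => ?_⟩
  let v := app n (ext0 Y) (app d (ext0 x) (app (m + n + 2) u fun _ => 0))
  have v1 : ∀ j : Fin n, v j = Y j := fun j =>
    (app_lt j.2).trans (ext0_val _ _)
  have v2 : ∀ i : Fin d, v (n + i) = x i := fun i =>
    app_add.trans ((app_lt i.2).trans (ext0_val _ _))
  have v3 : ∀ i, i < m + n + 2 → v (n + (d + i)) = u i := fun i hi =>
    app_add.trans (app_add.trans (app_lt hi))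
  have v4 : ∀ l' : Fin m, v (n + (d + l')) = c l' := fun l' => by
    rw [v3 _ (by omega)]; exact (app_lt l'.2).trans (ext0_val _ _)
  have v5 : ∀ j : Fin n, v (n + (d + (m + j))) = y j := fun j => by
    rw [v3 _ (by omega)]; exact app_add.trans ((app_lt j.2).trans (ext0_val _ _))
  have v6 : v (n + (d + (m + n))) = η := by
    rw [v3 _ (by omega)]; exact app_add.trans (app_add (i := 0))
  have v7 : v (n + (d + (m + n + 1))) = ε := by
    rw [v3 _ (by omega), add_assoc]; exact app_add.trans (app_add (i := 1))
  have hSv : ∀ j, (fun o => S o j v) = fun o : Option (Fin m) => o.elim (Y j) (crd c η l x) := by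
    intro j
    funext o
    rcases o with _ | l'
    · exact v1 j
    · simp only [S, Option.elim_some, crd, v4, v6, v2]
  have : holds v [(List.finRange n).flatMap fun j => [(P j, 0), (Q j, 1), (R j, 1)]] ↔
      ∀ j, sgn (ev v (P j)) = 0 ∧ sgn (ev v (Q j)) = 1 ∧ sgn (ev v (R j)) = 1 := by
    simp only [holds, holdsC, exists_eq_left, List.mem_flatMap,
      List.mem_finRange, true_and, List.mem_cons, List.not_mem_nil, or_false]
    constructor
    · exact fun h j => ⟨h _ ⟨j, Or.inl rfl⟩, h _ ⟨j, Or.inr (Or.inl rfl)⟩,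
        h _ ⟨j, Or.inr (Or.inr rfl)⟩⟩
    · rintro h l ⟨j, rfl | rfl | rfl⟩
      · exact (h j).1
      · exact (h j).2.1
      · exact (h j).2.2
  rw [this]
  unfold Gam
  refine forall_congr' fun j => ?_
  have hN' : (N j : ℝ) ≠ 0 := by exact_mod_cast hN j
  simp only [hP, hQ, hR, hSv, v1, v5, v7, sgn_eq_zero, sgn_eq_one, mul_eq_zero, hN', false_or,
    abs_lt]
  refine and_congr_right fun _ => ⟨fun h => ⟨by linarith, by linarith⟩,
    fun h => ⟨by linarith, by linarith⟩⟩

/-- The formula relation on tuples. -/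
def FRel {n d : ℕ} (γ : QF) (u : ℕ → ℝ) (x : Fin d → ℝ) (Y : Fin n → ℝ) : Prop :=
  holds (app n (ext0 Y) (app d (ext0 x) u)) γ

theorem forall_zEmb_iff {k d n : ℕ} (hk : 2 ≤ k) {p : MvPolynomial (Fin k × Fin n) ℚ}
    {τ : Fin k → Fin d → Fin k} : (∀ M : ℕ, ZEmb (ZQ p) τ (Fin M)) ↔
      ∃ (N : ℕ) (γ : QF) (u : ℕ → ℝ), CertR (ZQ p) τ (FRel γ (app N u fun _ => 0)) := by
  constructor
  · intro h
    obtain ⟨m, G, l, c, y, η, ε, hC⟩ := exists_certR hk h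
    obtain ⟨N, u, γ, hγ⟩ := exists_formula G l c y η ε
    refine ⟨N, γ, u, ?_⟩
    have : Gam G l c y η ε = FRel γ (app N u fun _ => 0) :=
      funext fun x => funext fun Y => propext (hγ x Y)
    rwa [← this]
  · rintro ⟨N, γ, u, h⟩
    exact h.zEmb

end QE

namespace QE
open PR

/-- Digits in base `b`. -/
def dig (b t i : ℕ) : ℕ := t / b ^ i % b

@[fun_prop] theorem pr_dig {α : Type*} [Primcodable α] {b t i : α → ℕ} (hb : Primrec b)
    (ht : Primrec t) (hi : Primrec i) : Primrec fun a => dig (b a) (t a) (i a) := by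
  unfold dig; fun_prop

theorem dig_lt {b : ℕ} (hb : 0 < b) (t i : ℕ) : dig b t i < b := Nat.mod_lt _ hb

theorem exists_dig {b N : ℕ} (f : Fin N → Fin b) :
    ∃ t < b ^ N, ∀ i : Fin N, dig b t i = f i := by
  refine ⟨finFunctionFinEquiv f, (finFunctionFinEquiv f).2, fun i => ?_⟩
  have := congrFun (finFunctionFinEquiv.symm_apply_apply f) i
  rw [← this]
  rfl

theorem flat_lt {k d : ℕ} (i : Fin k) (c : Fin d) : (i : ℕ) * d + c < k * d := by
  calc (i : ℕ) * d + c < i * d + d := by omega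
    _ = (i + 1) * d := by ring
    _ ≤ k * d := Nat.mul_le_mul_right _ i.2

theorem exists_flat {X : Type*} {k d : ℕ} (f : Fin k → Fin d → X) :
    ∃ g : Fin (k * d) → X, ∀ (i : Fin k) (c : Fin d), g ⟨i * d + c, flat_lt i c⟩ = f i c := by
  refine ⟨fun e => f (finProdFinEquiv.symm e).1 (finProdFinEquiv.symm e).2, fun i c => ?_⟩
  have : (⟨i * d + c, flat_lt i c⟩ : Fin (k * d)) = finProdFinEquiv (i, c) :=
    Fin.ext (by simp [mul_comm, add_comm])
  rw [this]
  simp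

theorem exists_dig₂ {b k d : ℕ} (f : Fin k → Fin d → Fin b) :
    ∃ t < b ^ (k * d), ∀ (i : Fin k) (c : Fin d), dig b t (i * d + c) = f i c := by
  obtain ⟨g, hg⟩ := exists_flat f
  obtain ⟨t, ht, h⟩ := exists_dig g
  exact ⟨t, ht, fun i c => by rw [← hg]; exact h ⟨i * d + c, flat_lt i c⟩⟩

theorem forall_fin {N : ℕ} {P : (Fin N → ℝ) → Prop} :
    (∀ x, P x) ↔ ∀ x : ℕ → ℝ, P fun i => x i :=
  ⟨fun h _ => h _, fun h x => by
    have := h (ext0 x)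
    simp only [ext0_val] at this
    exact this⟩

theorem exists_fin {N : ℕ} {P : (Fin N → ℝ) → Prop} :
    (∃ x, P x) ↔ ∃ x : ℕ → ℝ, P fun i => x i := by
  have := not_congr (forall_fin (P := fun x => ¬ P x))
  simpa using this

theorem forall_fin₂ {k d : ℕ} {P : (Fin k → Fin d → ℝ) → Prop} :
    (∀ x, P x) ↔ ∀ x : ℕ → ℝ, P fun i c => x (i * d + c) := by
  refine ⟨fun h _ => h _, fun h x => ?_⟩
  obtain ⟨g, hg⟩ := exists_flat x
  have := h (ext0 g)
  have e : (fun (i : Fin k) (c : Fin d) => ext0 g (i * d + c)) = x := by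
    funext i c
    rw [ext0_lt g (flat_lt i c), hg]
  rwa [e] at this

theorem exists_fin₂ {k d : ℕ} {P : (Fin k → Fin d → ℝ) → Prop} :
    (∃ x, P x) ↔ ∃ x : ℕ → ℝ, P fun i c => x (i * d + c) := by
  have := not_congr (forall_fin₂ (P := fun x => ¬ P x))
  simpa using this

theorem forall_flat {k d : ℕ} {P : ℕ → Prop} :
    (∀ j < k * d, P j) ↔ ∀ (i : Fin k) (c : Fin d), P (i * d + c) := by
  refine ⟨fun h i c => h _ (flat_lt i c), fun h j hj => ?_⟩
  have hd : 0 < d := Nat.pos_of_ne_zero fun h => by simp [h] at hj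
  have := h ⟨j / d, Nat.div_lt_of_lt_mul (by rwa [mul_comm] at hj)⟩ ⟨j % d, Nat.mod_lt _ hd⟩
  simpa [Nat.div_add_mod'] using this

/-- The code `s` is that of a permutation. -/
def IsPm (k s : ℕ) : Prop := ∀ i < k, ∀ j < k, dig k s i = dig k s j → i = j

theorem exists_perm_iff {k : ℕ} {P : (Fin k → ℕ) → Prop} :
    (∃ π : Equiv.Perm (Fin k), P fun i => π i) ↔
      ∃ s < k ^ k, IsPm k s ∧ P fun i => dig k s i := by
  constructor
  · rintro ⟨π, h⟩
    obtain ⟨s, hs, h'⟩ := exists_dig (fun i => π i)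
    refine ⟨s, hs, fun i hi j hj hij => ?_, ?_⟩
    · have h1 := h' ⟨i, hi⟩
      have h2 := h' ⟨j, hj⟩
      simp only at h1 h2
      rw [hij, h2] at h1
      simpa using (π.injective (Fin.ext h1)).symm
    · simpa only [h'] using h
  · rintro ⟨s, -, hs, h⟩
    have hi : Function.Injective fun i : Fin k =>
        (⟨dig k s i, dig_lt (Nat.zero_lt_of_lt i.2) _ _⟩ : Fin k) := fun i j hij =>
      Fin.ext (hs i i.2 j j.2 (congrArg Fin.val hij))
    exact ⟨Equiv.ofBijective _ (Finite.injective_iff_bijective.1 hi), h⟩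

namespace Def

variable {α : Type*} [Primcodable α]

theorem prop {A : α → (ℕ → ℝ) → Prop} {b : α → Bool} (hb : Primrec b)
    (h : ∀ a v, b a = true ↔ A a v) : Def A := (dec hb).congr h

theorem posv {f : α → ℕ} (hf : Primrec f) : Def fun a v => 0 < v (f a) :=
  (pos (p := fun a => [(1, 0, [f a])]) (by fun_prop)).congr fun a v => by simp [evM]

theorem ltOne {f : α → ℕ} (hf : Primrec f) : Def fun a v => v (f a) < 1 :=
  (pos (p := fun a => [(1, 0, []), (0, 1, [f a])]) (by fun_prop)).congr fun a v => by simp [evM]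

theorem eqv {f g : α → ℕ} (hf : Primrec f) (hg : Primrec g) : Def fun a v => v (f a) = v (g a) :=
  (eq0 (p := fun a => [(1, 0, [f a]), (0, 1, [g a])]) (by fun_prop)).congr fun a v => by
    simp [evM, ← sub_eq_add_neg, sub_eq_zero]

theorem eqn {f g : α → ℕ} (hf : Primrec f) (hg : Primrec g) : Def fun a _ => f a = g a :=
  prop (b := fun a => f a == g a) (by fun_prop) fun a v => by simp

theorem form {f : α → QF} (hf : Primrec f) : Def fun a v => holds v (f a) :=
  ⟨f, hf, fun _ _ => Iff.rfl⟩

theorem isPm {k s : α → ℕ} (hk : Primrec k) (hs : Primrec s) : Def fun a _ => IsPm (k a) (s a) := by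
  unfold IsPm
  refine ball (A := fun a i _ => ∀ j < k a, dig (k a) (s a) i = dig (k a) (s a) j → i = j) hk
    (ball (A := fun (p : α × ℕ) j _ => dig (k p.1) (s p.1) p.2 = dig (k p.1) (s p.1) j → p.2 = j)
      (by fun_prop) (imp (eqn (by fun_prop) (by fun_prop)) (eqn (by fun_prop) (by fun_prop))))

end Def

end QE

namespace QE
open PR

/-- The code `e` of a tuple of vertices is compatible with the template coded by `t`. -/
def CompD (k d t M e : ℕ) : Prop :=
  (∀ i < k, ∀ j < k, dig (M ^ d) e i = dig (M ^ d) e j → i = j) ∧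
    ∀ i < k, ∀ j < k, ∀ c < d, dig k t (i * d + c) = dig k t (j * d + c) →
      dig M (dig (M ^ d) e i) c = dig M (dig (M ^ d) e j) c

/-- Some permutation of the points with indices given by `w` satisfies the polynomial. -/
def PermD (k n : ℕ) (f : Po) (w : ℕ → ℕ) (v : ℕ → ℝ) : Prop :=
  ∃ s < k ^ k, IsPm k s ∧ ev (fun x => v (w (dig k s (x / n)) * n + x % n)) f = 0

/-- Arithmetical form of embeddability. -/
def EmbD (k n d t M : ℕ) (f : Po) (v : ℕ → ℝ) : Prop :=
  ∃ y, (∀ a < M ^ d, ∀ b < M ^ d, (∀ j < n, app (M ^ d * n) y v (a * n + j) =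
      app (M ^ d * n) y v (b * n + j)) → a = b) ∧
    ∀ e < (M ^ d) ^ k, CompD k d t M e →
      PermD k n f (fun i => dig (M ^ d) e i) (app (M ^ d * n) y v)

theorem permD_iff {k n : ℕ} {Z : (Fin k → Fin n → ℝ) → Prop} {f : Po}
    (hp : ∀ v, ev v f = 0 ↔ Z fun i j => v (i * n + j)) (w : ℕ → ℕ) (v : ℕ → ℝ) :
    PermD k n f w v ↔ ∃ π : Equiv.Perm (Fin k), Z fun i j => v (w (π i) * n + j) := by
  rw [exists_perm_iff (P := fun σ => Z fun i j => v (w (σ i) * n + j))]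
  unfold PermD
  refine exists_congr fun s => and_congr_right fun _ => and_congr_right fun _ => ?_
  rw [hp]
  have : ∀ (i : Fin k) (j : Fin n), (i * n + j) / n = (i : ℕ) ∧ (i * n + j) % n = (j : ℕ) :=
    fun i j => by
      have hn : 0 < n := Nat.zero_lt_of_lt j.2
      constructor
      · rw [mul_comm, Nat.mul_add_div hn, Nat.div_eq_of_lt j.2, add_zero]
      · rw [mul_comm, Nat.mul_add_mod, Nat.mod_eq_of_lt j.2]
  simp only [this]

theorem app_fin {N : ℕ} {y v : ℕ → ℝ} (i : Fin N) : app N y v i = y i := app_lt i.2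

theorem embD_iff {k n d t M : ℕ} (hk : 0 < k) {Z : (Fin k → Fin n → ℝ) → Prop} {f : Po}
    (hp : ∀ v, ev v f = 0 ↔ Z fun i j => v (i * n + j)) {τ : Fin k → Fin d → Fin k}
    (hτ : ∀ (i : Fin k) (c : Fin d), dig k t (i * d + c) = τ i c) (v : ℕ → ℝ) :
    EmbD k n d t M f v ↔ ZEmb Z τ (Fin M) := by
  have hP : ∀ e < (M ^ d) ^ k, 0 < M ^ d := fun e he => Nat.pos_of_ne_zero fun h => by
    rw [h, zero_pow hk.ne'] at he; omega
  have hfl : ∀ y (a : Fin (M ^ d)) (j : Fin n), app (M ^ d * n) y v (a * n + j) = y (a * n + j) :=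
    fun y a j => app_lt (flat_lt a j)
  let E : (Fin d → Fin M) ≃ Fin (M ^ d) := finFunctionFinEquiv
  have hE : ∀ a c, ((E.symm a c : Fin M) : ℕ) = dig M a c := fun a c => rfl
  have h1 : ZEmb Z τ (Fin M) ↔ ∃ h : Fin (M ^ d) → Fin n → ℝ, Function.Injective h ∧
      ∀ q : Fin k → Fin d → Fin M, Comp τ q → ∃ π : Equiv.Perm (Fin k),
        Z fun i => h (E (q (π i))) := by
    constructor
    · rintro ⟨g, hg, h⟩
      exact ⟨fun a => g (E.symm a), hg.comp E.symm.injective, fun q hq => by simpa using h q hq⟩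
    · rintro ⟨g, hg, h⟩
      exact ⟨fun a => g (E a), hg.comp E.injective, h⟩
  rw [h1, exists_fin₂]
  unfold EmbD
  refine exists_congr fun y => and_congr ?_ ?_
  · constructor
    · intro h a b hab
      refine Fin.ext (h a a.2 b b.2 fun j hj => ?_)
      rw [hfl y a ⟨j, hj⟩, hfl y b ⟨j, hj⟩]
      exact congrFun hab ⟨j, hj⟩
    · intro h a ha b hb hab
      refine congrArg Fin.val (@h ⟨a, ha⟩ ⟨b, hb⟩ (funext fun j => ?_))
      have := hab j j.2
      rwa [hfl y ⟨a, ha⟩ j, hfl y ⟨b, hb⟩ j] at this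
  · have h2 : ∀ e < (M ^ d) ^ k, ∀ q : Fin k → Fin d → Fin M,
        (∀ i : Fin k, dig (M ^ d) e i = E (q i)) → ((CompD k d t M e ↔ Comp τ q) ∧
        (PermD k n f (fun i => dig (M ^ d) e i) (app (M ^ d * n) y v) ↔
          ∃ π : Equiv.Perm (Fin k), Z fun i j => y (E (q (π i)) * n + j))) := by
      intro e he q hq
      have hqd : ∀ (i : Fin k) (c : Fin d), dig M (dig (M ^ d) e i) c = q i c := by
        intro i c
        rw [hq, ← hE, Equiv.symm_apply_apply]
      constructor
      · unfold CompD Comp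
        refine and_congr ?_ ?_
        · constructor
          · intro h i j hij
            exact Fin.ext (h i i.2 j j.2 (by rw [hq, hq, hij]))
          · intro h i hi j hj hij
            rw [hq ⟨i, hi⟩, hq ⟨j, hj⟩] at hij
            exact congrArg Fin.val (h (E.injective (Fin.ext hij)))
        · constructor
          · intro h i j c hij
            have := h i i.2 j j.2 c c.2 (by rw [hτ, hτ, hij])
            rw [hqd, hqd] at this
            exact Fin.ext this
          · intro h i hi j hj c hc hij
            rw [hτ ⟨i, hi⟩ ⟨c, hc⟩, hτ ⟨j, hj⟩ ⟨c, hc⟩] at hij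
            rw [hqd ⟨i, hi⟩ ⟨c, hc⟩, hqd ⟨j, hj⟩ ⟨c, hc⟩, h _ _ _ (Fin.ext hij)]
      · rw [permD_iff hp]
        simp only [hq, hfl]
    constructor
    · intro h q hq
      obtain ⟨e, he, h3⟩ := exists_dig (fun i => E (q i))
      exact ((h2 e he q h3).2).1 (h e he (((h2 e he q h3).1).2 hq))
    · intro h e he hC
      have h3 : ∀ i : Fin k, dig (M ^ d) e i = E (E.symm ⟨_, dig_lt (hP e he) e i⟩) := by simp
      exact ((h2 e he _ h3).2).2 (h _ (((h2 e he _ h3).1).1 hC))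

/-- The box condition. -/
def BoxD (N : ℕ) (v : ℕ → ℝ) : Prop := ∀ c < N, 0 < v c ∧ v c < 1

/-- Totality of the relation. -/
def CertA (n d : ℕ) (γ : QF) (u : ℕ → ℝ) : Prop :=
  ∀ x, BoxD d (app d x u) → ∃ Y, holds (app n Y (app d x u)) γ

/-- Separation along coordinate lines. -/
def CertB (n d : ℕ) (γ : QF) (u : ℕ → ℝ) : Prop :=
  ∀ x, BoxD d (app d x u) → ∀ z, BoxD 1 (app 1 z (app d x u)) → ∀ i < d,
    app 1 z (app d x u) (1 + i) ≠ app 1 z (app d x u) 0 → ∀ Y,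
      holds (fun j => app n Y (app 1 z (app d x u)) (if j < n then j else j + 1)) γ →
      ¬ holds (fun j => app n Y (app 1 z (app d x u))
        (if j < n then j else if j = n + i then n else j + 1)) γ

/-- Compatibility of a tuple of real points with a template. -/
def CompR (k d t : ℕ) (v : ℕ → ℝ) : Prop :=
  (∀ i < k, ∀ j < k, (∀ c < d, v (i * d + c) = v (j * d + c)) → i = j) ∧
    ∀ i < k, ∀ j < k, ∀ c < d, dig k t (i * d + c) = dig k t (j * d + c) →
      v (i * d + c) = v (j * d + c)

/-- The edge condition. -/
def CertC (k n d t : ℕ) (f : Po) (γ : QF) (u : ℕ → ℝ) : Prop :=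
  ∀ x, CompR k d t (app (k * d) x u) → BoxD (k * d) (app (k * d) x u) → ∀ Y,
    (∀ i < k, holds (fun j => app (k * n) Y (app (k * d) x u) (if j < n then i * n + j else
      if j < n + d then k * n + (i * d + (j - n)) else k * n + (k * d + (j - (n + d))))) γ) →
    PermD k n f (fun i => i) (app (k * n) Y (app (k * d) x u))

/-- Arithmetical form of the certificate. -/
def CertD (k n d t : ℕ) (f : Po) (γ : QF) (u : ℕ → ℝ) : Prop :=
  CertA n d γ u ∧ CertB n d γ u ∧ CertC k n d t f γ u

theorem app_ext0 {N : ℕ} {y v : ℕ → ℝ} : app N (ext0 fun i : Fin N => y i) v = app N y v := by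
  funext i
  unfold app
  split_ifs with h
  · rw [ext0_lt _ h]
  · rfl

theorem fRel_iff {n d : ℕ} {γ : QF} {u x Y : ℕ → ℝ} :
    FRel γ u (fun c : Fin d => x c) (fun j : Fin n => Y j) ↔ holds (app n Y (app d x u)) γ := by
  rw [FRel, app_ext0, app_ext0]

theorem boxD_iff {d : ℕ} {x u : ℕ → ℝ} : BoxD d (app d x u) ↔ Box fun c : Fin d => x c :=
  ⟨fun h c => by simpa [app_fin] using h c c.2, fun h c hc => by
    rw [app_lt hc]; exact h ⟨c, hc⟩⟩

theorem certA_iff {n d : ℕ} {γ : QF} {u : ℕ → ℝ} :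
    CertA n d γ u ↔ ∀ x : Fin d → ℝ, Box x → ∃ Y : Fin n → ℝ, FRel γ u x Y := by
  rw [forall_fin]
  unfold CertA
  refine forall_congr' fun x => ?_
  rw [boxD_iff, exists_fin]
  simp only [fRel_iff]

theorem certB_iff {n d : ℕ} {γ : QF} {u : ℕ → ℝ} :
    CertB n d γ u ↔ ∀ (x : Fin d → ℝ), Box x → ∀ z : Fin 1 → ℝ, Box z → ∀ i, x i ≠ z 0 →
      ∀ Y : Fin n → ℝ, FRel γ u x Y → ¬ FRel γ u (Function.update x i (z 0)) Y := by
  rw [forall_fin]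
  unfold CertB
  refine forall_congr' fun x => ?_
  rw [boxD_iff, forall_fin]
  refine forall_congr' fun _ => forall_congr' fun z => ?_
  rw [boxD_iff]
  refine forall_congr' fun _ => ?_
  have hr : ∀ (P : ℕ → Prop), (∀ i < d, P i) ↔ ∀ i : Fin d, P i := fun P =>
    ⟨fun h i => h i i.2, fun h i hi => h ⟨i, hi⟩⟩
  rw [hr]
  refine forall_congr' fun i => ?_
  have e1 : app 1 z (app d x u) (1 + i) = x i := by rw [app_add, app_fin]
  have e2 : app 1 z (app d x u) 0 = z 0 := app_lt one_pos
  rw [e1, e2, forall_fin]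
  refine forall_congr' fun _ => forall_congr' fun Y => ?_
  have e3 : (fun j => app n Y (app 1 z (app d x u)) (if j < n then j else j + 1)) =
      app n Y (app d x u) := by
    funext j
    by_cases hj : j < n
    · simp only [hj, if_true, app_lt]
    · obtain ⟨r, rfl⟩ := Nat.exists_eq_add_of_le (not_lt.1 hj)
      simp only [hj, if_false, add_assoc, app_add]
      rw [add_comm r 1, app_add]
  have e4 : (fun j => app n Y (app 1 z (app d x u))
        (if j < n then j else if j = n + i then n else j + 1)) =
      app n Y (app d (Function.update x i (z 0)) u) := by
    funext j
    by_cases hj : j < n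
    · simp only [hj, if_true, app_lt]
    · obtain ⟨r, rfl⟩ := Nat.exists_eq_add_of_le (not_lt.1 hj)
      simp only [hj, if_false, app_add]
      by_cases hri : r = i
      · subst hri
        simp only [if_true, app_fin, Function.update_self]
        exact (app_add (i := 0)).trans e2
      · simp only [add_right_inj, hri, if_false, add_assoc, app_add]
        rw [add_comm r 1, app_add]
        simp only [app, Function.update_apply, hri, if_false]
  have e5 : Function.update (fun c : Fin d => x c) i (z 0) =
      fun c : Fin d => Function.update x (i : ℕ) (z 0) (c : ℕ) := by
    funext c
    simp only [Function.update_apply, Fin.ext_iff]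
  rw [e3, e4]
  simp only [Fin.val_zero]
  rw [e5, fRel_iff, fRel_iff]

theorem compR_iff {k d t : ℕ} {τ : Fin k → Fin d → Fin k}
    (hτ : ∀ (i : Fin k) (c : Fin d), dig k t (i * d + c) = τ i c) {x u : ℕ → ℝ} :
    CompR k d t (app (k * d) x u) ↔ Comp τ fun i c => x (i * d + c) := by
  have hx : ∀ (i : Fin k) (c : Fin d), app (k * d) x u (i * d + c) = x (i * d + c) :=
    fun i c => app_lt (flat_lt i c)
  unfold CompR Comp
  refine and_congr ?_ ?_
  · constructor
    · intro h i j hij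
      refine Fin.ext (h i i.2 j j.2 fun c hc => ?_)
      rw [hx i ⟨c, hc⟩, hx j ⟨c, hc⟩]
      exact congrFun hij ⟨c, hc⟩
    · intro h i hi j hj hij
      refine congrArg Fin.val (@h ⟨i, hi⟩ ⟨j, hj⟩ (funext fun c => ?_))
      have := hij c c.2
      rwa [hx ⟨i, hi⟩, hx ⟨j, hj⟩] at this
  · constructor
    · intro h i j c hij
      have := h i i.2 j j.2 c c.2 (by rw [hτ, hτ, hij])
      rwa [hx, hx] at this
    · intro h i hi j hj c hc hij
      rw [hτ ⟨i, hi⟩ ⟨c, hc⟩, hτ ⟨j, hj⟩ ⟨c, hc⟩] at hij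
      rw [hx ⟨i, hi⟩ ⟨c, hc⟩, hx ⟨j, hj⟩ ⟨c, hc⟩]
      exact h _ _ _ (Fin.ext hij)

theorem certC_iff {k n d t : ℕ} {Z : (Fin k → Fin n → ℝ) → Prop} {f : Po}
    (hp : ∀ v, ev v f = 0 ↔ Z fun i j => v (i * n + j)) {τ : Fin k → Fin d → Fin k}
    (hτ : ∀ (i : Fin k) (c : Fin d), dig k t (i * d + c) = τ i c) {γ : QF} {u : ℕ → ℝ} :
    CertC k n d t f γ u ↔ ∀ x : Fin k → Fin d → ℝ, Comp τ x → (∀ i, Box (x i)) →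
      ∀ Y : Fin k → Fin n → ℝ, (∀ i, FRel γ u (x i) (Y i)) →
        ∃ π : Equiv.Perm (Fin k), Z fun i => Y (π i) := by
  rw [forall_fin₂]
  unfold CertC
  refine forall_congr' fun x => ?_
  rw [compR_iff hτ]
  refine forall_congr' fun _ => ?_
  have hb : BoxD (k * d) (app (k * d) x u) ↔ ∀ i : Fin k, Box fun c : Fin d => x (i * d + c) := by
    unfold BoxD Box
    rw [forall_flat]
    refine forall_congr' fun i => forall_congr' fun c => ?_
    rw [app_lt (flat_lt i c)]
  rw [hb, forall_fin₂]
  refine forall_congr' fun _ => forall_congr' fun Y => ?_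
  have hP : PermD k n f (fun i => i) (app (k * n) Y (app (k * d) x u)) ↔
      ∃ π : Equiv.Perm (Fin k), Z fun i j => Y (π i * n + j) := by
    rw [permD_iff hp]
    have : ∀ (i : Fin k) (j : Fin n), app (k * n) Y (app (k * d) x u) (i * n + j) =
      Y (i * n + j) := fun i j => app_lt (flat_lt i j)
    simp only [this]
  rw [hP]
  refine imp_congr_left ?_
  have hr : ∀ (P : ℕ → Prop), (∀ i < k, P i) ↔ ∀ i : Fin k, P i := fun P =>
    ⟨fun h i => h i i.2, fun h i hi => h ⟨i, hi⟩⟩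
  rw [hr]
  refine forall_congr' fun i => ?_
  have := fRel_iff (γ := γ) (n := n) (d := d) (u := u) (x := fun c => x (i * d + c))
    (Y := fun j => Y (i * n + j))
  rw [this]
  refine iff_of_eq (congrArg (fun v => holds v γ) ?_)
  funext j
  by_cases hj : j < n
  · simp only [hj, if_true, app_lt]
    exact app_lt (flat_lt i ⟨j, hj⟩)
  · obtain ⟨r, rfl⟩ := Nat.exists_eq_add_of_le (not_lt.1 hj)
    simp only [hj, if_false, app_add]
    by_cases hr : r < d
    · simp only [add_lt_add_iff_left, hr, if_true, app_add, app_lt, Nat.add_sub_cancel_left]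
      exact app_lt (flat_lt i ⟨r, hr⟩)
    · obtain ⟨r, rfl⟩ := Nat.exists_eq_add_of_le (not_lt.1 hr)
      have h1 : ¬ n + (d + r) < n + d := by omega
      have h2 : n + (d + r) - (n + d) = r := by omega
      simp only [h1, h2, if_false, app_add]

theorem certD_iff {k n d t : ℕ} {Z : (Fin k → Fin n → ℝ) → Prop} {f : Po}
    (hp : ∀ v, ev v f = 0 ↔ Z fun i j => v (i * n + j)) {τ : Fin k → Fin d → Fin k}
    (hτ : ∀ (i : Fin k) (c : Fin d), dig k t (i * d + c) = τ i c) {γ : QF} {u : ℕ → ℝ} :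
    CertD k n d t f γ u ↔ CertR Z τ (FRel γ u) := by
  rw [CertD, certA_iff, certB_iff, certC_iff hp hτ]
  constructor
  · rintro ⟨ha, hb, hc⟩
    refine ⟨ha, fun x x' i hx hx' hne hj Y hY => ?_, hc⟩
    have := hb x hx (fun _ => x' i) (fun _ => hx' i) i hne Y hY
    have e : Function.update x i (x' i) = x' := by
      funext j
      by_cases h : j = i
      · subst h; simp
      · simp [h, hj j h]
    rwa [e] at this
  · rintro ⟨ha, hb, hc⟩
    refine ⟨ha, fun x hx z hz i hne Y hY => ?_, hc⟩
    refine hb x _ i hx (fun c => ?_) (by simpa using hne) (fun j hj => by simp [hj]) Y hY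
    by_cases h : c = i
    · subst h; simpa using hz 0
    · simpa [h] using hx c

end QE

namespace QE
open PR

/-- The basic encoding of the rationals, from which the library obtains a bijection with `ℕ`. -/
def encQ (q : ℚ) : ℕ := @Encodable.encode ℚ Rat.instEncodable q

theorem encQ_eq (q : ℚ) : encQ q = Nat.pair (Equiv.intEquivNat q.num) q.den := rfl

theorem encode_rat (q : ℚ) : @Encodable.encode ℚ Primcodable.toEncodable q =
    (List.range (encQ q)).countP
      (fun m => @decide (m ∈ Set.range encQ) (Encodable.decidableRangeEncode ℚ m)) := rfl

theorem intEquivNat_natCast (a : ℕ) : Equiv.intEquivNat a = 2 * a := rfl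

theorem intEquivNat_negSucc (a : ℕ) : Equiv.intEquivNat (Int.negSucc a) = 2 * a + 1 := rfl

/-- The positive part of an integer, from its code. -/
def posZ (z : ℕ) : ℕ := if z % 2 = 0 then z / 2 else 0

/-- The negative part of an integer, from its code. -/
def negZ (z : ℕ) : ℕ := if z % 2 = 0 then 0 else z / 2 + 1

theorem posZ_sub_negZ (a : ℤ) :
    (posZ (Equiv.intEquivNat a) : ℤ) - negZ (Equiv.intEquivNat a) = a := by
  rcases a with a | a
  · rw [Int.ofNat_eq_natCast, intEquivNat_natCast]
    have : 2 * a % 2 = 0 := by omega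
    simp [posZ, negZ]
  · rw [intEquivNat_negSucc]
    have h1 : (2 * a + 1) % 2 = 1 := by omega
    have h2 : (2 * a + 1) / 2 = a := by omega
    simp [posZ, negZ, h2, Int.negSucc_eq]

/-- The test for being a value of `encQ`. -/
def isQ (m : ℕ) : Bool :=
  !(m.unpair.2 == 0) && (List.range (m.unpair.2 + 1)).all fun c =>
    c - 1 == 0 || !((m.unpair.1 + 1) / 2 % c == 0) || !(m.unpair.2 % c == 0)

@[fun_prop] theorem pr_unpair {α : Type*} [Primcodable α] {f : α → ℕ} (hf : Primrec f) :
    Primrec fun a => (f a).unpair := Primrec.unpair.comp hf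

@[fun_prop] theorem pr_isQ {α : Type*} [Primcodable α] {f : α → ℕ} (hf : Primrec f) :
    Primrec fun a => isQ (f a) := by
  unfold isQ; fun_prop

theorem natAbs_eq (a : ℤ) : (Equiv.intEquivNat a + 1) / 2 = a.natAbs := by
  rcases a with a | a
  · rw [Int.ofNat_eq_natCast, intEquivNat_natCast, Int.natAbs_natCast]; omega
  · rw [intEquivNat_negSucc, Int.natAbs_negSucc]; omega

theorem isQ_iff (m : ℕ) : isQ m = true ↔ m ∈ Set.range encQ := by
  obtain ⟨⟨x, b⟩, rfl⟩ := Nat.pairEquiv.surjective m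
  obtain ⟨a, rfl⟩ := Equiv.intEquivNat.surjective x
  have h1 : isQ (Nat.pairEquiv (Equiv.intEquivNat a, b)) = true ↔ 0 < b ∧ a.natAbs.Coprime b := by
    simp only [isQ, Nat.pairEquiv_apply, Function.uncurry, Nat.unpair_pair, natAbs_eq,
      Bool.and_eq_true, beq_iff_eq, ← Nat.pos_iff_ne_zero, List.all_eq_true, List.mem_range, Bool.or_eq_true,
      Bool.not_eq_true', beq_eq_false_iff_ne]
    refine and_congr_right fun hb => ⟨fun h => ?_, fun h c hc => ?_⟩
    · have hg := h (a.natAbs.gcd b) (Nat.lt_succ_of_le (Nat.gcd_le_right _ hb))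
      have h1 := Nat.mod_eq_zero_of_dvd (Nat.gcd_dvd_left a.natAbs b)
      have h2 := Nat.mod_eq_zero_of_dvd (Nat.gcd_dvd_right a.natAbs b)
      have h3 := Nat.gcd_pos_of_pos_right a.natAbs hb
      rcases hg with (hg | hg) | hg
      · unfold Nat.Coprime; omega
      · exact absurd h1 hg.ne'
      · exact absurd h2 hg.ne'
    · by_contra hn
      push Not at hn
      have := Nat.dvd_gcd (Nat.dvd_of_mod_eq_zero (Nat.le_zero.1 hn.1.2))
        (Nat.dvd_of_mod_eq_zero (Nat.le_zero.1 hn.2))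
      rw [h] at this
      exact absurd (Nat.le_of_dvd one_pos this) (by omega)
  rw [h1]
  constructor
  · rintro ⟨hb, h⟩
    exact ⟨⟨a, b, hb.ne', h⟩, rfl⟩
  · rintro ⟨q, hq⟩
    rw [encQ_eq] at hq
    have := Nat.pairEquiv.injective (a₁ := (Equiv.intEquivNat q.num, q.den)) hq
    simp only [Prod.mk.injEq, EmbeddingLike.apply_eq_iff_eq] at this
    obtain ⟨rfl, rfl⟩ := this
    exact ⟨q.den_pos, q.reduced⟩

theorem encode_rat_eq (q : ℚ) : @Encodable.encode ℚ Primcodable.toEncodable q =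
    ((List.range (encQ q)).filter isQ).length := by
  rw [encode_rat, List.countP_eq_length_filter]
  congr 2
  funext m
  rw [Bool.eq_iff_iff, isQ_iff]
  exact @decide_eq_true_iff _ (Encodable.decidableRangeEncode ℚ m)

/-- The element of index `n` in the range of `encQ`. -/
def nthQ (n : ℕ) : ℕ := ((List.range (Nat.pair 2 (n + 1) + 1)).filter isQ).getD n 0

@[fun_prop] theorem pr_natPair {α : Type*} [Primcodable α] {f g : α → ℕ} (hf : Primrec f)
    (hg : Primrec g) : Primrec fun a => Nat.pair (f a) (g a) := Primrec₂.natPair.comp hf hg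

@[fun_prop] theorem pr_nthQ {α : Type*} [Primcodable α] {f : α → ℕ} (hf : Primrec f) :
    Primrec fun a => nthQ (f a) := by
  unfold nthQ; fun_prop

theorem le_length_filter_isQ {n m : ℕ} (h : Nat.pair 2 (n + 1) < m) :
    n + 1 ≤ ((List.range m).filter isQ).length := by
  let s : Finset ℕ := (Finset.range (n + 1)).image fun j => Nat.pair 2 (j + 1)
  have hs : s.card = n + 1 := by
    rw [Finset.card_image_of_injective, Finset.card_range]
    intro i j hij
    have := (Nat.pair_eq_pair.1 hij).2
    omega
  have hsub : s ⊆ (((List.range m).filter isQ).toFinset) := by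
    intro x hx
    obtain ⟨j, hj, rfl⟩ := Finset.mem_image.1 hx
    rw [List.mem_toFinset, List.mem_filter, List.mem_range, isQ_iff]
    have hj' : j + 1 ≤ n + 1 := by have := Finset.mem_range.1 hj; omega
    refine ⟨lt_of_le_of_lt ?_ h, ⟨⟨1, j + 1, by omega, by simp⟩, rfl⟩⟩
    rcases hj'.lt_or_eq with h | h
    · exact (Nat.pair_lt_pair_right 2 h).le
    · rw [h]
  calc n + 1 = s.card := hs.symm
    _ ≤ _ := Finset.card_le_card hsub
    _ ≤ _ := List.toFinset_card_le _

theorem nthQ_encode (q : ℚ) : nthQ (@Encodable.encode ℚ Primcodable.toEncodable q) = encQ q := by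
  rw [encode_rat_eq, nthQ]
  set n := ((List.range (encQ q)).filter isQ).length with hn
  have hlt : encQ q < Nat.pair 2 (n + 1) + 1 := by
    by_contra h
    have := le_length_filter_isQ (n := n) (m := encQ q) (by omega)
    omega
  obtain ⟨r, hr⟩ := Nat.exists_eq_add_of_lt hlt
  have h1 : Nat.pair 2 (n + 1) + 1 = encQ q + (r + 1) := by omega
  rw [h1, List.range_add, List.filter_append, List.getD_append_right _ _ _ _ (le_of_eq hn.symm),
    ← hn, Nat.sub_self, List.range_succ_eq_map]
  have h2 : isQ (encQ q) = true := (isQ_iff _).2 ⟨q, rfl⟩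
  simp [h2]

theorem pr_encQ : Primrec encQ :=
  (pr_nthQ (Primrec.encode (α := ℚ))).of_eq nthQ_encode

/-- The denominator of a rational. -/
def denN (q : ℚ) : ℕ := (encQ q).unpair.2

/-- The positive part of the numerator of a rational. -/
def posN (q : ℚ) : ℕ := posZ (encQ q).unpair.1

/-- The negative part of the numerator of a rational. -/
def negN (q : ℚ) : ℕ := negZ (encQ q).unpair.1

@[fun_prop] theorem pr_denN {α : Type*} [Primcodable α] {f : α → ℚ} (hf : Primrec f) :
    Primrec fun a => denN (f a) := by
  have := pr_encQ.comp hf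
  unfold denN; fun_prop

@[fun_prop] theorem pr_posN {α : Type*} [Primcodable α] {f : α → ℚ} (hf : Primrec f) :
    Primrec fun a => posN (f a) := by
  have := pr_encQ.comp hf
  unfold posN posZ; fun_prop

@[fun_prop] theorem pr_negN {α : Type*} [Primcodable α] {f : α → ℚ} (hf : Primrec f) :
    Primrec fun a => negN (f a) := by
  have := pr_encQ.comp hf
  unfold negN negZ; fun_prop

theorem denN_pos (q : ℚ) : 0 < denN q := by
  rw [denN, encQ_eq, Nat.unpair_pair]; exact q.den_pos

theorem rat_eq (q : ℚ) : (q : ℝ) = ((posN q : ℝ) - negN q) / denN q := by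
  rw [posN, negN, denN, encQ_eq, Nat.unpair_pair]
  have := posZ_sub_negZ q.num
  have h2 : ((posZ (Equiv.intEquivNat q.num) : ℝ) - negZ (Equiv.intEquivNat q.num)) = q.num := by
    exact_mod_cast this
  rw [h2]
  exact Rat.cast_def q

end QE

namespace QE
open PR

/-- A common denominator of the coefficients. -/
def comDen (c : PolyCode) : ℕ := c.foldr (fun e D => denN e.1 * D) 1

/-- The list of variables of a monomial, with multiplicity. -/
def varList (N : ℕ) (e : List ℕ) : List ℕ :=
  (List.range N).flatMap fun x => (List.range (e.getD x 0)).map fun _ => x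

/-- An integer polynomial with the same zeros as the coded rational polynomial. -/
def toPo (N : ℕ) (c : PolyCode) : Po :=
  c.map fun e => (posN e.1 * (comDen c / denN e.1), negN e.1 * (comDen c / denN e.1),
    varList N e.2)

@[fun_prop] theorem pr_comDen {α : Type*} [Primcodable α] {c : α → PolyCode} (hc : Primrec c) :
    Primrec fun a => comDen (c a) := by
  unfold comDen; fun_prop

@[fun_prop] theorem pr_varList {α : Type*} [Primcodable α] {N : α → ℕ} {e : α → List ℕ}
    (hN : Primrec N) (he : Primrec e) : Primrec fun a => varList (N a) (e a) := by
  unfold varList; fun_prop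

@[fun_prop] theorem pr_toPo {α : Type*} [Primcodable α] {N : α → ℕ} {c : α → PolyCode}
    (hN : Primrec N) (hc : Primrec c) : Primrec fun a => toPo (N a) (c a) := by
  unfold toPo; fun_prop

theorem comDen_pos (c : PolyCode) : 0 < comDen c := by
  induction c with
  | nil => exact one_pos
  | cons e c ih => exact Nat.mul_pos (denN_pos _) ih

theorem denN_dvd_comDen {c : PolyCode} {e : ℚ × List ℕ} (he : e ∈ c) : denN e.1 ∣ comDen c := by
  induction c with
  | nil => simp at he
  | cons e' c ih =>
    rcases List.mem_cons.1 he with rfl | h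
    · exact dvd_mul_right _ _
    · exact (ih h).mul_left _

theorem prod_varList (v : ℕ → ℝ) (N : ℕ) (e : List ℕ) :
    ((varList N e).map v).prod = ∏ x ∈ Finset.range N, v x ^ e.getD x 0 := by
  unfold varList
  induction N with
  | zero => simp
  | succ N ih =>
    rw [List.range_succ, List.flatMap_append, List.map_append, List.prod_append, ih,
      Finset.prod_range_succ]
    simp

theorem prod_range_mul {k n : ℕ} (g : ℕ → ℝ) :
    ∏ x ∈ Finset.range (k * n), g x = ∏ w : Fin k × Fin n, g (w.1 * n + w.2) := by
  rw [Finset.prod_range, ← finProdFinEquiv.prod_comp]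
  refine Finset.prod_congr rfl fun w _ => ?_
  simp [mul_comm, add_comm]

theorem decodePoly_cons (k n : ℕ) (e : ℚ × List ℕ) (c : PolyCode) :
    decodePoly k n (e :: c) = MvPolynomial.C e.1 *
      ∏ w : Fin k × Fin n, MvPolynomial.X w ^ (e.2.getD (w.1.1 * n + w.2.1) 0) +
        decodePoly k n c := by
  simp [decodePoly]

theorem ev_toPo {k n : ℕ} (c : PolyCode) (v : ℕ → ℝ) :
    ev v (toPo (k * n) c) = comDen c *
      MvPolynomial.aeval (fun w : Fin k × Fin n => v (w.1 * n + w.2)) (decodePoly k n c) := by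
  have key : ∀ (D : ℕ) (c : PolyCode), (∀ e ∈ c, denN e.1 ∣ D) →
      ev v (c.map fun e => (posN e.1 * (D / denN e.1), negN e.1 * (D / denN e.1),
        varList (k * n) e.2)) = D *
      MvPolynomial.aeval (fun w : Fin k × Fin n => v (w.1 * n + w.2)) (decodePoly k n c) := by
    intro D c
    induction c with
    | nil => simp [decodePoly]
    | cons e c ih =>
      intro h
      rw [List.map_cons, ev_cons, ih fun e' he' => h e' (List.mem_cons_of_mem _ he'),
        decodePoly_cons, map_add, mul_add]
      refine congrArg₂ _ ?_ rfl
      rw [evM, prod_varList, prod_range_mul]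
      simp only [map_mul, map_prod, map_pow, MvPolynomial.aeval_X, MvPolynomial.aeval_C]
      rw [← mul_assoc]
      refine congrArg₂ _ ?_ rfl
      obtain ⟨m, hm⟩ := h e List.mem_cons_self
      have hd := denN_pos e.1
      have hd' : (denN e.1 : ℝ) ≠ 0 := by exact_mod_cast hd.ne'
      rw [hm, Nat.mul_div_cancel_left _ hd, eq_ratCast, rat_eq]
      push_cast
      field_simp
  exact key (comDen c) c fun e => denN_dvd_comDen

theorem ev_toPo_eq_zero {k n : ℕ} (c : PolyCode) (v : ℕ → ℝ) :
    ev v (toPo (k * n) c) = 0 ↔ ZQ (decodePoly k n c) fun i j => v (i * n + j) := by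
  have : (comDen c : ℝ) ≠ 0 := by exact_mod_cast (comDen_pos c).ne'
  rw [ev_toPo, mul_eq_zero, or_iff_right this]
  rfl

end QE

namespace QE
open PR

namespace Def

variable {α : Type*} [Primcodable α] {k n d t M e : α → ℕ} {f : α → Po} {γ : α → QF}

theorem permD {w : α → ℕ → ℕ} (hk : Primrec k) (hn : Primrec n) (hf : Primrec f)
    (hw : Primrec fun p : α × ℕ => w p.1 p.2) :
    Def fun a v => PermD (k a) (n a) (f a) (w a) v := by
  have hw' : Primrec fun p : (α × ℕ) × ℕ => w p.1.1 (dig (k p.1.1) p.1.2 (p.2 / n p.1.1)) :=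
    hw.comp (g := fun p : (α × ℕ) × ℕ => (p.1.1, dig (k p.1.1) p.1.2 (p.2 / n p.1.1)))
      (by fun_prop)
  unfold PermD
  exact bex (A := fun a s v => IsPm (k a) s ∧
      ev (fun x => v (w a (dig (k a) s (x / n a)) * n a + x % n a)) (f a) = 0) (by fun_prop)
    (and (isPm (by fun_prop) (by fun_prop))
      (ren (A := fun (p : α × ℕ) v => ev v (f p.1) = 0)
        (ρ := fun p x => w p.1 (dig (k p.1) p.2 (x / n p.1)) * n p.1 + x % n p.1)
        (eq0 (by fun_prop)) (by fun_prop)))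

theorem compD (hk : Primrec k) (hd : Primrec d) (ht : Primrec t) (hM : Primrec M)
    (he : Primrec e) : Def fun a _ => CompD (k a) (d a) (t a) (M a) (e a) := by
  unfold CompD
  refine and ?_ ?_
  · exact ball (A := fun a i _ => ∀ j < k a,
        dig (M a ^ d a) (e a) i = dig (M a ^ d a) (e a) j → i = j) hk
      (ball (A := fun (p : α × ℕ) j _ =>
        dig (M p.1 ^ d p.1) (e p.1) p.2 = dig (M p.1 ^ d p.1) (e p.1) j → p.2 = j) (by fun_prop)
        (imp (eqn (by fun_prop) (by fun_prop)) (eqn (by fun_prop) (by fun_prop))))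
  · exact ball (A := fun a i _ => ∀ j < k a, ∀ c < d a,
        dig (k a) (t a) (i * d a + c) = dig (k a) (t a) (j * d a + c) →
        dig (M a) (dig (M a ^ d a) (e a) i) c = dig (M a) (dig (M a ^ d a) (e a) j) c) hk
      (ball (A := fun (p : α × ℕ) j _ => ∀ c < d p.1,
        dig (k p.1) (t p.1) (p.2 * d p.1 + c) = dig (k p.1) (t p.1) (j * d p.1 + c) →
        dig (M p.1) (dig (M p.1 ^ d p.1) (e p.1) p.2) c =
          dig (M p.1) (dig (M p.1 ^ d p.1) (e p.1) j) c) (by fun_prop)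
        (ball (A := fun (p : (α × ℕ) × ℕ) c _ =>
          dig (k p.1.1) (t p.1.1) (p.1.2 * d p.1.1 + c) =
            dig (k p.1.1) (t p.1.1) (p.2 * d p.1.1 + c) →
          dig (M p.1.1) (dig (M p.1.1 ^ d p.1.1) (e p.1.1) p.1.2) c =
            dig (M p.1.1) (dig (M p.1.1 ^ d p.1.1) (e p.1.1) p.2) c) (by fun_prop)
          (imp (eqn (by fun_prop) (by fun_prop)) (eqn (by fun_prop) (by fun_prop)))))

theorem embD (hk : Primrec k) (hn : Primrec n) (hd : Primrec d) (ht : Primrec t) (hM : Primrec M)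
    (hf : Primrec f) : Def fun a v => EmbD (k a) (n a) (d a) (t a) (M a) (f a) v := by
  unfold EmbD
  refine ex (A := fun a v => (∀ b < M a ^ d a, ∀ b' < M a ^ d a,
      (∀ j < n a, v (b * n a + j) = v (b' * n a + j)) → b = b') ∧
    ∀ e < (M a ^ d a) ^ k a, CompD (k a) (d a) (t a) (M a) e →
      PermD (k a) (n a) (f a) (fun i => dig (M a ^ d a) e i) v) (and ?_ ?_) (by fun_prop)
  · exact ball (A := fun a b v => ∀ b' < M a ^ d a,
        (∀ j < n a, v (b * n a + j) = v (b' * n a + j)) → b = b') (by fun_prop)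
      (ball (A := fun (p : α × ℕ) b' v =>
        (∀ j < n p.1, v (p.2 * n p.1 + j) = v (b' * n p.1 + j)) → p.2 = b') (by fun_prop)
        (imp (ball (A := fun (p : (α × ℕ) × ℕ) j v =>
          v (p.1.2 * n p.1.1 + j) = v (p.2 * n p.1.1 + j)) (by fun_prop)
          (eqv (by fun_prop) (by fun_prop))) (eqn (by fun_prop) (by fun_prop))))
  · exact ball (A := fun a e v => CompD (k a) (d a) (t a) (M a) e →
        PermD (k a) (n a) (f a) (fun i => dig (M a ^ d a) e i) v) (by fun_prop)
      (imp (compD (by fun_prop) (by fun_prop) (by fun_prop) (by fun_prop) (by fun_prop))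
        (permD (w := fun (p : α × ℕ) i => dig (M p.1 ^ d p.1) p.2 i) (by fun_prop) (by fun_prop)
          (by fun_prop) (by fun_prop)))

theorem boxD {N : α → ℕ} (hN : Primrec N) : Def fun a v => BoxD (N a) v :=
  ball (A := fun _ c v => 0 < v c ∧ v c < 1) hN
    (and (posv (by fun_prop)) (ltOne (by fun_prop)))

theorem certA (hn : Primrec n) (hd : Primrec d) (hγ : Primrec γ) :
    Def fun a v => CertA (n a) (d a) (γ a) v :=
  all (A := fun a v => BoxD (d a) v → ∃ Y, holds (app (n a) Y v) (γ a))
    (imp (boxD hd) (ex (A := fun a v => holds v (γ a)) (form hγ) hn)) hd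

theorem certB (hn : Primrec n) (hd : Primrec d) (hγ : Primrec γ) :
    Def fun a v => CertB (n a) (d a) (γ a) v := by
  refine all (A := fun a v => BoxD (d a) v → ∀ z, BoxD 1 (app 1 z v) → ∀ i < d a,
    app 1 z v (1 + i) ≠ app 1 z v 0 → ∀ Y,
      holds (fun j => app (n a) Y (app 1 z v) (if j < n a then j else j + 1)) (γ a) →
      ¬ holds (fun j => app (n a) Y (app 1 z v)
        (if j < n a then j else if j = n a + i then n a else j + 1)) (γ a))
    (imp (boxD hd) (all (N := fun _ => 1) (A := fun a v => BoxD 1 v → ∀ i < d a,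
      v (1 + i) ≠ v 0 → ∀ Y,
      holds (fun j => app (n a) Y v (if j < n a then j else j + 1)) (γ a) →
      ¬ holds (fun j => app (n a) Y v
        (if j < n a then j else if j = n a + i then n a else j + 1)) (γ a))
      (imp (boxD (by fun_prop)) (ball (A := fun a i v => v (1 + i) ≠ v 0 → ∀ Y,
        holds (fun j => app (n a) Y v (if j < n a then j else j + 1)) (γ a) →
        ¬ holds (fun j => app (n a) Y v
          (if j < n a then j else if j = n a + i then n a else j + 1)) (γ a)) hd
        (imp (not (eqv (by fun_prop) (by fun_prop))) ?_))) (by fun_prop))) hd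
  exact all (A := fun (p : α × ℕ) v =>
      holds (fun j => v (if j < n p.1 then j else j + 1)) (γ p.1) →
      ¬ holds (fun j => v (if j < n p.1 then j else if j = n p.1 + p.2 then n p.1 else j + 1))
        (γ p.1))
    (imp
      (ren (A := fun (p : α × ℕ) v => holds v (γ p.1))
        (ρ := fun p j => if j < n p.1 then j else j + 1) (form (by fun_prop)) (by fun_prop))
      (not (ren (A := fun (p : α × ℕ) v => holds v (γ p.1))
        (ρ := fun p j => if j < n p.1 then j else if j = n p.1 + p.2 then n p.1 else j + 1)
        (form (by fun_prop)) (by fun_prop)))) (by fun_prop)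

theorem compR (hk : Primrec k) (hd : Primrec d) (ht : Primrec t) :
    Def fun a v => CompR (k a) (d a) (t a) v := by
  unfold CompR
  refine and ?_ ?_
  · exact ball (A := fun a i v => ∀ j < k a,
        (∀ c < d a, v (i * d a + c) = v (j * d a + c)) → i = j) hk
      (ball (A := fun (p : α × ℕ) j v =>
        (∀ c < d p.1, v (p.2 * d p.1 + c) = v (j * d p.1 + c)) → p.2 = j) (by fun_prop)
        (imp (ball (A := fun (p : (α × ℕ) × ℕ) c v =>
          v (p.1.2 * d p.1.1 + c) = v (p.2 * d p.1.1 + c)) (by fun_prop)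
          (eqv (by fun_prop) (by fun_prop))) (eqn (by fun_prop) (by fun_prop))))
  · exact ball (A := fun a i v => ∀ j < k a, ∀ c < d a,
        dig (k a) (t a) (i * d a + c) = dig (k a) (t a) (j * d a + c) →
        v (i * d a + c) = v (j * d a + c)) hk
      (ball (A := fun (p : α × ℕ) j v => ∀ c < d p.1,
        dig (k p.1) (t p.1) (p.2 * d p.1 + c) = dig (k p.1) (t p.1) (j * d p.1 + c) →
        v (p.2 * d p.1 + c) = v (j * d p.1 + c)) (by fun_prop)
        (ball (A := fun (p : (α × ℕ) × ℕ) c v =>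
          dig (k p.1.1) (t p.1.1) (p.1.2 * d p.1.1 + c) =
            dig (k p.1.1) (t p.1.1) (p.2 * d p.1.1 + c) →
          v (p.1.2 * d p.1.1 + c) = v (p.2 * d p.1.1 + c)) (by fun_prop)
          (imp (eqn (by fun_prop) (by fun_prop)) (eqv (by fun_prop) (by fun_prop)))))

theorem certC (hk : Primrec k) (hn : Primrec n) (hd : Primrec d) (ht : Primrec t) (hf : Primrec f)
    (hγ : Primrec γ) : Def fun a v => CertC (k a) (n a) (d a) (t a) (f a) (γ a) v := by
  let ρ : α → ℕ → ℕ → ℕ := fun a i j => if j < n a then i * n a + j else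
      if j < n a + d a then k a * n a + (i * d a + (j - n a)) else
        k a * n a + (k a * d a + (j - (n a + d a)))
  refine all (A := fun a v => CompR (k a) (d a) (t a) v → BoxD (k a * d a) v → ∀ Y,
      (∀ i < k a, holds (fun j => app (k a * n a) Y v (ρ a i j)) (γ a)) →
        PermD (k a) (n a) (f a) (fun i => i) (app (k a * n a) Y v))
    (imp (compR hk hd ht) (imp (boxD (by fun_prop))
      (all (A := fun a v => (∀ i < k a, holds (fun j => v (ρ a i j)) (γ a)) →
        PermD (k a) (n a) (f a) (fun i => i) v) (imp ?_ (permD hk hn hf (by fun_prop)))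
        (by fun_prop)))) (by fun_prop)
  exact ball (A := fun a i v => holds (fun j => v (ρ a i j)) (γ a)) hk
    (ren (A := fun (p : α × ℕ) v => holds v (γ p.1)) (ρ := fun p j => ρ p.1 p.2 j)
      (form (by fun_prop)) (by fun_prop))

theorem certD (hk : Primrec k) (hn : Primrec n) (hd : Primrec d) (ht : Primrec t) (hf : Primrec f)
    (hγ : Primrec γ) : Def fun a v => CertD (k a) (n a) (d a) (t a) (f a) (γ a) v :=
  and (certA hn hd hγ) (and (certB hn hd hγ) (certC hk hn hd ht hf hγ))

end Def

end QE

namespace QE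
open PR

/-- The template whose points have the digits of `t` as coordinates. -/
def digT (k d t : ℕ) (hk : 0 < k) (i : Fin k) (c : Fin d) : Fin k :=
  ⟨dig k t (i * d + c), dig_lt hk _ _⟩

/-- Arithmetical form of being a template for which every coordinate is needed. -/
def TmD (k d t : ℕ) : Prop :=
  (∀ i < k, ∀ j < k, (∀ c < d, dig k t (i * d + c) = dig k t (j * d + c)) → i = j) ∧
    ∀ c < d, ∃ i < k, ∃ j < k, ¬ dig k t (i * d + c) = dig k t (j * d + c) ∧
      ∀ c' < d, ¬ c' = c → dig k t (i * d + c') = dig k t (j * d + c')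

theorem tmD_iff {k d t : ℕ} {τ : Fin k → Fin d → Fin k}
    (hτ : ∀ (i : Fin k) (c : Fin d), dig k t (i * d + c) = τ i c) : TmD k d t ↔ Tm τ := by
  refine and_congr ?_ ?_
  · constructor
    · intro h i j hij
      refine Fin.ext (h i i.2 j j.2 fun c hc => ?_)
      rw [hτ i ⟨c, hc⟩, hτ j ⟨c, hc⟩, hij]
    · intro h i hi j hj hij
      refine congrArg Fin.val (@h ⟨i, hi⟩ ⟨j, hj⟩ (funext fun c => Fin.ext ?_))
      rw [← hτ, ← hτ]
      exact hij c c.2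
  · constructor
    · intro h c
      obtain ⟨i, hi, j, hj, h1, h2⟩ := h c c.2
      refine ⟨⟨i, hi⟩, ⟨j, hj⟩, fun h => h1 ?_, fun c' hc' => Fin.ext ?_⟩
      · rw [hτ ⟨i, hi⟩, hτ ⟨j, hj⟩, h]
      · rw [← hτ, ← hτ]
        exact h2 c' c'.2 fun h => hc' (Fin.ext h)
    · intro h c hc
      obtain ⟨i, j, h1, h2⟩ := h ⟨c, hc⟩
      refine ⟨i, i.2, j, j.2, fun h => h1 (Fin.ext ?_), fun c' hc' hne => ?_⟩
      · rw [← hτ, ← hτ]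
        exact h
      · rw [hτ i ⟨c', hc'⟩, hτ j ⟨c', hc'⟩, h2 ⟨c', hc'⟩ fun h => hne (congrArg Fin.val h)]

theorem ZEmb.mono {k d n : ℕ} {α : Type*} {Z : (Fin k → Fin n → ℝ) → Prop} {τ : Fin k → Fin d → α}
    {M M' : ℕ} (h : ZEmb Z τ (Fin M')) (hM : M ≤ M') : ZEmb Z τ (Fin M) := by
  obtain ⟨g, hg, hq⟩ := h
  have hi : Function.Injective fun (x : Fin d → Fin M) c => Fin.castLE hM (x c) :=
    fun x y hxy => funext fun c => Fin.castLE_injective hM (congrFun hxy c)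
  exact ⟨fun x => g fun c => Fin.castLE hM (x c), hg.comp hi, fun q hc =>
    hq (fun i c => Fin.castLE hM (q i c)) ⟨hi.comp hc.1, fun i j c hij =>
      congrArg (Fin.castLE hM) (hc.2 i j c hij)⟩⟩

theorem mem_depthSet_iff_exists_cert {k n : ℕ} (hk : 2 ≤ k) {c : PolyCode} {δ : ℕ} :
    δ ∈ DepthSet k (zeroEdgesQ k n (decodePoly k n c)) ↔ ∃ y : ℕ × ℕ × QF,
      TmD k (δ + 1) y.1 ∧
        ∃ u, CertD k n (δ + 1) y.1 (toPo (k * n) c) y.2.2 (app y.2.1 u fun _ => 0) := by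
  have hk0 : 0 < k := by omega
  rw [mem_depthSet_iff hk0]
  constructor
  · rintro ⟨τ, hT, h⟩
    obtain ⟨N, γ, u, hC⟩ := (forall_zEmb_iff hk).1 h
    obtain ⟨t, -, ht⟩ := exists_dig₂ τ
    exact ⟨(t, N, γ), (tmD_iff ht).2 hT, u, (certD_iff (ev_toPo_eq_zero c) ht).2 hC⟩
  · rintro ⟨⟨t, N, γ⟩, hT, u, hC⟩
    have ht : ∀ (i : Fin k) (c : Fin (δ + 1)),
        dig k t (i * (δ + 1) + c) = digT k (δ + 1) t hk0 i c := fun _ _ => rfl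
    exact ⟨digT k (δ + 1) t hk0, (tmD_iff ht).1 hT, (forall_zEmb_iff hk).2
      ⟨N, γ, u, (certD_iff (ev_toPo_eq_zero c) ht).1 hC⟩⟩

theorem notMem_depthSet_iff_exists {k n : ℕ} (hk : 2 ≤ k) {c : PolyCode} {δ : ℕ} :
    δ ∉ DepthSet k (zeroEdgesQ k n (decodePoly k n c)) ↔ ∃ M : ℕ,
      ∀ t < k ^ (k * (δ + 1)), TmD k (δ + 1) t →
        ¬ EmbD k n (δ + 1) t M (toPo (k * n) c) fun _ => 0 := by
  have hk0 : 0 < k := by omega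
  rw [mem_depthSet_iff hk0]
  constructor
  · intro h
    push Not at h
    choose! m hm using h
    refine ⟨Finset.univ.sup m, fun t _ hT hE => ?_⟩
    have ht : ∀ (i : Fin k) (c : Fin (δ + 1)),
        dig k t (i * (δ + 1) + c) = digT k (δ + 1) t hk0 i c := fun _ _ => rfl
    exact hm _ ((tmD_iff ht).1 hT) (((embD_iff hk0 (ev_toPo_eq_zero c) ht _).1 hE).mono
      (Finset.le_sup (Finset.mem_univ _)))
  · rintro ⟨M, h⟩ ⟨τ, hT, hE⟩
    obtain ⟨t, ht, hd⟩ := exists_dig₂ τ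
    exact h t ht ((tmD_iff hd).2 hT) ((embD_iff hk0 (ev_toPo_eq_zero c) hd _).2 (hE M))

theorem Def.tmD {α : Type*} [Primcodable α] {k d t : α → ℕ} (hk : Primrec k) (hd : Primrec d)
    (ht : Primrec t) : Def fun a _ => TmD (k a) (d a) (t a) := by
  unfold TmD
  refine and ?_ ?_
  · exact ball (A := fun a i _ => ∀ j < k a,
        (∀ c < d a, dig (k a) (t a) (i * d a + c) = dig (k a) (t a) (j * d a + c)) → i = j) hk
      (ball (A := fun (p : α × ℕ) j _ => (∀ c < d p.1, dig (k p.1) (t p.1) (p.2 * d p.1 + c) =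
        dig (k p.1) (t p.1) (j * d p.1 + c)) → p.2 = j) (by fun_prop)
        (imp (ball (A := fun (p : (α × ℕ) × ℕ) c _ =>
          dig (k p.1.1) (t p.1.1) (p.1.2 * d p.1.1 + c) =
            dig (k p.1.1) (t p.1.1) (p.2 * d p.1.1 + c)) (by fun_prop)
          (eqn (by fun_prop) (by fun_prop))) (eqn (by fun_prop) (by fun_prop))))
  · refine ball (A := fun a c _ => ∃ i < k a, ∃ j < k a,
        ¬ dig (k a) (t a) (i * d a + c) = dig (k a) (t a) (j * d a + c) ∧
        ∀ c' < d a, ¬ c' = c →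
          dig (k a) (t a) (i * d a + c') = dig (k a) (t a) (j * d a + c')) hd
      (bex (A := fun (p : α × ℕ) i _ => ∃ j < k p.1,
        ¬ dig (k p.1) (t p.1) (i * d p.1 + p.2) = dig (k p.1) (t p.1) (j * d p.1 + p.2) ∧
        ∀ c' < d p.1, ¬ c' = p.2 → dig (k p.1) (t p.1) (i * d p.1 + c') =
          dig (k p.1) (t p.1) (j * d p.1 + c')) (by fun_prop)
        (bex (A := fun (p : (α × ℕ) × ℕ) j _ =>
          ¬ dig (k p.1.1) (t p.1.1) (p.2 * d p.1.1 + p.1.2) =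
            dig (k p.1.1) (t p.1.1) (j * d p.1.1 + p.1.2) ∧
          ∀ c' < d p.1.1, ¬ c' = p.1.2 → dig (k p.1.1) (t p.1.1) (p.2 * d p.1.1 + c') =
            dig (k p.1.1) (t p.1.1) (j * d p.1.1 + c')) (by fun_prop)
          (and (not (eqn (by fun_prop) (by fun_prop))) ?_)))
    exact ball (A := fun (p : ((α × ℕ) × ℕ) × ℕ) c' _ => ¬ c' = p.1.1.2 →
        dig (k p.1.1.1) (t p.1.1.1) (p.1.2 * d p.1.1.1 + c') =
          dig (k p.1.1.1) (t p.1.1.1) (p.2 * d p.1.1.1 + c')) (by fun_prop)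
      (imp (not (eqn (by fun_prop) (by fun_prop))) (eqn (by fun_prop) (by fun_prop)))

theorem rePred_exists {α β : Type*} [Primcodable α] [Primcodable β] {b : α × β → Bool}
    (hb : Primrec b) : REPred fun a => ∃ y, b (a, y) = true := by
  let g : α → ℕ → Bool := fun a w => ((Encodable.decode (α := β) w).map fun y => b (a, y)).getD false
  have hg : Primrec₂ g :=
    Primrec.option_getD.comp (Primrec.option_map (Primrec.decode.comp Primrec.snd)
      (hb.comp (Primrec.pair (Primrec.fst.comp Primrec.fst) Primrec.snd))) (Primrec.const false)
  have h : Partrec fun a => Nat.rfind fun w => Part.some (g a w) :=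
    Partrec.rfind hg.to_comp.partrec₂
  refine h.dom_re.of_eq fun a => Nat.rfind_dom'.trans ?_
  constructor
  · rintro ⟨w, hw, -⟩
    obtain ⟨_, hw'⟩ := hw
    change g a w = true at hw'
    simp only [g] at hw'
    cases hd : Encodable.decode (α := β) w with
    | none => simp [hd] at hw'
    | some y => exact ⟨y, by simpa [hd] using hw'⟩
  · rintro ⟨y, hy⟩
    exact ⟨Encodable.encode y, by simp [g, hy], fun _ => trivial⟩

theorem computablePred_mem_depthSet : ComputablePred fun x : (ℕ × ℕ × PolyCode) × ℕ =>
    x.2 ∈ DepthSet (x.1.1 + 2)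
      (zeroEdgesQ (x.1.1 + 2) x.1.2.1 (decodePoly (x.1.1 + 2) x.1.2.1 x.1.2.2)) := by
  rw [ComputablePred.computable_iff_re_compl_re']
  constructor
  · have hD : Def fun (p : ((ℕ × ℕ × PolyCode) × ℕ) × (ℕ × ℕ × QF)) v =>
        TmD (p.1.1.1 + 2) (p.1.2 + 1) p.2.1 ∧ ∃ u, CertD (p.1.1.1 + 2) p.1.1.2.1 (p.1.2 + 1) p.2.1
          (toPo ((p.1.1.1 + 2) * p.1.1.2.1) p.1.1.2.2) p.2.2.2 (app p.2.2.1 u v) :=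
      Def.and (Def.tmD (by fun_prop) (by fun_prop) (by fun_prop))
        (Def.ex (Def.certD (by fun_prop) (by fun_prop) (by fun_prop) (by fun_prop) (by fun_prop)
          (by fun_prop)) (by fun_prop))
    obtain ⟨b, hb, h⟩ := hD.decide
    refine (rePred_exists hb).of_eq fun x => ?_
    rw [mem_depthSet_iff_exists_cert (by omega)]
    exact exists_congr fun y => h (x, y)
  · have hD : Def fun (p : ((ℕ × ℕ × PolyCode) × ℕ) × ℕ) v =>
        ∀ t < (p.1.1.1 + 2) ^ ((p.1.1.1 + 2) * (p.1.2 + 1)), TmD (p.1.1.1 + 2) (p.1.2 + 1) t →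
          ¬ EmbD (p.1.1.1 + 2) p.1.1.2.1 (p.1.2 + 1) t p.2
            (toPo ((p.1.1.1 + 2) * p.1.1.2.1) p.1.1.2.2) v :=
      Def.ball (A := fun (p : ((ℕ × ℕ × PolyCode) × ℕ) × ℕ) t v =>
        TmD (p.1.1.1 + 2) (p.1.2 + 1) t → ¬ EmbD (p.1.1.1 + 2) p.1.1.2.1 (p.1.2 + 1) t p.2
            (toPo ((p.1.1.1 + 2) * p.1.1.2.1) p.1.1.2.2) v) (by fun_prop)
        (Def.imp (Def.tmD (by fun_prop) (by fun_prop) (by fun_prop))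
          (Def.not (Def.embD (by fun_prop) (by fun_prop) (by fun_prop) (by fun_prop) (by fun_prop)
            (by fun_prop))))
    obtain ⟨b, hb, h⟩ := hD.decide
    refine (rePred_exists hb).of_eq fun x => ?_
    rw [notMem_depthSet_iff_exists (by omega)]
    exact exists_congr fun y => h (x, y)

theorem exists_computable_mem_depthSet : ∃ g : ℕ × ℕ × PolyCode → ℕ → Bool, Computable₂ g ∧
    ∀ k n c δ, 2 ≤ k →
      (g (k, n, c) δ = true ↔ δ ∈ DepthSet k (zeroEdgesQ k n (decodePoly k n c))) := by
  obtain ⟨inst, hP⟩ := computablePred_mem_depthSet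
  have h : Primrec fun p : (ℕ × ℕ × PolyCode) × ℕ =>
      (((p.1.1 - 2, p.1.2) : ℕ × ℕ × PolyCode), p.2) := by fun_prop
  refine ⟨_, (hP.comp h.to_comp).to₂, fun k n c δ hk => ?_⟩
  obtain ⟨k, rfl⟩ := Nat.exists_eq_add_of_le' hk
  exact decide_eq_true_iff

/-- The least `i < m` with `g i`, or `m` if there is none. -/
def leastBelow (g : ℕ → Bool) (m : ℕ) : ℕ :=
  Nat.rec 0 (fun i r => cond (r == i && !g i) (i + 1) r) m

theorem leastBelow_spec (g : ℕ → Bool) (m : ℕ) : leastBelow g m ≤ m ∧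
    (∀ i < leastBelow g m, g i = false) ∧ (leastBelow g m < m → g (leastBelow g m) = true) := by
  induction m with
  | zero => exact ⟨le_rfl, fun i hi => absurd hi (Nat.not_lt_zero i), fun h => absurd h (lt_irrefl _)⟩
  | succ m ih =>
    obtain ⟨h1, h2, h3⟩ := ih
    have hs : leastBelow g (m + 1) =
      cond (leastBelow g m == m && !g m) (m + 1) (leastBelow g m) := rfl
    rw [hs]
    rcases h1.lt_or_eq with h | h
    · have : (leastBelow g m == m) = false := by simpa using h.ne
      rw [this]
      exact ⟨by simpa using h.le.trans (Nat.le_succ m), h2, fun _ => h3 h⟩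
    · rw [h] at h2 ⊢
      cases hm : g m
      · simp only [beq_self_eq_true, Bool.not_false, Bool.and_self, cond_true, lt_irrefl, le_refl,
          false_imp_iff, and_true, true_and]
        intro i hi
        rcases (Nat.lt_succ_iff.1 hi).lt_or_eq with h | rfl
        · exact h2 i h
        · exact hm
      · simpa [hm] using h2

/-- The least `i < m` with `g i`, if there is one. -/
def least? (g : ℕ → Bool) (m : ℕ) : Option ℕ :=
  cond (leastBelow g m == m) none (some (leastBelow g m))

theorem computable_leastBelow {α : Type*} [Primcodable α] {g : α → ℕ → Bool} {m : α → ℕ}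
    (hg : Computable₂ g) (hm : Computable m) : Computable fun a => leastBelow (g a) (m a) := by
  refine Computable.nat_rec (h := fun a p => cond (p.2 == p.1 && !g a p.1) (p.1 + 1) p.2) hm
    (Computable.const 0) ?_
  have h1 : Primrec fun p : (ℕ × ℕ) × Bool =>
      cond (p.1.2 == p.1.1 && !p.2) (p.1.1 + 1) p.1.2 := by fun_prop
  exact h1.to_comp.comp (Computable.pair Computable.snd
    (hg.comp Computable.fst (Computable.fst.comp Computable.snd)))

theorem computable_least? {α : Type*} [Primcodable α] {g : α → ℕ → Bool} {m : α → ℕ}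
    (hg : Computable₂ g) (hm : Computable m) : Computable fun a => least? (g a) (m a) := by
  have h : Primrec fun p : ℕ × ℕ => cond (p.1 == p.2) none (some p.1) :=
    Primrec.cond (by fun_prop) (Primrec.const none) (Primrec.option_some.comp Primrec.fst)
  exact h.to_comp.comp ((computable_leastBelow hg hm).pair hm)

end QE

/-- The depth function restricted to polynomials over `ℚ` is computable: a computable
function outputs `some δ` when the zero hypergraph of the given polynomial has depth
`δ < ω`, and `none` when its depth is `∞`. -/
theorem depth_computable :
    ∃ F : ℕ × ℕ × PolyCode → Option ℕ, Computable F ∧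
      ∀ k n : ℕ, 2 ≤ k → 1 ≤ n → ∀ c : PolyCode,
        (∀ δ : ℕ, F (k, n, c) = some δ ↔
            IsLeast (DepthSet k (zeroEdgesQ k n (decodePoly k n c))) δ) ∧
        (F (k, n, c) = none ↔ DepthSet k (zeroEdgesQ k n (decodePoly k n c)) = ∅) := by
  obtain ⟨g, hg, hgd⟩ := QE.exists_computable_mem_depthSet
  refine ⟨fun x => QE.least? (g x) x.1, QE.computable_least? hg Computable.fst,
    fun k n hk _ c => ?_⟩
  · obtain ⟨h1, h2, h3⟩ := QE.leastBelow_spec (g (k, n, c)) k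
    simp only [QE.least?]
    have hgd := fun δ => hgd k n c δ hk
    set D := DepthSet k (zeroEdgesQ k n (decodePoly k n c))
    set r := QE.leastBelow (g (k, n, c)) k
    have hlow : r ∈ lowerBounds D := fun δ hδ => by
      by_contra hlt
      have := h2 δ (not_le.1 hlt)
      rw [(hgd δ).2 hδ] at this
      exact absurd this (by simp)
    rcases h1.lt_or_eq with h | h
    · have hL : IsLeast D r := ⟨(hgd r).1 (h3 h), hlow⟩
      have hb : (r == k) = false := by simpa using h.ne
      simp only [hb, cond_false, Option.some.injEq, reduceCtorEq, false_iff]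
      refine ⟨fun δ => ⟨?_, fun hδ => hL.unique hδ⟩, fun he => ?_⟩
      · rintro rfl; exact hL
      · exact absurd hL.1 (he ▸ Set.notMem_empty r)
    · have hE : D = ∅ := Set.eq_empty_of_forall_notMem fun δ hδ => by
        have := hlow hδ
        have := QE.lt_of_mem_depthSet hk hδ
        omega
      simp [h, hE, IsLeast]
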